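/- Let p < q < r be distinct prime numbers and let H be a semisimple Hopf algebra over ℂ of dimension pqr. Then H contains a nontrivial group-like element (an element g ≠ 1 with Δ(g) = g ⊗ g and ε(g) = 1), and H admits a nontrivial one-dimensional representation (a ℂ-algebra homomorphism φ : H → ℂ with φ ≠ ε). -/

import Mathlib

set_option linter.all false
noncomputable section
namespace Pqr
open TensorProduct Coalgebra HopfAlgebra
open Coalgebra.Repr (arbitrary)
open Module (finrank End)
open Finset (card_erase_of_mem card_filter_le card_insert_of_notMem card_le_card card_nsmul_le_sum card_union_le card_union_of_disjoint mem_erase mem_filter mem_image_of_mem mem_insert mem_insert_of_mem mem_insert_self mem_inter mem_of_mem_erase mem_univ mul_sum single_le_sum sum_add_distrib sum_coe_sort sum_comm sum_congr sum_const sum_div sum_eq_single sum_eq_single_of_mem sum_eq_zero sum_eq_zero_iff_of_nonneg sum_equiv sum_fiberwise sum_fiberwise_of_maps_to sum_filter sum_insert sum_ite_eq sum_ite_mem sum_le_card_nsmul sum_le_sum sum_le_sum_of_subset sum_le_sum_of_subset_of_nonneg sum_lt_sum_of_subset sum_mul sum_mul_sum sum_nonneg sum_pair sum_pos sum_product sum_range_succ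 sum_singleton sum_smul sum_sub_distrib sum_subset univ univ_inter)
lemma scr {I M : Type*} [AddCommMonoid M] {s : Finset I} {f g : I → M} (h : ∀ i ∈ s, f i = g i) : s.sum f = s.sum g := Finset.sum_congr rfl h

section
def Du (A : Type*) [Ring A] [HopfAlgebra ℂ A] := WithConv (A →ₗ[ℂ] ℂ)

variable {A : Type*} [Ring A] [HopfAlgebra ℂ A]

instance : Ring (Du A) := inferInstanceAs (Ring (WithConv (A →ₗ[ℂ] ℂ)))
instance : Algebra ℂ (Du A) := inferInstanceAs (Algebra ℂ (WithConv (A →ₗ[ℂ] ℂ)))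

def toL : Du A ≃ₗ[ℂ] (A →ₗ[ℂ] ℂ) where
  toFun f := WithConv.ofConv f
  invFun f := WithConv.toConv f
  map_add' _ _ := rfl
  map_smul' _ _ := rfl
  left_inv _ := rfl
  right_inv _ := rfl

instance : CoeFun (Du A) (fun _ => A → ℂ) := ⟨fun f => toL f⟩

def ev (x : A) : Du A →ₗ[ℂ] ℂ := (LinearMap.applyₗ x) ∘ₗ toL.toLinearMap

@[simp] lemma ev_apply (x : A) (f : Du A) : ev x f = f x := rfl

instance [FiniteDimensional ℂ A] : FiniteDimensional ℂ (Du A) :=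
  letI : FiniteDimensional ℂ (A →ₗ[ℂ] ℂ) := inferInstance
  toL.symm.finiteDimensional

lemma finrank_du : finrank ℂ (Du A) = finrank ℂ A :=
  (toL.finrank_eq).trans Subspace.dual_finrank_eq

lemma du_ext {f g : Du A} (h : ∀ x, f x = g x) : f = g := toL.injective (LinearMap.ext h)

lemma du_mul (f g : Du A) {x : A} {ι : Type*} (r : Coalgebra.Repr ℂ x ι) :
    (f * g) x = ∑ i ∈ r.index, f (r.left i) * g (r.right i) :=
  r.convMul_apply (A := ℂ) f g

lemma du_mul' (f g : Du A) (x : A) :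
    (f * g) x = LinearMap.mul' ℂ ℂ (TensorProduct.map (toL f) (toL g) (comul (R := ℂ) x)) :=
  LinearMap.convMul_apply (A := ℂ) f g x

@[simp] lemma du_algebraMap (c : ℂ) (x : A) : (algebraMap ℂ (Du A) c) x = c * counit (R := ℂ) x := by
  rw [Algebra.algebraMap_eq_smul_one, map_smul, LinearMap.smul_apply, smul_eq_mul]
  congr 1

@[simp] lemma du_one (x : A) : (1 : Du A) x = counit (R := ℂ) x := LinearMap.convOne_apply (A := ℂ) x

def sl (N : Type*) [AddCommGroup N] [Module ℂ N] (x : A) : Du A ⊗[ℂ] N →ₗ[ℂ] N :=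
  TensorProduct.lid ℂ N ∘ₗ (ev x).rTensor N

@[simp] lemma sl_tmul {N : Type*} [AddCommGroup N] [Module ℂ N] (x : A) (f : Du A) (n : N) :
    sl N x (f ⊗ₜ n) = f x • n := by simp [sl]

variable [FiniteDimensional ℂ A]

lemma sl_sep {N : Type*} [AddCommGroup N] [Module ℂ N]
    {s t : Du A ⊗[ℂ] N} (h : ∀ x, sl N x s = sl N x t) : s = t := by
  classical
  let b := Module.finBasis ℂ A
  have key : ∀ t : Du A ⊗[ℂ] N, t = ∑ i, (toL.symm (b.coord i) : Du A) ⊗ₜ sl N (b i) t := by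
    intro t
    induction t with
    | zero => simp
    | add a c ha hc => conv_lhs => rw [ha, hc]
                       simp [tmul_add, sum_add_distrib]
    | tmul f n =>
      simp only [sl_tmul, ← smul_tmul]
      rw [← sum_tmul]
      congr 1
      apply du_ext; intro x
      have : f x = f (∑ i, b.coord i x • b i) := by
        rw [show ∑ i, b.coord i x • b i = x from b.sum_repr x]
      rw [this]
      simp [mul_comm]
  rw [key s, key t]; simp [h]

def E2 (x y : A) : Du A ⊗[ℂ] Du A →ₗ[ℂ] ℂ := ev y ∘ₗ sl _ x
@[simp] lemma E2_tmul (x y : A) (f g : Du A) : E2 x y (f ⊗ₜ g) = f x * g y := by simp [E2]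

lemma E2_sep {s t : Du A ⊗[ℂ] Du A} (h : ∀ x y, E2 x y s = E2 x y t) :
    s = t := sl_sep fun x => du_ext fun y => h x y

def duComul : Du A →ₗ[ℂ] Du A ⊗[ℂ] Du A :=
  let b := Module.finBasis ℂ A
  ∑ i, (TensorProduct.mk ℂ (Du A) (Du A) (toL.symm (b.coord i))) ∘ₗ
    toL.symm.toLinearMap ∘ₗ
    LinearMap.lcomp ℂ ℂ (LinearMap.mulLeft ℂ (b i)) ∘ₗ toL.toLinearMap

lemma E2_duComul (f : Du A) (x y : A) : E2 x y (duComul f) = f (x * y) := by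
  let b := Module.finBasis ℂ A
  have : f (x * y) = f ((∑ i, b.coord i x • b i) * y) := by
        rw [show ∑ i, b.coord i x • b i = x from b.sum_repr x]
  rw [this]
  rw [sum_mul, map_sum]
  simp [duComul, LinearMap.sum_apply, b]

instance : CoalgebraStruct ℂ (Du A) where
  comul := duComul
  counit := ev 1

lemma E2_comul (f : Du A) (x y : A) :
    E2 x y (comul (R := ℂ) f) = f (x * y) := E2_duComul f x y
@[simp] lemma du_counit (f : Du A) : counit (R := ℂ) f = f 1 := rfl

lemma du_repr {f : Du A} {ι : Type*} (r : Coalgebra.Repr ℂ f ι) (x y : A) :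
    ∑ i ∈ r.index, r.left i x * r.right i y = f (x * y) := by
  rw [← E2_comul, ← r.eq]; simp

instance : Coalgebra ℂ (Du A) where
  coassoc := by
    ext1 f
    refine sl_sep fun x => sl_sep fun y => du_ext fun z => ?_
    have h1 : ∀ t : Du A ⊗[ℂ] Du A, ∀ g : Du A, (sl _ y (sl _ x (TensorProduct.assoc ℂ _ _ _ (t ⊗ₜ[ℂ] g)))) z
        = E2 x y t * g z := by
      intro t g
      induction t with
      | zero => simp
      | add a c ha hc => simp only [add_tmul, map_add, LinearMap.add_apply, ha, hc, add_mul]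
      | tmul a c => simp [mul_assoc]
    have h2 : ∀ t : Du A ⊗[ℂ] Du A, ∀ g : Du A, (sl _ y (sl _ x (g ⊗ₜ[ℂ] t))) z
        = g x * E2 y z t := by
      intro t g
      simp [E2]
    have r := arbitrary ℂ f
    simp only [LinearMap.comp_apply]
    rw [← r.eq]
    simp only [map_sum, LinearMap.sum_apply, LinearMap.rTensor_tmul, LinearMap.lTensor_tmul,
      LinearEquiv.coe_coe, h1, h2, E2_comul, du_repr, mul_assoc]
  rTensor_counit_comp_comul := by
    ext1 f
    have r := arbitrary ℂ f
    apply (TensorProduct.lid ℂ _).injective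
    apply du_ext; intro x
    simp only [LinearMap.comp_apply]
    rw [← r.eq]
    simp [map_sum, LinearMap.sum_apply, du_repr]
  lTensor_counit_comp_comul := by
    ext1 f
    have r := arbitrary ℂ f
    apply (TensorProduct.rid ℂ _).injective
    apply du_ext; intro x
    simp only [LinearMap.comp_apply]
    rw [← r.eq]
    simp [map_sum, LinearMap.sum_apply]
    simp_rw [mul_comm (r.right _ 1)]
    simp [du_repr]

lemma E2_mul_aux (s t : Du A ⊗[ℂ] Du A) (x y : A) {ι κ : Type*} (r : Coalgebra.Repr ℂ x ι) (q : Coalgebra.Repr ℂ y κ) :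
    E2 x y (s * t) = ∑ i ∈ r.index, ∑ j ∈ q.index, E2 (r.left i) (q.left j) s * E2 (r.right i) (q.right j) t := by
  induction s with
  | zero => simp
  | add a b ha hb => simp [add_mul, ha, hb, sum_add_distrib]
  | tmul a b =>
    induction t with
    | zero => simp
    | add c d hc hd => simp only [mul_add, map_add, hc, hd, sum_add_distrib]
    | tmul c d =>
      simp only [Algebra.TensorProduct.tmul_mul_tmul, E2_tmul, du_mul _ _ r, du_mul _ _ q,
        sum_mul_sum]
      refine scr fun i _ => scr fun j _ => by ring

instance duBialgebra : Bialgebra ℂ (Du A) :=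
  Bialgebra.mk' ℂ (Du A) (by simp)
    (by intro a b
        rw [du_counit, du_counit, du_counit, du_mul', Bialgebra.comul_one]
        simp [Algebra.TensorProduct.one_def])
    (by refine E2_sep fun x y => ?_
        rw [E2_comul]; simp [Algebra.TensorProduct.one_def])
    (by intro a b
        refine E2_sep fun x y => ?_
        have r := arbitrary ℂ x
        have q := arbitrary ℂ y
        rw [E2_comul, E2_mul_aux _ _ x y r q, du_mul', Bialgebra.comul_mul, ← r.eq, ← q.eq]
        simp [sum_mul_sum, E2_comul])

instance duHopf : HopfAlgebra ℂ (Du A) where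
  antipode := toL.symm.toLinearMap ∘ₗ
    LinearMap.lcomp ℂ ℂ (antipode ℂ (A := A)) ∘ₗ toL.toLinearMap
  mul_antipode_rTensor_comul := by
    ext1 f
    apply du_ext; intro x
    have r := arbitrary ℂ f
    have q := arbitrary ℂ x
    simp only [LinearMap.comp_apply]
    rw [← r.eq]
    simp only [map_sum, LinearMap.sum_apply, LinearMap.rTensor_tmul, LinearMap.mul'_apply,
      du_mul _ _ q]
    rw [sum_comm]
    have : ∀ j, ∑ i ∈ r.index, r.left i (antipode ℂ (q.left j)) * r.right i (q.right j) =
      f (antipode ℂ (q.left j) * q.right j) := fun j => du_repr r _ _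
    refine (scr fun j _ => this j).trans ?_
    rw [← map_sum, sum_antipode_mul_eq_smul q]
    simp [mul_comm]
  mul_antipode_lTensor_comul := by
    ext1 f
    apply du_ext; intro x
    have r := arbitrary ℂ f
    have q := arbitrary ℂ x
    simp only [LinearMap.comp_apply]
    rw [← r.eq]
    simp only [map_sum, LinearMap.sum_apply, LinearMap.lTensor_tmul, LinearMap.mul'_apply,
      du_mul _ _ q]
    rw [sum_comm]
    have : ∀ j, ∑ i ∈ r.index, r.left i (q.left j) * r.right i (antipode ℂ (q.right j)) =
      f (q.left j * antipode ℂ (q.right j)) := fun j => du_repr r _ _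
    refine (scr fun j _ => this j).trans ?_
    rw [← map_sum, sum_mul_antipode_eq_smul q]
    simp [mul_comm]

@[simp] lemma du_antipode (f : Du A) (x : A) : (antipode ℂ f) x = f (antipode ℂ x) := rfl
end

section
section conv
abbrev Cv (C B : Type*) [AddCommGroup C] [Module ℂ C] [Ring B] [Algebra ℂ B] := WithConv (C →ₗ[ℂ] B)
variable {C B : Type*} [AddCommGroup C] [Module ℂ C] [Coalgebra ℂ C] [Ring B] [Algebra ℂ B]

lemma sum_counit_smul_r {c : C} {ι : Type*} (r : Coalgebra.Repr ℂ c ι) :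
    ∑ x ∈ r.index, counit (R := ℂ) (r.right x) • r.left x = c := by
  have := congr(TensorProduct.rid ℂ C $(sum_tmul_counit_eq (R := ℂ) r))
  simpa only [map_sum, TensorProduct.rid_tmul, one_smul] using this

def io (b : B) : Cv C B := WithConv.toConv ((counit (R := ℂ) (A := C)).smulRight b)

@[simp] lemma io_apply (b : B) (c : C) : (io b : Cv C B).ofConv c = counit (R := ℂ) c • b := rfl

@[simp] lemma conv_io (f : Cv C B) (b : B) (c : C) : (f * io b : Cv C B).ofConv c = f c * b := by
  have r := arbitrary ℂ c
  rw [r.convMul_apply]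
  simp only [io_apply, mul_smul_comm, ← smul_mul_assoc, ← map_smul]
  rw [← sum_mul, ← map_sum, sum_counit_smul_r r]

@[simp] lemma io_conv (f : Cv C B) (b : B) (c : C) : (io b * f : Cv C B).ofConv c = b * f c := by
  have r := arbitrary ℂ c
  rw [r.convMul_apply]
  simp only [io_apply, smul_mul_assoc, ← mul_smul_comm, ← map_smul]
  rw [← mul_sum, ← map_sum, Coalgebra.sum_counit_smul r]

lemma io_mul (b b' : B) : (io (b * b') : Cv C B) = io b * io b' := by
  ext c
  rw [io_conv]
  simp
end conv

variable {A : Type*} [Ring A] [HopfAlgebra ℂ A]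

abbrev S : A →ₗ[ℂ] A := antipode ℂ (A := A)
lemma S_mul (a b : A) : S (a * b) = S b * S a := antipode_mul_antidistrib a b
lemma S2_mul (a b : A) : S (S (a * b)) = S (S a) * S (S b) := by rw [S_mul, S_mul]

abbrev eps (x : A) : ℂ := counit (R := ℂ) x

lemma theta_key {x : A} {ι : Type*} (r : Coalgebra.Repr ℂ x ι) :
    ∑ i ∈ r.index, comul (R := ℂ) (r.left i) * (1 ⊗ₜ S (r.right i)) = x ⊗ₜ[ℂ] (1 : A) := by
  let i1 : Cv A (A ⊗[ℂ] A) := WithConv.toConv (Algebra.TensorProduct.includeLeft : A →ₐ[ℂ] A ⊗[ℂ] A).toLinearMap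
  let i2 : Cv A (A ⊗[ℂ] A) := WithConv.toConv (Algebra.TensorProduct.includeRight : A →ₐ[ℂ] A ⊗[ℂ] A).toLinearMap
  let i2S : Cv A (A ⊗[ℂ] A) := WithConv.toConv ((Algebra.TensorProduct.includeRight : A →ₐ[ℂ] A ⊗[ℂ] A).toLinearMap ∘ₗ S)
  have h1 : (WithConv.toConv (comul (R := ℂ)) : Cv A (A ⊗[ℂ] A)) = i1 * i2 := by
    ext y
    have q := arbitrary ℂ y
    rw [q.convMul_apply]
    simp [i1, i2, q.eq]
  have h2 : i2 * i2S = 1 := by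
    ext y
    have q := arbitrary ℂ y
    rw [q.convMul_apply]
    simp only [i2, i2S, AlgHom.toLinearMap_apply, LinearMap.comp_apply, Algebra.TensorProduct.includeRight_apply,
      Algebra.TensorProduct.tmul_mul_tmul, one_mul]
    rw [← tmul_sum, sum_mul_antipode_eq_smul q]
    simp [Algebra.TensorProduct.one_def, Algebra.algebraMap_eq_smul_one]
  have h3 : (WithConv.toConv (comul (R := ℂ)) : Cv A (A ⊗[ℂ] A)) * i2S = i1 := by
    rw [h1, mul_assoc, h2, mul_one]
  have h4 := congr((($h3).ofConv x))
  rw [r.convMul_apply] at h4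
  simpa [i1, i2S] using h4

variable [FiniteDimensional ℂ A]

abbrev tr {V : Type*} [AddCommGroup V] [Module ℂ V] : End ℂ V →ₗ[ℂ] ℂ := LinearMap.trace ℂ V
abbrev Lm (x : A) : End ℂ A := LinearMap.mulLeft ℂ x

def rh : Du A →ₗ[ℂ] End ℂ A :=
  LinearMap.mk₂ ℂ (fun f x => TensorProduct.lid ℂ A ((toL f).rTensor A (comul (R := ℂ) x)))
    (by intro a b x; simp [LinearMap.rTensor_add]) (by intro c a x; simp [LinearMap.rTensor_smul])
    (by intro a b x; simp) (by intro c a x; simp)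

lemma rh_repr (f : Du A) {x : A} {ι : Type*} (r : Coalgebra.Repr ℂ x ι) :
    rh f x = ∑ i ∈ r.index, f (r.left i) • r.right i := by
  simp [rh, ← r.eq]

lemma du_rh (f g : Du A) (x : A) : g (rh f x) = (f * g) x := by
  have r := arbitrary ℂ x
  rw [rh_repr f r, du_mul f g r]; simp

lemma du_sep {x y : A} (h : ∀ g : Du A, g x = g y) : x = y := by
  rw [← sub_eq_zero]
  refine (Module.forall_dual_apply_eq_zero_iff ℂ _).1 fun g => ?_
  have := h (toL.symm g)
  simp only [LinearEquiv.apply_symm_apply] at this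
  simp [this]

lemma rh_mul (f g : Du A) : rh (f * g) = rh g * rh f := by
  ext x; refine du_sep fun k => ?_
  simp [du_rh, mul_assoc]

lemma rh_one : rh (1 : Du A) = 1 := by
  ext x; refine du_sep fun k => ?_
  simp [du_rh]

lemma rh_S2 (f : Du A) : rh f * (S * S) = (S * S) * rh (S (S f)) := by
  ext x; refine du_sep fun k => ?_
  simp only [Module.End.mul_apply, du_rh, ← du_antipode (A := A)]
  rw [← S2_mul]

lemma rh_Lm (f : Du A) (x : A) {ι : Type*} (r : Coalgebra.Repr ℂ f ι) :
    rh f * Lm x = ∑ i ∈ r.index, Lm (rh (r.left i) x) * rh (r.right i) := by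
  ext y
  have p := arbitrary ℂ x
  have q := arbitrary ℂ y
  have h1 : rh f (x * y) = ∑ i ∈ p.index, ∑ j ∈ q.index, f (p.left i * q.left j) • (p.right i * q.right j) := by
    simp [rh, Bialgebra.comul_mul, ← p.eq, ← q.eq, sum_mul_sum]
  simp only [Module.End.mul_apply, LinearMap.mulLeft_apply, h1, LinearMap.sum_apply, rh_repr _ p, rh_repr _ q,
    ← du_repr r, sum_mul_sum, sum_smul, smul_mul_smul_comm]
  refine (scr fun i _ => sum_comm).trans ?_
  exact sum_comm

def lam : Du A := toL.symm (tr ∘ₗ LinearMap.mulRight ℂ (S * S : End ℂ A) ∘ₗ (LinearMap.mul ℂ A))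

lemma lam_apply (x : A) : lam x = tr (Lm x * (S * S)) := by
  simp only [lam, LinearEquiv.apply_symm_apply]; rfl

lemma lam_rh (f : Du A) (x : A) : lam (rh f x) = f 1 * lam x := by
  let r : Cv (Du A) (End ℂ A) := WithConv.toConv rh
  let rS : Cv (Du A) (End ℂ A) := WithConv.toConv (rh ∘ₗ S)
  let rS2 : Cv (Du A) (End ℂ A) := WithConv.toConv (rh ∘ₗ S ∘ₗ S)
  let l : Cv (Du A) (End ℂ A) := WithConv.toConv (LinearMap.mul ℂ A ∘ₗ rh.flip x)
  have h1 : r * io (Lm x) = l * r := by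
    ext1; ext1 g
    have q := arbitrary ℂ g
    rw [conv_io, q.convMul_apply]
    exact rh_Lm g x q
  have h2 : r * io (S * S) = io (S * S) * rS2 := by
    ext1; ext1 g
    rw [conv_io, io_conv]
    exact rh_S2 g
  have h3 : rS2 * rS = 1 := by
    ext1; ext1 g
    have q := arbitrary ℂ g
    rw [q.convMul_apply]
    simp only [rS2, rS, LinearMap.comp_apply, ← rh_mul, ← S_mul, ← map_sum]
    rw [sum_antipode_mul_eq_smul q]
    simp [rh_one, antipode_one, Algebra.algebraMap_eq_smul_one]
  have h4 : l * io (S * S) = r * io (Lm x * (S * S)) * rS := by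
    rw [io_mul (Lm x), ← mul_assoc r, h1, mul_assoc l, h2, mul_assoc, mul_assoc, h3, mul_one]
  have h5 := congr(tr (($h4).ofConv f))
  have q := arbitrary ℂ f
  rw [conv_io, q.convMul_apply] at h5
  simp only [conv_io, map_sum] at h5
  rw [lam_apply, lam_apply]
  refine h5.trans ?_
  have h6 : ∀ i, tr (r.ofConv (q.left i) * (Lm x * (S * S)) * rS.ofConv (q.right i))
      = tr ((Lm x * (S * S)) * rh (q.left i * S (q.right i))) := by
    intro i
    rw [rh_mul, mul_assoc, LinearMap.trace_mul_comm, mul_assoc]; rfl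
  simp only [h6]
  rw [← map_sum, ← mul_sum, ← map_sum, sum_mul_antipode_eq_smul q, map_smul, rh_one]
  simp

lemma lam_int (f : Du A) : f * lam = f 1 • lam := by
  apply du_ext; intro x
  rw [← du_rh, lam_rh]; simp

lemma lam_cyc (x y : A) : lam (x * y) = lam (y * S (S x)) := by
  have h1 : Lm (x * y) * (S * S) = Lm x * (Lm y * (S * S)) := by ext z; simp [mul_assoc]
  have h2 : Lm (y * S (S x)) * (S * S) = (Lm y * (S * S)) * Lm x := by ext z; simp [mul_assoc, S_mul]
  rw [lam_apply, lam_apply, h1, h2, LinearMap.trace_mul_comm]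
end

section
variable {A : Type*} [Ring A] [HopfAlgebra ℂ A]

structure IsInt (L : A) : Prop where
  left : ∀ x, x * L = eps x • L
  right : ∀ x, L * x = eps x • L
  norm : eps L = 1

def rt (f : Du A) (y : A) : Du A := toL.symm (toL f ∘ₗ LinearMap.mulRight ℂ y)
@[simp] lemma rt_apply (f : Du A) (y x : A) : rt f y x = f (x * y) := rfl

def pr (f g : Du A) : A ⊗[ℂ] A →ₗ[ℂ] ℂ := LinearMap.mul' ℂ ℂ ∘ₗ TensorProduct.map (toL f) (toL g)
@[simp] lemma pr_tmul (f g : Du A) (x y : A) : pr f g (x ⊗ₜ y) = f x * g y := rfl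
lemma pr_comul (f g : Du A) (x : A) : pr f g (comul x) = (f * g) x := (du_mul' f g x).symm
lemma pr_left (f g : Du A) (t : A ⊗[ℂ] A) (x : A) : pr f g (t * (x ⊗ₜ 1)) = pr (rt f x) g t := by
  induction t with
  | zero => simp
  | add a b ha hb => rw [add_mul, map_add, map_add, ha, hb]
  | tmul a b => simp
lemma pr_right (f g : Du A) (t : A ⊗[ℂ] A) (x : A) : pr f g (t * (1 ⊗ₜ x)) = pr f (rt g x) t := by
  induction t with
  | zero => simp
  | add a b ha hb => rw [add_mul, map_add, map_add, ha, hb]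
  | tmul a b => simp

namespace IsInt
variable {L : A} (h : IsInt L)
include h

lemma comul_swap (x : A) : comul (R := ℂ) L * (x ⊗ₜ 1) = comul (R := ℂ) L * (1 ⊗ₜ[ℂ] S x) := by
  have r := arbitrary ℂ x
  rw [← theta_key r, mul_sum]
  simp only [← mul_assoc, ← Bialgebra.comul_mul, h.right, map_smul, smul_mul_assoc, ← mul_smul_comm]
  rw [← mul_sum]
  congr 1
  simp only [← tmul_smul, ← map_smul]
  rw [← tmul_sum, ← map_sum, Coalgebra.sum_counit_smul r]

lemma swap (f g : Du A) (x : A) : (rt f x * g) L = (f * rt g (S x)) L := by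
  rw [← pr_comul, ← pr_comul, ← pr_left, ← pr_right, h.comul_swap]

variable [FiniteDimensional ℂ A]

lemma lam_L : lam L = 1 := by
  rw [lam_apply]
  have : Lm L * (S * S) = (counit (R := ℂ) (A := A)).smulRight L := by
    ext y; simp [h.right]
  rw [this]
  simp [LinearMap.trace_smulRight, h.norm]

lemma int_pair {m : Du A} (hm : ∀ f : Du A, f * m = f 1 • m) (g : Du A) (x : A) :
    (g * rt m (S x)) L = g x * m L := by
  rw [← h.swap, hm]; simp

lemma pair (g : Du A) (x : A) : (g * rt lam (S x)) L = g x := by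
  rw [h.int_pair lam_int, h.lam_L, mul_one]

lemma nondegS {x : A} (hx : ∀ y, lam (y * S x) = 0) : x = 0 := by
  refine du_sep fun g => ?_
  have : rt lam (S x) = 0 := du_ext fun y => by simpa using hx y
  rw [← h.pair g x, this]; simp

lemma S_bij : Function.Bijective (S : A → A) := by
  have : Function.Injective (S : A →ₗ[ℂ] A) := by
    rw [injective_iff_map_eq_zero]
    intro x hx
    exact h.nondegS fun y => by simp [hx]
  exact ⟨this, LinearMap.injective_iff_surjective.1 this⟩

lemma nondeg {x : A} (hx : ∀ y, lam (y * x) = 0) : x = 0 := by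
  obtain ⟨z, rfl⟩ := h.S_bij.2 x
  rw [h.nondegS hx, map_zero]

lemma nondegL {x : A} (hx : ∀ y, lam (x * y) = 0) : x = 0 := by
  have : S (S x) = 0 := h.nondeg fun y => by rw [← lam_cyc, hx]
  exact h.S_bij.1 (h.S_bij.1 (by simp [this]))

lemma rep (f : Du A) : ∃ x, f = rt lam (S x) := by
  let F : A →ₗ[ℂ] Du A := toL.symm.toLinearMap ∘ₗ (LinearMap.mul ℂ A).flip.compr₂ (toL lam) ∘ₗ S
  have hF : ∀ x, F x = rt lam (S x) := fun x => rfl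
  have hi : Function.Injective F := by
    rw [injective_iff_map_eq_zero]
    intro x hx
    refine h.nondegS fun y => ?_
    rw [← rt_apply, ← hF, hx]; simp
  have := (LinearMap.injective_iff_surjective_of_finrank_eq_finrank (finrank_du (A := A)).symm).1 hi f
  obtain ⟨x, hx⟩ := this
  exact ⟨x, by rw [← hF, hx]⟩

lemma dual_nondeg {f : Du A} (hf : ∀ g : Du A, (g * f) L = 0) : f = 0 := by
  obtain ⟨x, rfl⟩ := h.rep f
  have : x = 0 := du_sep fun g => by rw [← h.pair, hf]; simp
  apply du_ext; simp [this]

lemma int_unique {m : Du A} (hm : ∀ f : Du A, f * m = f 1 • m) : m = m L • lam := by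
  rw [← sub_eq_zero]
  refine h.dual_nondeg fun g => ?_
  rw [mul_sub, mul_smul_comm, hm, lam_int]
  simp [h.lam_L, mul_comm]

lemma S_L : S L = L := by
  have h1 : S L * L = L := by rw [h.left]; simp [h.norm]
  obtain ⟨z, hz⟩ := h.S_bij.2 L
  have h2 : S L * L = S L := by
    have : S L * S z = S L := by
      rw [← S_mul, h.left, map_smul]
      have : eps z = 1 := by rw [← h.norm, ← hz]; simp
      rw [this, one_smul]
    rwa [hz] at this
  rw [← h2, h1]

lemma lam_mul (f : Du A) : lam * f = f (rh lam L) • lam := by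
  rw [du_rh]
  exact h.int_unique fun g => by rw [← mul_assoc, lam_int]; simp

lemma a_mul (f g : Du A) : (f * g) (rh lam L) = f (rh lam L) * g (rh lam L) := by
  rw [du_rh, ← mul_assoc, h.lam_mul f, smul_mul_assoc, h.lam_mul g]
  simp [h.lam_L]

lemma eps_a : eps (rh lam L) = 1 := by
  have := du_rh lam 1 L
  rw [mul_one, h.lam_L] at this
  simpa using this

omit h in
lemma pr_sep {s t : A ⊗[ℂ] A} (hst : ∀ f g, pr f g s = pr f g t) : s = t := by
  let b := Module.finBasis ℂ A
  refine (b.tensorProduct b).ext_elem fun ij => ?_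
  have := hst (toL.symm (b.coord ij.1)) (toL.symm (b.coord ij.2))
  have key : ∀ u : A ⊗[ℂ] A, pr (toL.symm (b.coord ij.1)) (toL.symm (b.coord ij.2)) u = (b.tensorProduct b).repr u ij := by
    intro u
    induction u with
    | zero => simp
    | add x y hx hy => simp [hx, hy]
    | tmul x y => rw [Module.Basis.tensorProduct_repr_tmul_apply]; simp [mul_comm]
  rw [← key, ← key, this]

lemma comul_a : comul (R := ℂ) (rh lam L) = (rh lam L) ⊗ₜ (rh lam L) :=
  pr_sep fun f g => by rw [pr_comul, h.a_mul, pr_tmul]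

lemma a_gl : IsGroupLikeElem ℂ (rh lam L) := ⟨h.eps_a, h.comul_a⟩

lemma S_a : S (rh lam L) * (rh lam L) = 1 := by
  have := mul_antipode_rTensor_comul_apply (R := ℂ) (rh lam L)
  rw [h.comul_a] at this
  simpa [h.eps_a] using this
lemma a_S : (rh lam L) * S (rh lam L) = 1 := by
  have := mul_antipode_lTensor_comul_apply (R := ℂ) (rh lam L)
  rw [h.comul_a] at this
  simpa [h.eps_a] using this

lemma S_S_a : S (S (rh lam L)) = rh lam L := by
  have h1 := congrArg S h.a_S
  rw [S_mul, antipode_one] at h1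
  calc S (S (rh lam L)) = S (S (rh lam L)) * (S (rh lam L) * rh lam L) := by rw [h.S_a, mul_one]
    _ = _ := by rw [← mul_assoc, h1, one_mul]

lemma lam_Sa (x : A) : lam (S x * rh lam L) = lam x := by
  set a := rh lam L with ha
  have hr : ∀ f : Du A, rt lam a * f = f 1 • rt lam a := by
    intro f
    have h1 : ∀ f g : Du A, rt f a * rt g a = rt (f * g) a := by
      intro f g; apply du_ext; intro x
      rw [rt_apply, ← pr_comul, ← pr_comul, Bialgebra.comul_mul, h.comul_a]
      have : comul (R := ℂ) x * (a ⊗ₜ a) = comul (R := ℂ) x * (a ⊗ₜ[ℂ] 1) * (1 ⊗ₜ[ℂ] a) := by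
        rw [mul_assoc]; simp
      rw [this, pr_right, pr_left]
    have h2 : f = rt (rt f (S a)) a := by
      apply du_ext; intro x; simp [mul_assoc, h.a_S, ha]
    rw [h2, h1, h.lam_mul, ← ha]
    apply du_ext; intro x
    simp [mul_assoc, h.a_S, h.S_a, ha]
  have hm : ∀ f : Du A, f * S (rt lam a) = f 1 • S (rt lam a) := by
    intro f
    obtain ⟨g, rfl⟩ : ∃ g : Du A, f = S g := by
      have hb := LinearEquiv.ofBijective (S : A →ₗ[ℂ] A) h.S_bij
      refine ⟨toL.symm (toL f ∘ₗ (LinearEquiv.ofBijective (S : A →ₗ[ℂ] A) h.S_bij).symm.toLinearMap), du_ext fun x => ?_⟩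
      rw [du_antipode]
      have := (LinearEquiv.ofBijective (S : A →ₗ[ℂ] A) h.S_bij).symm_apply_apply x
      simp at this
      simp [this]
    rw [← S_mul, hr, map_smul]; simp [antipode_one]
  have := h.int_unique hm
  have h3 := congr($this x)
  rw [du_antipode, du_antipode, h.S_L, rt_apply, rt_apply, h.right, h.eps_a, one_smul, h.lam_L, one_smul] at h3
  exact h3

lemma S4 (y : A) : S (S (S (S (rh lam L * y * S (rh lam L))))) = y := by
  rw [← sub_eq_zero]
  refine h.nondeg fun x => ?_
  rw [mul_sub, map_sub, sub_eq_zero]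
  set a := rh lam L with ha
  rw [← lam_cyc (S (S (a * y * S a))) x, ← h.lam_Sa (S (S (a * y * S a)) * x), ← h.lam_Sa (x * y)]
  rw [S_mul, S_mul, S_mul, S_mul, S_mul, S_mul, S_mul, S_mul, ← ha, h.S_S_a, ← ha]
  rw [mul_assoc (S y), lam_cyc (S y), h.S_S_a, ← ha]
  simp only [mul_assoc]
  rw [ha, h.S_a, mul_one]

end IsInt
end

section
lemma trace_idem {V : Type*} [AddCommGroup V] [Module ℂ V] [FiniteDimensional ℂ V] {f : End ℂ V}
    (h : f * f = f) : ∃ k : ℕ, tr f = k :=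
  ⟨_, (LinearMap.IsIdempotentElem.isProj_range f h).trace⟩

structure Wed (A : Type*) [Ring A] [Algebra ℂ A] where
  n : ℕ
  d : Fin n → ℕ
  ne : ∀ i, NeZero (d i)
  e : A ≃ₐ[ℂ] (Π i, Matrix (Fin (d i)) (Fin (d i)) ℂ)

lemma exists_wed (A : Type*) [Ring A] [Algebra ℂ A] [FiniteDimensional ℂ A] [IsSemisimpleRing A] :
    Nonempty (Wed A) := by
  obtain ⟨n, d, hd, ⟨e⟩⟩ := IsSemisimpleRing.exists_algEquiv_pi_matrix_of_isAlgClosed ℂ A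
  exact ⟨⟨n, d, hd, e⟩⟩

namespace Wed
variable {A : Type*} [Ring A] [Algebra ℂ A] (W : Wed A)

instance (i : Fin W.n) : NeZero (W.d i) := W.ne i

def rho (i : Fin W.n) : A →ₐ[ℂ] Matrix (Fin (W.d i)) (Fin (W.d i)) ℂ :=
  (Pi.evalAlgHom ℂ _ i).comp W.e.toAlgHom
lemma rho_apply (i : Fin W.n) (x : A) : W.rho i x = W.e x i := rfl

def chi (i : Fin W.n) : A →ₗ[ℂ] ℂ := Matrix.traceLinearMap _ ℂ ℂ ∘ₗ (W.rho i).toLinearMap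
lemma chi_apply (i : Fin W.n) (x : A) : W.chi i x = (W.rho i x).trace := rfl

def E (i : Fin W.n) (a b : Fin (W.d i)) : A := W.e.symm (Pi.single i (Matrix.single a b 1))

lemma rho_E (i : Fin W.n) (a b) : W.rho i (W.E i a b) = Matrix.single a b 1 := by
  simp [rho_apply, E]
lemma rho_E_ne {i j : Fin W.n} (h : j ≠ i) (a b) : W.rho j (W.E i a b) = 0 := by
  simp [rho_apply, E, h]

lemma ext {x y : A} (h : ∀ i, W.rho i x = W.rho i y) : x = y :=
  W.e.injective (funext h)

lemma E_mul (i : Fin W.n) (a b c) : W.E i a b * W.E i b c = W.E i a c := by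
  apply W.ext; intro j
  rw [map_mul]
  by_cases h : j = i
  · subst h; simp [rho_E]
  · simp [W.rho_E_ne h]

lemma E_mul_ne (i : Fin W.n) {a b b' c} (h : b ≠ b') : W.E i a b * W.E i b' c = 0 := by
  apply W.ext; intro j
  rw [map_mul]
  by_cases hj : j = i
  · subst hj; simp [rho_E, h]
  · simp [W.rho_E_ne hj]

lemma sum_E (x : A) : x = ∑ i, ∑ a, ∑ b, W.rho i x a b • W.E i a b := by
  apply W.ext; intro j
  simp only [map_sum, map_smul]
  rw [sum_eq_single j]
  · simp only [rho_E]
    conv_lhs => rw [Matrix.matrix_eq_sum_single (W.rho j x)]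
    simp
  · intro i _ hi
    simp [W.rho_E_ne hi.symm]
  · simp

def ent (i : Fin W.n) (a b : Fin (W.d i)) : A →ₗ[ℂ] ℂ := Matrix.entryLinearMap ℂ ℂ a b ∘ₗ (W.rho i).toLinearMap
@[simp] lemma ent_apply (i : Fin W.n) (a b) (x : A) : W.ent i a b x = W.rho i x a b := rfl

include W in
lemma findim : FiniteDimensional ℂ A := Module.Finite.equiv W.e.symm.toLinearEquiv

lemma tr_eq (f : End ℂ A) : tr f = ∑ i, ∑ a, ∑ b, W.rho i (f (W.E i a b)) a b := by
  haveI := W.findim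
  have : f = ∑ i, ∑ a, ∑ b, (W.ent i a b).smulRight (f (W.E i a b)) := by
    ext x
    conv_lhs => rw [W.sum_E x]
    simp [LinearMap.sum_apply]
  conv_lhs => rw [this]
  simp [LinearMap.trace_smulRight]

lemma tr_LR (x y : A) : tr (LinearMap.mulLeft ℂ x * LinearMap.mulRight ℂ y) = ∑ i, W.chi i x * W.chi i y := by
  rw [W.tr_eq]
  refine scr fun i _ => ?_
  simp only [Module.End.mul_apply, LinearMap.mulLeft_apply, LinearMap.mulRight_apply, map_mul, rho_E, chi_apply,
    Matrix.trace, Matrix.diag_apply, sum_mul_sum]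
  refine scr fun a _ => scr fun b _ => ?_
  simp [Matrix.mul_apply, Matrix.single_apply, sum_ite_eq, ite_and]

lemma chi_one (i : Fin W.n) : W.chi i 1 = W.d i := by simp [chi_apply]

lemma tr_L (x : A) : tr (LinearMap.mulLeft ℂ x) = ∑ i, (W.d i : ℂ) * W.chi i x := by
  have := W.tr_LR x 1
  rw [LinearMap.mulRight_one] at this
  simp only [chi_one] at this
  rw [← Module.End.one_eq_id, mul_one] at this
  rw [this]; simp [mul_comm]

lemma finrank_eq : finrank ℂ A = ∑ i, W.d i ^ 2 := by
  haveI := W.findim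
  have := W.tr_L 1
  rw [LinearMap.mulLeft_one, LinearMap.trace_id] at this
  simp only [chi_one] at this
  simp only [← sq] at this
  exact_mod_cast this

lemma chi_mul_comm (i : Fin W.n) (x y : A) : W.chi i (x * y) = W.chi i (y * x) := by
  rw [chi_apply, chi_apply, map_mul, map_mul, Matrix.trace_mul_comm]

lemma chi_mul_E (i : Fin W.n) (x : A) (a b) : W.chi i (x * W.E i b a) = W.rho i x a b := by
  rw [chi_apply, map_mul, rho_E]
  simp [Matrix.trace_mul_single]

lemma chi_mul_E_ne {i j : Fin W.n} (h : j ≠ i) (x : A) (a b) : W.chi j (x * W.E i b a) = 0 := by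
  rw [chi_apply, map_mul, W.rho_E_ne h]; simp

include W in
lemma reg_nondeg {x : A} (h : ∀ y, tr (LinearMap.mulLeft ℂ (x * y)) = 0) : x = 0 := by
  apply W.ext; intro i
  ext a b
  have := h (W.E i b a)
  rw [W.tr_L, sum_eq_single i, chi_mul_E] at this
  · simpa [NeZero.ne] using this
  · intro j _ hj; rw [W.chi_mul_E_ne hj]; simp
  · simp

lemma chi_E (i : Fin W.n) (a) : W.chi i (W.E i a a) = 1 := by
  simp [chi_apply, rho_E]
lemma chi_E_ne {i j : Fin W.n} (h : j ≠ i) (a b) : W.chi j (W.E i a b) = 0 := by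
  simp [chi_apply, W.rho_E_ne h]

lemma class_eq (t : A →ₗ[ℂ] ℂ) (ht : ∀ x y, t (x * y) = t (y * x)) (x : A) :
    t x = ∑ i, t (W.E i 0 0) * W.chi i x := by
  conv_lhs => rw [W.sum_E x]
  simp only [map_sum, map_smul]
  refine scr fun i _ => ?_
  obtain ⟨c, hc⟩ : ∃ c, c = t (W.E i 0 0) := ⟨_, rfl⟩
  rw [← hc]
  have h1 : ∀ a b, t (W.E i a b) = if a = b then c else 0 := by
    intro a b
    split_ifs with h
    · subst h; rw [hc, ← W.E_mul i a 0 a, ht, W.E_mul]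
    · rw [← W.E_mul i a a b, ht, W.E_mul_ne i (fun h' => h h'.symm), map_zero]
  simp only [h1, chi_apply, Matrix.trace, Matrix.diag_apply, smul_eq_mul, mul_ite, mul_zero,
    sum_ite_eq, mem_univ, if_true]
  rw [← sum_mul, mul_comm]

lemma mult_nat {V : Type*} [AddCommGroup V] [Module ℂ V] [FiniteDimensional ℂ V] (r : A →ₐ[ℂ] End ℂ V)
    (i : Fin W.n) : ∃ k : ℕ, tr (r (W.E i 0 0)) = k :=
  trace_idem (by rw [← map_mul, W.E_mul])

end Wed

section pos
variable {m : Type*} [Fintype m] [DecidableEq m]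
open Matrix ComplexOrder

lemma trace_inv_conj {g g' : Matrix m m ℂ} (hg : g * g' = 1) {M : ℕ} (hM : 0 < M) (h : g ^ M = 1) :
    g'.trace = star g.trace := by
  let P : Matrix m m ℂ := ∑ k ∈ Finset.range M, (g ^ k)ᴴ * g ^ k
  have h1 : gᴴ * P * g = P := by
    have : gᴴ * P * g = ∑ k ∈ Finset.range M, (g ^ (k+1))ᴴ * g ^ (k+1) := by
      simp only [P, mul_sum, sum_mul]
      refine scr fun k _ => ?_
      rw [pow_succ, conjTranspose_mul]; simp only [Matrix.mul_assoc]
    rw [this]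
    have h2 := Finset.sum_range_succ' (fun k => (g ^ k)ᴴ * g ^ k) M
    rw [sum_range_succ] at h2
    simp only [h, pow_zero] at h2
    exact (add_right_cancel h2).symm
  have h2 : IsUnit P.det := by
    rw [isUnit_iff_ne_zero]
    have : P.PosDef := by
      have : P = 1 + ∑ k ∈ Finset.range (M - 1), (g ^ (k+1))ᴴ * g ^ (k+1) := by
        simp only [P]
        conv_lhs => rw [show M = (M - 1) + 1 by omega, Finset.sum_range_succ']
        simp [add_comm]
      rw [this]
      exact PosDef.one.add_posSemidef (posSemidef_sum _ fun k _ => posSemidef_conjTranspose_mul_self _)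
    exact this.det_pos.ne'
  have h3 : g' = P⁻¹ * gᴴ * P := by
    have : P⁻¹ * gᴴ * P * g = 1 := by
      rw [Matrix.mul_assoc, Matrix.mul_assoc, ← Matrix.mul_assoc gᴴ, h1, nonsing_inv_mul _ h2]
    calc g' = P⁻¹ * gᴴ * P * g * g' := by rw [this, Matrix.one_mul]
      _ = _ := by rw [Matrix.mul_assoc _ g, hg, Matrix.mul_one]
  rw [h3, trace_mul_comm, ← Matrix.mul_assoc, mul_nonsing_inv _ h2, Matrix.one_mul, trace_conjTranspose]

lemma trace_trace_inv {g g' : Matrix m m ℂ} (hg : g * g' = 1) {M : ℕ} (hM : 0 < M) {c : ℂ} (h : g ^ M = c • 1) :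
    ∃ t : ℝ, 0 ≤ t ∧ g.trace * g'.trace = t := by
  rcases isEmpty_or_nonempty m with hm | hm
  · exact ⟨0, le_rfl, by simp [Matrix.trace]⟩
  have hc : c ≠ 0 := by
    rintro rfl
    have : g ^ M * g' ^ M = 1 := by
      have hcomm : Commute g g' := by
        have : g' * g = 1 := mul_eq_one_comm.1 hg
        exact hg.trans this.symm
      rw [← hcomm.mul_pow, hg, one_pow]
    rw [h] at this; simp at this
  obtain ⟨b, hb⟩ := IsAlgClosed.exists_pow_nat_eq c hM
  have hb0 : b ≠ 0 := by rintro rfl; rw [zero_pow hM.ne'] at hb; exact hc hb.symm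
  have := trace_inv_conj (g := b⁻¹ • g) (g' := b • g') (by simp [hg, smul_smul, hb0]) hM
    (by rw [smul_pow, h, smul_smul, inv_pow, hb, inv_mul_cancel₀ hc, one_smul])
  refine ⟨Complex.normSq (b⁻¹ • g).trace, Complex.normSq_nonneg _, ?_⟩
  rw [← Complex.mul_conj, ← starRingEnd_apply] at *
  rw [← this]
  simp only [trace_smul, smul_eq_mul]
  field_simp

end pos
end

section
lemma ss_of_trace {A : Type*} [Ring A] [Algebra ℂ A] [FiniteDimensional ℂ A]
    (h : ∀ x : A, (∀ y, tr (LinearMap.mulLeft ℂ (y * x)) = 0) → x = 0) : IsSemisimpleRing A := by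
  haveI : IsArtinianRing A := IsArtinianRing.of_finite ℂ A
  rw [IsArtinianRing.isSemisimpleRing_iff_jacobson]
  rw [eq_bot_iff]
  intro x hx
  obtain ⟨n, hn⟩ := IsSemiprimaryRing.isNilpotent (R := A)
  refine h x fun y => ?_
  have h1 : y * x ∈ Ring.jacobson A := Ideal.mul_mem_left _ _ hx
  have h2 : (y * x) ^ n = 0 := by
    have := Ideal.pow_mem_pow h1 n
    rw [hn] at this; simpa using this
  have h3 : IsNilpotent (LinearMap.mulLeft ℂ (y * x)) := ⟨n, by rw [LinearMap.pow_mulLeft, h2]; simp⟩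
  exact (LinearMap.isNilpotent_trace_of_isNilpotent h3).eq_zero

variable {A : Type*} [Ring A] [HopfAlgebra ℂ A]

namespace Wed
lemma E_sandwich (W : Wed A) (i : Fin W.n) (x : A) (a b) : W.E i a a * x * W.E i b b = W.rho i x a b • W.E i a b := by
  apply W.ext; intro j
  by_cases h : j = i
  · subst h
    simp only [map_mul, map_smul, rho_E]
    ext c d
    simp [Matrix.mul_apply, Matrix.single_apply, ite_and, sum_ite_eq]
    aesop
  · simp [W.rho_E_ne h]

lemma exists_triv (W : Wed A) : ∃ i, W.d i = 1 ∧ (∀ x, W.chi i x = eps x) ∧ IsInt (W.E i 0 0) := by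
  have hmul : ∀ x y : A, eps (x * y) = eps x * eps y := fun x y => Bialgebra.counit_mul x y
  have h1 : ∀ x : A, eps x = ∑ i, eps (W.E i 0 0) * W.chi i x :=
    W.class_eq (counit (R := ℂ)) fun x y => by rw [Bialgebra.counit_mul, Bialgebra.counit_mul, mul_comm]
  obtain ⟨i, hi⟩ : ∃ i, eps (W.E i 0 0) ≠ 0 := by
    by_contra! hc
    have := h1 1
    simp [hc] at this
  have hi1 : eps (W.E i 0 0) = 1 := by
    have := hmul (W.E i 0 0) (W.E i 0 0)
    rw [W.E_mul] at this
    exact (mul_eq_left₀ hi).1 this.symm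
  have hs : Subsingleton (Fin (W.d i)) := by
    constructor
    intro a b
    by_contra hab
    have h2 : ∀ a, eps (W.E i a a) = 1 := fun a => by
      rw [← W.E_mul i a 0 a, hmul, mul_comm, ← hmul, W.E_mul, hi1]
    have h3 : eps (W.E i a b) * eps (W.E i b a) = 1 := by rw [← hmul, W.E_mul, h2]
    have h4 : eps (W.E i a b) * eps (W.E i a b) = 0 := by
      rw [← hmul, W.E_mul_ne i (Ne.symm hab)]; simp
    rw [mul_self_eq_zero.1 h4] at h3
    simp at h3
  have hd : W.d i = 1 := by
    have h0 := NeZero.pos (W.d i)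
    have := Fintype.card_le_one_iff_subsingleton.2 hs
    simp at this; omega
  have hr : ∀ x : A, W.rho i x 0 0 = eps x := fun x => by
    have := congrArg eps (W.E_sandwich i x 0 0)
    simp only [hmul, hi1, one_mul, mul_one] at this
    simp [eps] at this
    rw [show counit (R := ℂ) (W.E i 0 0) = 1 from hi1, mul_one] at this; exact this.symm
  have hx : ∀ x : A, W.rho i x = eps x • 1 := by
    intro x; ext a b
    rw [Subsingleton.elim a 0, Subsingleton.elim b 0, hr]; simp
  refine ⟨i, hd, fun x => ?_, fun x => ?_, fun x => ?_, hi1⟩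
  · rw [chi_apply, hx]; simp [hd]
  · apply W.ext; intro j
    by_cases h : j = i
    · subst h; rw [map_mul, hx x, map_smul]; simp
    · simp [W.rho_E_ne h]
  · apply W.ext; intro j
    by_cases h : j = i
    · subst h; rw [map_mul, hx x, map_smul]; simp
    · simp [W.rho_E_ne h]
end Wed

variable [FiniteDimensional ℂ A]

def reg : Du A := toL.symm (tr ∘ₗ (LinearMap.mul ℂ A))
lemma reg_apply (x : A) : reg x = tr (Lm x) := rfl
lemma reg_comm (x y : A) : reg (x * y) = reg (y * x) := by
  rw [reg_apply, reg_apply, Lm, Lm, LinearMap.mulLeft_mul, LinearMap.mulLeft_mul]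
  exact LinearMap.trace_mul_comm _ _ _

lemma reg_one : reg (1 : A) = finrank ℂ A := by
  rw [reg_apply, Lm, LinearMap.mulLeft_one, LinearMap.trace_id]

lemma pr_reg (t : A ⊗[ℂ] A) : pr reg reg t = tr (LinearMap.mulLeft ℂ t) := by
  induction t with
  | zero => simp
  | add a b ha hb =>
    rw [map_add, ha, hb, ← map_add]; congr 1; ext; simp [add_mul]
  | tmul a b =>
    have : LinearMap.mulLeft ℂ (a ⊗ₜ[ℂ] b) = TensorProduct.map (Lm a) (Lm b) := by
      ext; simp
    rw [this, LinearMap.trace_tensorProduct']; rfl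

lemma reg_mul_reg : (reg * reg : Du A) = (finrank ℂ A : ℂ) • reg := by
  apply du_ext; intro x
  rw [← pr_comul, pr_reg]
  let th : A ⊗[ℂ] A →ₗ[ℂ] A ⊗[ℂ] A := TensorProduct.lift
    ((LinearMap.mul ℂ (A ⊗[ℂ] A)).compl₁₂ (comul (R := ℂ)) (TensorProduct.mk ℂ A A 1))
  have hth : ∀ y z, th (y ⊗ₜ z) = comul (R := ℂ) y * (1 ⊗ₜ z) := fun y z => by simp [th]
  have hsurj : Function.Surjective th := by
    rw [← LinearMap.range_eq_top, eq_top_iff, ← TensorProduct.span_tmul_eq_top, Submodule.span_le]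
    rintro _ ⟨y, z, rfl⟩
    have r := arbitrary ℂ y
    refine ⟨∑ i ∈ r.index, r.left i ⊗ₜ (S (r.right i) * z), ?_⟩
    simp only [map_sum, hth]
    have : ∀ i, (1 : A) ⊗ₜ[ℂ] (S (r.right i) * z) = (1 ⊗ₜ S (r.right i)) * (1 ⊗ₜ z) := by simp
    simp only [this, ← mul_assoc]
    rw [← sum_mul, theta_key r]; simp
  let te := LinearEquiv.ofBijective th ⟨LinearMap.injective_iff_surjective.2 hsurj, hsurj⟩
  have hc : LinearMap.mulLeft ℂ (comul (R := ℂ) x) * th = th * LinearMap.mulLeft ℂ (x ⊗ₜ[ℂ] (1 : A)) := by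
    ext y z
    simp [hth, mul_assoc]
  have h2 : LinearMap.mulLeft ℂ (comul (R := ℂ) x) = te.conj (LinearMap.mulLeft ℂ (x ⊗ₜ[ℂ] (1 : A))) := by
    rw [LinearEquiv.conj_apply]
    refine LinearMap.ext fun u => ?_
    obtain ⟨w, rfl⟩ := te.surjective u
    have := congr($hc w)
    simp only [Module.End.mul_apply] at this
    simp only [LinearMap.comp_apply, LinearEquiv.coe_coe, LinearEquiv.symm_apply_apply]
    exact this
  rw [h2, LinearMap.trace_conj', ← pr_reg, pr_tmul, reg_one]
  simp [mul_comm]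

lemma exists_ev (F : Du A →ₗ[ℂ] ℂ) : ∃ y : A, ∀ f : Du A, F f = f y := by
  obtain ⟨y, hy⟩ := (Module.evalEquiv ℂ A).surjective (F ∘ₗ toL.symm.toLinearMap)
  refine ⟨y, fun f => ?_⟩
  have := congr($hy (toL f))
  simpa using this.symm

lemma tr_S2_du : tr ((S * S : End ℂ (Du A))) = tr (S * S : End ℂ A) := by
  rw [← LinearMap.trace_transpose' (S * S : End ℂ A), ← LinearMap.trace_conj' _ (toL (A := A))]
  congr 1

lemma lam_du {L : A} (h : IsInt L) (f : Du A) : tr (Lm f * (S * S)) = tr (S * S : End ℂ A) * f L := by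
  obtain ⟨y, hy⟩ := exists_ev (toL (lam (A := Du A)))
  have h1 : ∀ x : A, x * y = eps x • y := by
    intro x
    refine du_sep fun g => ?_
    have := congr($(lam_int (A := Du A) (toL.symm (ev x))) g)
    have r := arbitrary ℂ g
    rw [du_mul _ _ r] at this
    simp only [hy, LinearEquiv.apply_symm_apply, ev_apply, du_repr r] at this
    rw [this]; simp [hy]
  have h2 : y = eps y • L := by
    rw [← h.right, h1, h.norm, one_smul]
  have h3 : eps y = tr (S * S : End ℂ A) := by
    have := hy 1
    rw [lam_apply, du_one] at this
    change counit (R := ℂ) y = _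
    rw [← tr_S2_du, ← this, Lm, LinearMap.mulLeft_one, ← Module.End.one_eq_id, one_mul]
  rw [← lam_apply, hy f, ← h3]
  conv_lhs => rw [h2]
  simp
end

section
variable {A : Type*} [Ring A] [HopfAlgebra ℂ A] [FiniteDimensional ℂ A]

lemma gl_fin {a b : A} (ha : IsGroupLikeElem ℂ a) (hb : b * a = 1) : ∃ N, 0 < N ∧ a ^ N = 1 := by
  have hf : {a : A | IsGroupLikeElem ℂ a}.Finite :=
    LinearIndependent.setFinite (R := ℂ) (linearIndepOn_isGroupLikeElem (R := ℂ) (A := A))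
  have : ¬ Function.Injective (fun n : ℕ => a ^ n) := fun hi =>
    Set.infinite_of_injective_forall_mem hi (fun n => (ha.pow : a ^ n ∈ {a : A | IsGroupLikeElem ℂ a})) hf
  have h2 : ∃ m k : ℕ, 0 < k ∧ a ^ m = a ^ (m + k) := by
    simp only [Function.Injective, not_forall] at this
    obtain ⟨i, j, h1, h2⟩ := this
    rcases lt_or_gt_of_ne h2 with h | h
    · exact ⟨i, j - i, by omega, by rw [show i + (j - i) = j by omega]; exact h1⟩
    · exact ⟨j, i - j, by omega, by rw [show j + (i - j) = i by omega]; exact h1.symm⟩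
  obtain ⟨m, k, hk, h3⟩ := h2
  refine ⟨k, hk, ?_⟩
  have h4 : ∀ m, b ^ m * a ^ m = 1 := fun m => by
    induction m with
    | zero => simp
    | succ m ih => rw [pow_succ, pow_succ', mul_assoc, ← mul_assoc b, hb, one_mul, ih]
  have := congrArg (b ^ m * ·) h3
  simp only [pow_add, ← mul_assoc, h4, one_mul] at this
  exact this.symm

lemma IsInt.reg_L {L : A} (h : IsInt L) : reg L = 1 := by
  have : Lm L = (counit (R := ℂ) (A := A)).smulRight L := by
    ext y; simp [h.right]
  rw [reg_apply, this, LinearMap.trace_smulRight]; exact h.norm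

lemma Wed.central_scalar (W : Wed A) (i) {z : A} (hz : ∀ x, z * x = x * z) : ∃ c : ℂ, W.rho i z = c • 1 := by
  obtain ⟨c, hc⟩ := Matrix.mem_range_scalar_of_commute_single (M := W.rho i z) fun a b _ => by
    change Commute (Matrix.single a b 1) _
    rw [← W.rho_E, Commute, SemiconjBy, ← map_mul, ← map_mul, hz]
  exact ⟨c, by rw [← hc]; ext a b; simp [Matrix.one_apply, Matrix.diagonal_apply]⟩

lemma exists_k (W : Wed A) : ∃ k k' : A, k * k' = 1 ∧ k' * k = 1 ∧ (∀ x : A, S (S x) = k * x * k') := by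
  obtain ⟨i, -, -, h⟩ := W.exists_triv
  let F : A →ₗ[ℂ] Du A := toL.symm.toLinearMap ∘ₗ (LinearMap.mul ℂ A).compr₂ (toL reg)
  have hF : ∀ x y, F x y = reg (x * y) := fun x y => rfl
  have hi : Function.Injective F := by
    rw [injective_iff_map_eq_zero]
    intro x hx
    exact W.reg_nondeg fun y => by have := hF x y; rw [hx] at this; exact this.symm
  have hsu : Function.Surjective F := (LinearMap.injective_iff_surjective_of_finrank_eq_finrank finrank_du.symm).1 hi
  obtain ⟨k, hk⟩ := hsu lam
  have hl : ∀ x, lam x = reg (k * x) := fun x => by rw [← hk]; rfl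
  have hc : ∀ x, k * x = S (S x) * k := fun x => by
    rw [← sub_eq_zero]
    refine W.reg_nondeg fun y => ?_
    change reg _ = 0
    rw [sub_mul, map_sub, sub_eq_zero, mul_assoc, ← hl, lam_cyc, hl, ← mul_assoc, reg_comm, mul_assoc]
  have hinj : Function.Injective (LinearMap.mulLeft ℂ k) := by
    rw [injective_iff_map_eq_zero]
    intro x hx
    refine h.nondegL fun y => ?_
    rw [hl, ← mul_assoc]
    rw [show k * x = 0 from hx]; simp
  obtain ⟨k', hk'⟩ := (LinearMap.injective_iff_surjective.1 hinj) 1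
  have hk' : k * k' = 1 := hk'
  have hk2 : k' * k = 1 := hinj (by simp [← mul_assoc, hk'])
  exact ⟨k, k', hk', hk2, fun x => by rw [hc, mul_assoc, hk', mul_one]⟩

lemma T_pos (W : Wed A) : ∃ t : ℝ, 1 ≤ t ∧ tr (S * S : End ℂ A) = t := by
  obtain ⟨i0, hd, hchi, h⟩ := W.exists_triv
  obtain ⟨k, k', h1, h2, hS⟩ := exists_k W
  set a := rh lam (W.E i0 0 0) with ha
  obtain ⟨N, hN, haN⟩ := gl_fin h.a_gl h.S_a
  have h4 : ∀ y, k * (k * y * k') * k' = S a * y * a := fun y => by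
    have := h.S4 (S a * y * a)
    rw [← ha, ← mul_assoc, ← mul_assoc, h.a_S, one_mul, mul_assoc, h.a_S, mul_one] at this
    rw [← this]; simp [hS]
  have h5 : ∀ m y, (k * k) ^ m * y * (k' * k') ^ m = (S a) ^ m * y * a ^ m := fun m => by
    induction m with
    | zero => simp
    | succ m ih =>
      intro y
      rw [pow_succ, pow_succ' (k' * k')]
      have := ih (k * (k * y * k') * k')
      rw [h4] at this
      have e : (k * k) ^ m * (k * k) * y * (k' * k' * (k' * k') ^ m) = (k * k) ^ m * (S a * y * a) * (k' * k') ^ m := by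
        rw [← h4]; noncomm_ring
      rw [e, ih, pow_succ, pow_succ']; noncomm_ring
  have hz : ∀ m, (k' * k') ^ m * (k * k) ^ m = 1 := fun m => by
    induction m with
    | zero => simp
    | succ m ih =>
      rw [pow_succ, pow_succ', mul_assoc, mul_assoc, mul_assoc k, ← mul_assoc k' k, h2, one_mul,← mul_assoc k' k, h2, one_mul, ih]
  have hSa : ∀ m, (S a) ^ m * a ^ m = 1 := fun m => by
    induction m with
    | zero => simp
    | succ m ih => rw [pow_succ, pow_succ', mul_assoc, ← mul_assoc (S a) a, h.S_a, one_mul, ih]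
  have hSaN : (S a) ^ N = 1 := by have := hSa N; rwa [haN, mul_one] at this
  have hcen : ∀ x, (k * k) ^ N * x = x * (k * k) ^ N := fun x => by
    have := h5 N x
    rw [haN, hSaN, one_mul, mul_one] at this
    conv_rhs => rw [← this, mul_assoc, hz, mul_one]
  have hT : tr (S * S : End ℂ A) = ∑ i, W.chi i k * W.chi i k' := by
    rw [← W.tr_LR]; congr 1; ext x; simp [hS, mul_assoc]
  have ht : ∀ i, ∃ t : ℝ, 0 ≤ t ∧ W.chi i k * W.chi i k' = t := fun i => by
    obtain ⟨c, hc⟩ := W.central_scalar i hcen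
    refine trace_trace_inv (g := W.rho i k) (g' := W.rho i k') (by rw [← map_mul, h1, map_one]) (M := 2 * N) (by omega) (c := c) ?_
    rw [← hc, ← map_pow, pow_mul, pow_two]
  choose t ht0 ht1 using ht
  refine ⟨∑ i, t i, ?_, by rw [hT]; simp [ht1]⟩
  have : t i0 = 1 := by
    have := ht1 i0
    rw [hchi, hchi] at this
    have e : eps k * eps k' = 1 := by
      change counit (R := ℂ) k * counit k' = 1
      rw [← Bialgebra.counit_mul, h1, Bialgebra.counit_one]
    rw [e] at this
    exact_mod_cast this.symm
  rw [← this]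
  exact single_le_sum (fun i _ => ht0 i) (mem_univ _)

lemma half_idem {V : Type*} [AddCommGroup V] [Module ℂ V] {e s : End ℂ V} (he : e * e = e) (hs : s * s = 1)
    (hes : e * s = s * e) (c : ℂ) (hc : c * c = 1) :
    ((2⁻¹ : ℂ) • (e * (1 + c • s))) * ((2⁻¹ : ℂ) • (e * (1 + c • s))) = (2⁻¹ : ℂ) • (e * (1 + c • s)) := by
  have h1 : (1 + c • s) * e = e * (1 + c • s) := by simp [add_mul, mul_add, hes]
  have h2 : (1 + c • s) * (1 + c • s) = (2 : ℂ) • (1 + c • s) := by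
    simp [add_mul, mul_add, hs, smul_smul, hc]; module
  rw [smul_mul_smul_comm, mul_assoc, ← mul_assoc _ e, h1, mul_assoc, h2, mul_smul_comm, mul_smul_comm, ← mul_assoc, he, smul_smul]
  norm_num

theorem S_S (W : Wed A) (x : A) : S (S x) = x := by
  obtain ⟨i0, hd, hchi, h⟩ := W.exists_triv
  obtain ⟨k, k', hk1, hk2, hkS⟩ := exists_k W
  obtain ⟨t, ht, hT⟩ := T_pos W
  set L := W.E i0 0 0 with hL
  have hl1 : lam (1 : A) = t := by rw [lam_apply, Lm, LinearMap.mulLeft_one, ← hT]; rfl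
  have ha : rh lam L = 1 := du_sep fun f => by
    have := congr($(h.lam_mul f) 1)
    rw [← pr_comul, Bialgebra.comul_one, Algebra.TensorProduct.one_def, pr_tmul] at this
    simp [hl1] at this
    have ht0 : (t : ℂ) ≠ 0 := by exact_mod_cast (by linarith : t ≠ 0)
    rw [mul_comm] at this
    exact (mul_right_cancel₀ ht0 this).symm
  have h4 : ∀ y : A, S (S (S (S y))) = y := fun y => by
    have := h.S4 y
    rw [ha, antipode_one, one_mul, mul_one] at this; exact this
  set n := finrank ℂ A with hn
  have hn0 : 0 < n := by
    rw [hn, W.finrank_eq]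
    exact sum_pos (fun i _ => by have := NeZero.pos (W.d i); positivity) ⟨i0, mem_univ _⟩
  have hn0' : (n : ℂ) ≠ 0 := by exact_mod_cast hn0.ne'
  let e : Du A := (n : ℂ)⁻¹ • reg
  have hee : e * e = e := by
    simp only [e]; rw [smul_mul_smul_comm, reg_mul_reg, smul_smul, ← hn]; congr 1; field_simp
  let s : End ℂ (Du A) := S * S
  have hs : s * s = 1 := by
    ext f; apply du_ext; intro x; simp [s, h4]
  have hse : S (S e) = e := by
    apply du_ext; intro x
    rw [du_antipode, du_antipode]
    rw [hkS x]
    simp only [e, map_smul, LinearMap.smul_apply]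
    rw [reg_comm, ← mul_assoc, hk2, one_mul]
  have hes : Lm e * s = s * Lm e := by
    ext f; simp only [s, Module.End.mul_apply, LinearMap.mulLeft_apply]
    rw [S2_mul, hse]
  have hle : Lm e * Lm e = Lm e := by
    conv_rhs => rw [← hee]
    ext f; simp [mul_assoc]
  obtain ⟨u, hu⟩ := trace_idem (half_idem hle hs hes 1 (by norm_num))
  obtain ⟨w, hw⟩ := trace_idem hle
  have htr : tr (Lm e * s) = t / n := by
    rw [lam_du h, hT]; simp [e, h.reg_L]; ring
  have h1 : t = n * (2 * u - w) := by
    have e1 : (2⁻¹ : ℂ) * (w + t / n) = u := by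
      rw [← hu, ← hw, ← htr]; simp [mul_add]
    field_simp at e1
    have : (t : ℂ) = n * (2 * u - w) := by linear_combination e1
    exact_mod_cast this
  have h2 : (n : ℝ) ≤ t := by
    have h3 : (0 : ℝ) < 2 * u - w := by
      by_contra hc
      have : (n : ℝ) * (2 * u - w) ≤ 0 := mul_nonpos_of_nonneg_of_nonpos (by positivity) (by linarith)
      linarith
    have h4 : (0 : ℤ) < 2 * u - w := by exact_mod_cast h3
    have h5 : (1 : ℝ) ≤ 2 * u - w := by exact_mod_cast h4
    rw [h1]; nlinarith [(by positivity : (0 : ℝ) ≤ n)]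
  have hsA : (S * S * (S * S) : End ℂ A) = 1 := by ext x; simp [h4]
  have hq := half_idem (e := (1 : End ℂ A)) (s := S * S) (by simp) hsA (by simp) (-1) (by norm_num)
  obtain ⟨v, hv⟩ := trace_idem hq
  have hv' := hv
  simp only [one_mul, map_smul, map_add, hT, LinearMap.trace_one, ← hn, smul_eq_mul] at hv'
  have hv2 : (2⁻¹ : ℝ) * (n + -1 * t) = v := by
    have := congrArg Complex.re hv'
    simpa using this
  have hv3 : v = 0 := by
    have : (v : ℝ) ≤ 0 := by linarith
    exact_mod_cast le_antisymm this (by positivity)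
  rw [hv3, Nat.cast_zero, LinearMap.IsIdempotentElem.trace_eq_zero_iff hq] at hv
  have := congr($hv x)
  simp at this
  have := smul_right_injective A (by norm_num : (2⁻¹ : ℂ) ≠ 0) (add_neg_eq_zero.1 this)
  exact this.symm

lemma du_ss (W : Wed A) : IsSemisimpleRing (Du A) := by
  obtain ⟨i0, hd, hchi, h⟩ := W.exists_triv
  refine ss_of_trace fun f hf => h.dual_nondeg fun g => ?_
  have := lam_du h (g * f)
  rw [show (S * S : End ℂ (Du A)) = 1 by ext f; apply du_ext; intro x; simp [S_S W], mul_one, hf,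
    show (S * S : End ℂ A) = 1 by ext x; simp [S_S W], LinearMap.trace_one] at this
  have hn0 : (finrank ℂ A : ℂ) ≠ 0 := by
    rw [W.finrank_eq]; push_cast
    have : 0 < ∑ i, W.d i ^ 2 := sum_pos (fun i _ => by have := NeZero.pos (W.d i); positivity) ⟨i0, mem_univ _⟩
    exact_mod_cast this.ne'
  simpa [hn0] using this.symm
end

section
variable {A : Type*} [Ring A] [HopfAlgebra ℂ A]

lemma S_flip (hS : ∀ x : A, S (S x) = x) {x : A} {ι : Type*} (r : Coalgebra.Repr ℂ x ι) :
    ∑ i ∈ r.index, r.right i * S (r.left i) = eps x • 1 := by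
  have := congrArg S (sum_mul_antipode_eq_smul r)
  rw [map_sum, map_smul, antipode_one] at this
  rw [← this]
  exact scr fun i _ => by rw [S_mul, hS]

lemma S_flip' (hS : ∀ x : A, S (S x) = x) {x : A} {ι : Type*} (r : Coalgebra.Repr ℂ x ι) :
    ∑ i ∈ r.index, S (r.right i) * r.left i = eps x • 1 := by
  have := congrArg S (sum_antipode_mul_eq_smul r)
  rw [map_sum, map_smul, antipode_one] at this
  rw [← this]
  exact scr fun i _ => by rw [S_mul, hS]

lemma hS_du [FiniteDimensional ℂ A] (hS : ∀ x : A, S (S x) = x) (f : Du A) : S (S f) = f := by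
  apply du_ext; intro x; rw [du_antipode, du_antipode, hS]

lemma theta_key' [FiniteDimensional ℂ A] (hS : ∀ x : A, S (S x) = x) {x : A} {ι : Type*} (r : Coalgebra.Repr ℂ x ι) :
    ∑ i ∈ r.index, (1 ⊗ₜ S (r.right i)) * comul (R := ℂ) (r.left i) = x ⊗ₜ[ℂ] (1 : A) := by
  refine IsInt.pr_sep fun f g => ?_
  have q := arbitrary ℂ g
  have h0 : ∀ (z : A) (t : A ⊗[ℂ] A), pr f g ((1 ⊗ₜ z) * t) = ∑ j ∈ q.index, (q.left j) z * pr f (q.right j) t := by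
    intro z t
    induction t with
    | zero => simp
    | add a b ha hb => simp only [mul_add, map_add, ha, hb, sum_add_distrib]
    | tmul a b => simp [← du_repr q, mul_sum, mul_left_comm]
  simp only [map_sum, h0, pr_comul]
  rw [sum_comm]
  have h1 : ∀ j ∈ q.index, ∑ i ∈ r.index, (q.left j) (S (r.right i)) * (f * q.right j) (r.left i) =
      (f * (q.right j * S (q.left j))) x := by
    intro j _
    rw [← mul_assoc, du_mul _ _ r]
    exact scr fun i _ => by rw [mul_comm]; rfl
  rw [sum_congr rfl h1, ← LinearMap.sum_apply, ← map_sum, ← mul_sum, S_flip (hS_du hS)]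
  simp [mul_comm]

variable [FiniteDimensional ℂ A]
def lh : Du A →ₗ[ℂ] End ℂ A :=
  LinearMap.mk₂ ℂ (fun f x => TensorProduct.rid ℂ A ((toL f).lTensor A (comul (R := ℂ) x)))
    (by intro a b x; simp [LinearMap.lTensor_add]) (by intro c a x; simp [LinearMap.lTensor_smul])
    (by intro a b x; simp) (by intro c a x; simp)

lemma lh_repr (f : Du A) {x : A} {ι : Type*} (r : Coalgebra.Repr ℂ x ι) :
    lh f x = ∑ i ∈ r.index, f (r.right i) • r.left i := by
  simp [lh, ← r.eq]

lemma du_lh (f g : Du A) (x : A) : g (lh f x) = (g * f) x := by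
  have r := arbitrary ℂ x
  rw [lh_repr f r, du_mul g f r]; simp [mul_comm]

lemma lh_mul (f g : Du A) : lh (f * g) = lh f * lh g := by
  ext x; refine du_sep fun k => ?_
  simp [du_lh, mul_assoc]

lemma lh_one : lh (1 : Du A) = 1 := by
  ext x; refine du_sep fun k => ?_
  simp [du_lh]

lemma lh_rh (f g : Du A) : lh f * rh g = rh g * lh f := by
  ext x; refine du_sep fun k => ?_
  simp [du_lh, du_rh, mul_assoc]

section rel
variable {B : Type*} [Ring B] [Algebra ℂ B]

abbrev NC (A B : Type*) [Ring A] [HopfAlgebra ℂ A] [FiniteDimensional ℂ A] [Ring B] [Algebra ℂ B] := Cv A (Cv (Du A) B)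

def ioL {C B : Type*} [AddCommGroup C] [Module ℂ C] [Coalgebra ℂ C] [Ring B] [Algebra ℂ B] : B →ₗ[ℂ] Cv C B where
  toFun := io
  map_add' a b := by ext; simp only [io_apply, WithConv.ofConv_add, LinearMap.add_apply, smul_add]
  map_smul' a b := by ext; simp only [io_apply, WithConv.ofConv_smul, LinearMap.smul_apply, RingHom.id_apply]; rw [smul_comm]

def al (a : Cv A B) : NC A B := WithConv.toConv (ioL ∘ₗ a.ofConv)
def be (b : Cv (Du A) B) : NC A B := io b
def e1 : A →ₗ[ℂ] Cv (Du A) B where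
  toFun h := WithConv.toConv ((ev h).smulRight 1)
  map_add' a b := by ext; simp [add_smul]
  map_smul' a b := by ext; simp [mul_smul]
@[simp] lemma e1_apply (h : A) (f : Du A) : (e1 h : Cv (Du A) B).ofConv f = f h • (1 : B) := rfl
def ee : NC A B := WithConv.toConv e1
@[simp] lemma al_apply (a : Cv A B) (h : A) : (al a).ofConv h = io (a.ofConv h) := rfl
@[simp] lemma ee_apply (h : A) : (ee : NC A B).ofConv h = e1 h := rfl

lemma be_mul (b b' : Cv (Du A) B) : be (b * b') = be b * be b' := io_mul b b'
lemma al_mul (a a' : Cv A B) : al (a * a') = al a * al a' := by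
  ext h : 2
  have r := arbitrary ℂ h
  rw [r.convMul_apply]
  simp only [al_apply, ← io_mul]
  rw [r.convMul_apply]
  exact map_sum (ioL : B →ₗ[ℂ] Cv (Du A) B) _ _

lemma al_be (a : Cv A B) (b : Cv (Du A) B) (h : A) (f : Du A) : ((al a * be b).ofConv h).ofConv f = a.ofConv h * b.ofConv f := by
  rw [be, conv_io, al_apply, io_conv]
lemma be_al (a : Cv A B) (b : Cv (Du A) B) (h : A) (f : Du A) : ((be b * al a).ofConv h).ofConv f = b.ofConv f * a.ofConv h := by
  rw [be, io_conv, al_apply, conv_io]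
lemma al_be_comm (a : Cv A B) (b : Cv (Du A) B) (H : ∀ h f, a.ofConv h * b.ofConv f = b.ofConv f * a.ofConv h) :
    al a * be b = be b * al a := by
  ext h f; rw [al_be, be_al, H]

lemma al_ee (a : Cv A B) (h : A) (f : Du A) : ((al a * ee).ofConv h).ofConv f = a.ofConv (lh f h) := by
  have r := arbitrary ℂ h
  rw [r.convMul_apply, lh_repr f r]
  simp only [WithConv.ofConv_sum, LinearMap.sum_apply, al_apply, ee_apply, io_conv]; simp
lemma ee_al (a : Cv A B) (h : A) (f : Du A) : ((ee * al a).ofConv h).ofConv f = a.ofConv (rh f h) := by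
  have r := arbitrary ℂ h
  rw [r.convMul_apply, rh_repr f r]
  simp only [WithConv.ofConv_sum, LinearMap.sum_apply, al_apply, ee_apply, conv_io]; simp

def Rel (a : Cv A B) (b : Cv (Du A) B) : Prop := al a * ee * be b = be b * ee * al a

lemma rel_iff (a : Cv A B) (b : Cv (Du A) B) : Rel a b ↔ ∀ (h : A) (f : Du A),
    (WithConv.toConv (a.ofConv ∘ₗ lh.flip h) * b).ofConv f = (b * WithConv.toConv (a.ofConv ∘ₗ rh.flip h)).ofConv f := by
  have e1 : ∀ h, (al a * ee).ofConv h = WithConv.toConv (a.ofConv ∘ₗ lh.flip h) := fun h => by ext f; rw [al_ee]; rfl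
  have e2 : ∀ h, (ee * al a).ofConv h = WithConv.toConv (a.ofConv ∘ₗ rh.flip h) := fun h => by ext f; rw [ee_al]; rfl
  have e3 : ∀ h, (al a * ee * be b).ofConv h = WithConv.toConv (a.ofConv ∘ₗ lh.flip h) * b := fun h => by
    rw [be, conv_io, e1]
  have e4 : ∀ h, (be b * ee * al a).ofConv h = b * WithConv.toConv (a.ofConv ∘ₗ rh.flip h) := fun h => by
    rw [be, mul_assoc, io_conv, e2]
  constructor
  · intro H h f; rw [← e3, ← e4, H]
  · intro H; ext h f; rw [e3, e4, H]

end rel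
end

section
variable {A : Type*} [Ring A] [HopfAlgebra ℂ A] [FiniteDimensional ℂ A]

section rel2
variable {B : Type*} [Ring B] [Algebra ℂ B]
lemma aeb (a : Cv A B) (b : Cv (Du A) B) (h : A) :
    (al a * ee * be b).ofConv h = WithConv.toConv (a.ofConv ∘ₗ lh.flip h) * b := by
  have e1 : (al a * ee).ofConv h = WithConv.toConv (a.ofConv ∘ₗ lh.flip h) := by ext f; rw [al_ee]; rfl
  rw [be, conv_io, e1]
lemma bea (a : Cv A B) (b : Cv (Du A) B) (h : A) :
    (be b * ee * al a).ofConv h = b * WithConv.toConv (a.ofConv ∘ₗ rh.flip h) := by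
  have e2 : (ee * al a).ofConv h = WithConv.toConv (a.ofConv ∘ₗ rh.flip h) := by ext f; rw [ee_al]; rfl
  rw [be, mul_assoc, io_conv, e2]

lemma cv_map {C B' : Type*} [AddCommGroup C] [Module ℂ C] [Coalgebra ℂ C] [Ring B'] [Algebra ℂ B'] (j : B →ₐ[ℂ] B') (x y : Cv C B) :
    (WithConv.toConv (j.toLinearMap ∘ₗ (x * y).ofConv) : Cv C B') =
      WithConv.toConv (j.toLinearMap ∘ₗ x.ofConv) * WithConv.toConv (j.toLinearMap ∘ₗ y.ofConv) := by
  ext c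
  have r := arbitrary ℂ c
  rw [r.convMul_apply]
  simp only [LinearMap.comp_apply, r.convMul_apply, map_sum]; simp
end rel2

lemma lh_Lm (f : Du A) (x : A) {ι : Type*} (r : Coalgebra.Repr ℂ f ι) :
    lh f * Lm x = ∑ i ∈ r.index, Lm (lh (r.left i) x) * lh (r.right i) := by
  ext y
  have p := arbitrary ℂ x
  have q := arbitrary ℂ y
  have h1 : lh f (x * y) = ∑ i ∈ p.index, ∑ j ∈ q.index, f (p.right i * q.right j) • (p.left i * q.left j) := by
    simp [lh, Bialgebra.comul_mul, ← p.eq, ← q.eq, sum_mul_sum]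
  simp only [Module.End.mul_apply, LinearMap.mulLeft_apply, h1, LinearMap.sum_apply, lh_repr _ p, lh_repr _ q,
    ← du_repr r, sum_mul_sum, sum_smul, smul_mul_smul_comm]
  refine (scr fun i _ => sum_comm).trans ?_
  exact sum_comm

abbrev LL : A →ₐ[ℂ] End ℂ A := Algebra.lmul ℂ A
def lhA : Du A →ₐ[ℂ] End ℂ A := AlgHom.ofLinearMap lh lh_one lh_mul
def ghA : Du A →ₐ[ℂ] End ℂ A := AlgHom.ofLinearMap (rh ∘ₗ S) (by simp [rh_one]) (by
  intro x y; simp only [LinearMap.comp_apply]; rw [S_mul, rh_mul])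
@[simp] lemma lhA_apply (f : Du A) : lhA f = lh f := rfl
@[simp] lemma ghA_apply (f : Du A) : ghA f = rh (S f) := rfl

abbrev cv {C B : Type*} [AddCommGroup C] [Module ℂ C] [Ring B] [Algebra ℂ B] (f : C →ₗ[ℂ] B) : Cv C B := WithConv.toConv f

abbrev cL (x : A) : Cv (Du A) (End ℂ A) := io (Lm x)

lemma heis1 (x : A) : cv lh * cL x = cv (LL.toLinearMap ∘ₗ lh.flip x) * cv lh := by
  ext f : 2
  have r := arbitrary ℂ f
  rw [conv_io, r.convMul_apply]
  exact lh_Lm f x r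
lemma heis2 (x : A) : cv rh * cL x = cv (LL.toLinearMap ∘ₗ rh.flip x) * cv rh := by
  ext f : 2
  have r := arbitrary ℂ f
  rw [conv_io, r.convMul_apply]
  exact rh_Lm f x r

section
variable (hS : ∀ x : A, S (S x) = x)
include hS
lemma lhS1 {f : Du A} {ι : Type*} (r : Coalgebra.Repr ℂ f ι) : ∑ i ∈ r.index, lh (S (r.right i)) * lh (r.left i) = f 1 • 1 := by
  simp only [← lh_mul, ← map_sum, S_flip' (hS_du hS) r]; simp [lh_one, du_counit]
lemma rhS1 {f : Du A} {ι : Type*} (r : Coalgebra.Repr ℂ f ι) : ∑ i ∈ r.index, rh (S (r.left i)) * rh (r.right i) = f 1 • 1 := by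
  simp only [← rh_mul, ← map_sum, S_flip (hS_du hS) r]; simp [rh_one, du_counit]
lemma rhS2 {f : Du A} {ι : Type*} (r : Coalgebra.Repr ℂ f ι) : ∑ i ∈ r.index, rh (r.left i) * rh (S (r.right i)) = f 1 • 1 := by
  simp only [← rh_mul, ← map_sum, S_flip' (hS_du hS) r]; simp [rh_one, du_counit]
omit hS in
lemma rhS3 {f : Du A} {ι : Type*} (r : Coalgebra.Repr ℂ f ι) : ∑ i ∈ r.index, rh (S (r.right i)) * rh (r.left i) = f 1 • 1 := by
  simp only [← rh_mul, ← map_sum, sum_mul_antipode_eq_smul r]; simp [rh_one, du_counit]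
omit hS in
lemma lhS2 {f : Du A} {ι : Type*} (r : Coalgebra.Repr ℂ f ι) : ∑ i ∈ r.index, lh (r.left i) * lh (S (r.right i)) = f 1 • 1 := by
  simp only [← lh_mul, ← map_sum, sum_mul_antipode_eq_smul r]; simp [lh_one, du_counit]

omit hS in
lemma cv_one_of {x y : Du A →ₗ[ℂ] End ℂ A}
    (h : ∀ f (r : Coalgebra.Repr ℂ f (Du A × Du A)), ∑ i ∈ r.index, x (r.left i) * y (r.right i) = f 1 • 1) : cv x * cv y = 1 := by
  ext f : 2
  have r := arbitrary ℂ f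
  rw [r.convMul_apply, h f r]
  simp [Algebra.algebraMap_eq_smul_one, du_counit]

lemma heis3 (x : A) : cL x * cv (rh ∘ₗ S) = cv (rh ∘ₗ S) * cv (LL.toLinearMap ∘ₗ rh.flip x) := by
  have h1 : cv (rh ∘ₗ S) * cv rh = (1 : Cv (Du A) (End ℂ A)) := cv_one_of fun f r => rhS1 hS r
  have h2 : cv rh * cv (rh ∘ₗ S) = (1 : Cv (Du A) (End ℂ A)) := cv_one_of fun f r => rhS2 hS r
  calc _ = (cv (rh ∘ₗ S) * cv rh) * cL x * cv (rh ∘ₗ S) := by rw [h1, one_mul]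
    _ = cv (rh ∘ₗ S) * (cv rh * cL x) * cv (rh ∘ₗ S) := by noncomm_ring
    _ = cv (rh ∘ₗ S) * cv (LL.toLinearMap ∘ₗ rh.flip x) * (cv rh * cv (rh ∘ₗ S)) := by rw [heis2]; noncomm_ring
    _ = _ := by rw [h2, mul_one]

omit hS in
lemma tr_conv {x y : Du A →ₗ[ℂ] End ℂ A} {t : Cv (Du A) (End ℂ A)} {X Q : End ℂ A}
    (ht : t = cv x * io X * cv y) (f : Du A) 
    (hr : ∀ (r : Coalgebra.Repr ℂ f (Du A × Du A)), ∑ i ∈ r.index, y (r.right i) * x (r.left i) = f 1 • 1)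
    (hQ : ∀ f, y f * Q = Q * y f) : tr (Q * t.ofConv f) = f 1 * tr (Q * X) := by
  have r := arbitrary ℂ f
  rw [ht, r.convMul_apply]
  simp only [conv_io, mul_sum, map_sum]
  have : ∀ i ∈ r.index, tr (Q * (x (r.left i) * X * y (r.right i))) = tr (Q * (y (r.right i) * x (r.left i)) * X) := by
    intro i _
    rw [← mul_assoc, ← mul_assoc, LinearMap.trace_mul_comm, ← mul_assoc, ← mul_assoc, hQ, mul_assoc Q]
  refine (sum_congr rfl this).trans ?_
  rw [← map_sum, ← sum_mul, ← mul_sum, hr r]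
  simp

def tw (Q : End ℂ A) : Du A := toL.symm (tr ∘ₗ LinearMap.mulLeft ℂ Q ∘ₗ (LinearMap.mul ℂ A))
omit hS in
lemma tw_apply (Q : End ℂ A) (x : A) : tw Q x = tr (Q * Lm x) := rfl

omit hS in
lemma tw_L {L : A} (h : IsInt L) (Q : End ℂ A) : tw Q L = eps (Q L) := by
  have : Q * Lm L = (counit (R := ℂ) (A := A)).smulRight (Q L) := by
    ext y; simp [h.right]
  rw [tw_apply, this, LinearMap.trace_smulRight]

lemma tw_left (Q : End ℂ A) (hQ : ∀ f : Du A, rh f * Q = Q * rh f) (f : Du A) : f * tw Q = f 1 • tw Q := by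
  apply du_ext; intro x
  rw [← du_rh, tw_apply]
  have h2 : cv rh * cv (rh ∘ₗ S) = (1 : Cv (Du A) (End ℂ A)) := cv_one_of fun f r => rhS2 hS r
  have ht : cv (LL.toLinearMap ∘ₗ rh.flip x) = cv rh * io (Lm x) * cv (rh ∘ₗ S) := by
    rw [heis2 x, mul_assoc, h2, mul_one]
  have key := tr_conv ht f (fun r => by simpa only [LinearMap.comp_apply] using rhS3 r) (Q := Q) (fun f => hQ (S f))
  rw [map_smul, LinearMap.smul_apply, tw_apply, smul_eq_mul]
  exact key

lemma tw_right (Q : End ℂ A) (hQ : ∀ f : Du A, lh f * Q = Q * lh f) (f : Du A) : tw Q * f = f 1 • tw Q := by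
  apply du_ext; intro x
  rw [← du_lh, tw_apply]
  have h2 : cv lh * cv (lh ∘ₗ S) = (1 : Cv (Du A) (End ℂ A)) := cv_one_of fun f r => lhS2 r
  have ht : cv (LL.toLinearMap ∘ₗ lh.flip x) = cv lh * io (Lm x) * cv (lh ∘ₗ S) := by
    rw [heis1 x, mul_assoc, h2, mul_one]
  have key := tr_conv ht f (fun r => by simpa only [LinearMap.comp_apply] using lhS1 hS r) (Q := Q) (fun f => hQ (S f))
  rw [map_smul, LinearMap.smul_apply, tw_apply, smul_eq_mul]
  exact key

omit hS in
lemma reg_tw : (reg : Du A) = tw 1 := by apply du_ext; intro x; rw [reg_apply, tw_apply, one_mul]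
lemma reg_left (f : Du A) : f * reg = f 1 • reg := by rw [reg_tw]; exact tw_left hS 1 (by simp) f
lemma reg_right (f : Du A) : reg * f = f 1 • reg := by rw [reg_tw]; exact tw_right hS 1 (by simp) f

lemma int_unique_l {L : A} (h : IsInt L) {m : Du A} (hm : ∀ f : Du A, f * m = f 1 • m) : m = m L • reg := by
  have h1 := h.int_unique hm
  have h2 := h.int_unique (reg_left hS)
  rw [h.reg_L, one_smul] at h2
  rw [h2]; exact h1
lemma int_unique_r {L : A} (h : IsInt L) {m : Du A} (hm : ∀ f : Du A, m * f = f 1 • m) : m = m L • reg := by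
  have key : ∀ {m : Du A}, (∀ f : Du A, m * f = f 1 • m) → S m = m L • reg := by
    intro m hm
    have := int_unique_l hS h (m := S m) fun f => by
      rw [← hS_du hS f, ← S_mul, hm, map_smul, hS_du hS]; simp
    rwa [du_antipode, show antipode ℂ L = L from h.S_L] at this
  have h1 := key hm
  have h2 := key (reg_right hS)
  rw [h.reg_L, one_smul] at h2
  calc m = S (S m) := (hS_du hS m).symm
    _ = _ := by rw [h1, map_smul, h2]

lemma tr_lh {L : A} (h : IsInt L) (f : Du A) (x : A) : tr (lh f * Lm x) = f L * reg x := by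
  rw [← tw_apply, int_unique_l hS h (tw_left hS (lh f) fun g => (lh_rh f g).symm), tw_L h]
  have := du_lh f 1 L
  rw [one_mul, du_one] at this
  simp [this]
lemma tr_gh {L : A} (h : IsInt L) (f : Du A) (x : A) : tr (rh (S f) * Lm x) = f L * reg x := by
  rw [← tw_apply, int_unique_r hS h (tw_right hS (rh (S f)) fun g => (lh_rh g _)), tw_L h]
  have := du_rh (S f) 1 L
  rw [mul_one, du_one, du_antipode, show antipode ℂ L = L from h.S_L] at this
  simp [this]
end
end

section
variable {A : Type*} [Ring A] [HopfAlgebra ℂ A] [FiniteDimensional ℂ A]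

section
variable {B : Type*} [Ring B] [Algebra ℂ B] (j : End ℂ A →ₐ[ℂ] B)

abbrev pj {C : Type*} [AddCommGroup C] [Module ℂ C] (x : C →ₗ[ℂ] End ℂ A) : Cv C B := cv (j.toLinearMap ∘ₗ x)

lemma heis1' : al (pj j LL.toLinearMap) * ee * be (pj j (lh (A := A))) = be (pj j lh) * al (pj j LL.toLinearMap) := by
  ext h : 2
  rw [aeb, be, io_conv, al_apply]
  have := congrArg (fun t : Cv (Du A) (End ℂ A) => (cv (j.toLinearMap ∘ₗ t.ofConv) : Cv (Du A) B)) (heis1 h)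
  simp only [cv_map] at this
  refine this.symm.trans ?_
  congr 1
  ext f; simp [io_apply]; rfl

lemma heis3' (hS : ∀ x : A, S (S x) = x) : be (pj j (rh (A := A) ∘ₗ S)) * ee * al (pj j LL.toLinearMap) = al (pj j LL.toLinearMap) * be (pj j (rh ∘ₗ S)) := by
  ext h : 2
  rw [bea, be, conv_io, al_apply]
  have := congrArg (fun t : Cv (Du A) (End ℂ A) => (cv (j.toLinearMap ∘ₗ t.ofConv) : Cv (Du A) B)) (heis3 hS h)
  simp only [cv_map] at this
  refine this.symm.trans ?_
  congr 1
  ext f; simp [io_apply]; rfl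

lemma rel_gen (hS : ∀ x : A, S (S x) = x) (j k : End ℂ A →ₐ[ℂ] B) (hjk : ∀ x y, j x * k y = k y * j x) :
    Rel (pj j LL.toLinearMap * pj k LL.toLinearMap) (pj k lh * pj j (rh (A := A) ∘ₗ S)) := by
  have h1 := heis1' (A := A) k
  have h2 := heis3' j hS
  have h3 : al (pj j (LL (A := A)).toLinearMap) * be (pj k (lh (A := A))) = be (pj k lh) * al (pj j LL.toLinearMap) :=
    al_be_comm _ _ fun h f => hjk _ _
  have h4 : al (pj k (LL (A := A)).toLinearMap) * be (pj j (rh (A := A) ∘ₗ S)) = be (pj j (rh ∘ₗ S)) * al (pj k LL.toLinearMap) :=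
    al_be_comm _ _ fun h f => (hjk _ _).symm
  rw [Rel, al_mul, be_mul]
  generalize al (pj j (LL (A := A)).toLinearMap) = Y at *
  generalize al (pj k (LL (A := A)).toLinearMap) = X at *
  generalize be (pj k (lh (A := A))) = P at *
  generalize be (pj j (rh (A := A) ∘ₗ S)) = G at *
  calc Y * X * ee * (P * G) = Y * (X * ee * P) * G := by simp only [mul_assoc]
    _ = (Y * P) * (X * G) := by rw [h1]; simp only [mul_assoc]
    _ = P * (Y * G) * X := by rw [h3, h4]; simp only [mul_assoc]
    _ = P * G * ee * (Y * X) := by rw [← h2]; simp only [mul_assoc]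
end

def TT (A : Type*) [Ring A] [Algebra ℂ A] : Type _ := A ⊗[ℂ] A
instance {A : Type*} [Ring A] [Algebra ℂ A] : AddCommGroup (TT A) := inferInstanceAs (AddCommGroup (A ⊗[ℂ] A))
instance {A : Type*} [Ring A] [Algebra ℂ A] : Module ℂ (TT A) := inferInstanceAs (Module ℂ (A ⊗[ℂ] A))
instance {A : Type*} [Ring A] [Algebra ℂ A] [FiniteDimensional ℂ A] : FiniteDimensional ℂ (TT A) := inferInstanceAs (Module.Finite ℂ (A ⊗[ℂ] A))
abbrev NN (A : Type*) [Ring A] [Algebra ℂ A] := End ℂ (TT A)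
def jl : End ℂ A →ₐ[ℂ] NN A := Module.End.rTensorAlgHom ℂ A A
def jr : End ℂ A →ₐ[ℂ] NN A := Module.End.lTensorAlgHom ℂ A A
lemma jlr (x y : End ℂ A) : jl x * jr y = jr y * jl x :=
  (LinearMap.rTensor_comp_lTensor A x y).trans (LinearMap.lTensor_comp_rTensor A x y).symm
lemma tr_jlr (x y : End ℂ A) : LinearMap.trace ℂ (TT A) (jl x * jr y) = tr x * tr y := by
  rw [← LinearMap.trace_tensorProduct']
  exact congrArg (LinearMap.trace ℂ (A ⊗[ℂ] A)) (LinearMap.rTensor_comp_lTensor A x y)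
def jmap {C C' : Type*} [Ring C] [Algebra ℂ C] [Ring C'] [Algebra ℂ C'] (f : C →ₐ[ℂ] End ℂ A) (g : C' →ₐ[ℂ] End ℂ A) : C ⊗[ℂ] C' →ₐ[ℂ] NN A :=
  Algebra.TensorProduct.lift (jl.comp f) (jr.comp g) fun x y => jlr _ _
@[simp] lemma jmap_tmul {C C' : Type*} [Ring C] [Algebra ℂ C] [Ring C'] [Algebra ℂ C'] (f : C →ₐ[ℂ] End ℂ A) (g : C' →ₐ[ℂ] End ℂ A) (x : C) (y : C') :
    jmap f g (x ⊗ₜ y) = jl (f x) * jr (g y) := rfl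
def aN : A →ₐ[ℂ] NN A := (jmap LL LL).comp (Bialgebra.comulAlgHom ℂ A)
def bN : Du A →ₐ[ℂ] NN A := ((jmap (ghA (A := A)) (lhA (A := A))).comp (Algebra.TensorProduct.comm ℂ (Du A) (Du A) : Du A ⊗[ℂ] Du A →ₐ[ℂ] Du A ⊗[ℂ] Du A)).comp
  (Bialgebra.comulAlgHom ℂ (Du A))

lemma aN_repr {h : A} {ι : Type*} (r : Coalgebra.Repr ℂ h ι) : aN h = ∑ i ∈ r.index, jl (Lm (r.left i)) * jr (Lm (r.right i)) := by
  simp only [aN, AlgHom.comp_apply, Bialgebra.comulAlgHom_apply, ← r.eq, map_sum, jmap_tmul]; rfl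
lemma bN_repr {f : Du A} {ι : Type*} (r : Coalgebra.Repr ℂ f ι) : bN f = ∑ i ∈ r.index, jl (rh (S (r.right i))) * jr (lh (r.left i)) := by
  simp only [bN, AlgHom.comp_apply, Bialgebra.comulAlgHom_apply, ← r.eq, map_sum]; rfl

lemma relN (hS : ∀ x : A, S (S x) = x) : Rel (cv (aN (A := A)).toLinearMap) (cv (bN (A := A)).toLinearMap) := by
  have := rel_gen hS (jl (A := A)) jr jlr
  convert this using 1
  · ext h : 2
    have r := arbitrary ℂ h
    rw [r.convMul_apply]
    exact aN_repr r
  · ext h : 2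
    have r := arbitrary ℂ h
    rw [r.convMul_apply]
    exact (bN_repr r).trans (scr fun i _ => jlr _ _)

lemma trN (hS : ∀ x : A, S (S x) = x) {L : A} (hL : IsInt L) (f : Du A) (h : A) :
    LinearMap.trace ℂ (TT A) (bN f * aN h) = finrank ℂ A * (f L * reg h) := by
  have r := arbitrary ℂ f
  have q := arbitrary ℂ h
  rw [bN_repr r, aN_repr q, sum_mul_sum]
  have h0 : ∀ x y x' y' : End ℂ A, jl x * jr y * (jl x' * jr y') = jl (x * x') * jr (y * y') := by
    intro x y x' y'
    rw [mul_assoc, ← mul_assoc (jr y), ← jlr, map_mul, map_mul]; simp only [mul_assoc]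
  simp only [map_sum, h0, tr_jlr, tr_gh hS hL, tr_lh hS hL]
  have h1 : ∑ i ∈ r.index, r.left i L * r.right i L = f L := by rw [du_repr r, hL.left]; simp [hL.norm]
  have h2 : ∑ i ∈ q.index, reg (q.left i) * reg (q.right i) = finrank ℂ A * reg h := by
    rw [← du_mul _ _ q, reg_left hS]; simp [reg_one]
  have : ∀ i ∈ r.index, ∀ j ∈ q.index, r.right i L * reg (q.left j) * (r.left i L * reg (q.right j)) =
      (r.left i L * r.right i L) * (reg (q.left j) * reg (q.right j)) := by intros; ring
  rw [scr fun i hi => scr fun j hj => this i hi j hj, ← sum_mul_sum, h1, h2]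
  ring
end

section
lemma tens_sep {V W : Type*} [AddCommGroup V] [Module ℂ V] [FiniteDimensional ℂ V] [AddCommGroup W] [Module ℂ W] [FiniteDimensional ℂ W]
    (F : V →ₗ[ℂ] Module.Dual ℂ V) (G : W →ₗ[ℂ] Module.Dual ℂ W) (hF : ∀ x, (∀ v, F x v = 0) → x = 0) (hG : ∀ x, (∀ v, G x v = 0) → x = 0) (t : V ⊗[ℂ] W)
    (h : ∀ v w, LinearMap.mul' ℂ ℂ (TensorProduct.map (F.flip v) (G.flip w) t) = 0) : t = 0 := by
  have i1 : Function.Injective F := (injective_iff_map_eq_zero F).2 fun x hx => hF x fun v => by rw [hx]; rfl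
  have i2 : Function.Injective G := (injective_iff_map_eq_zero G).2 fun x hx => hG x fun v => by rw [hx]; rfl
  refine (injective_iff_map_eq_zero (TensorProduct.map F G)).1 (TensorProduct.map_injective_of_flat_flat _ _ i1 i2) t ?_
  refine (injective_iff_map_eq_zero _).1 (TensorProduct.dualDistribEquiv ℂ V W).injective _ ?_
  apply TensorProduct.ext'
  intro v w
  rw [LinearMap.zero_apply, ← h v w]
  clear h
  induction t using TensorProduct.induction_on with
  | zero => simp
  | add a b ha hb => simp only [map_add, LinearMap.add_apply, ha, hb]
  | tmul a b => exact TensorProduct.dualDistrib_apply _ _ _ _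

variable {A : Type*} [Ring A] [HopfAlgebra ℂ A] [FiniteDimensional ℂ A]

def lt (f : Du A) (y : A) : Du A := toL.symm (toL f ∘ₗ LinearMap.mulLeft ℂ y)
@[simp] lemma lt_apply (f : Du A) (y x : A) : lt f y x = f (y * x) := rfl
lemma lt_eq {f : Du A} {ι : Type*} (q : Coalgebra.Repr ℂ f ι) (y : A) : lt f y = ∑ j ∈ q.index, q.left j y • q.right j := by
  apply du_ext; intro x; simp [du_repr q]

def tt (h : A) (f : Du A) : Du A ⊗[ℂ] A :=
  ∑ i ∈ (arbitrary ℂ h).index,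
    ∑ j ∈ (arbitrary ℂ (lt f (S ((arbitrary ℂ h).right i)))).index,
      (arbitrary ℂ (lt f (S ((arbitrary ℂ h).right i)))).left j ⊗ₜ
        rh ((arbitrary ℂ (lt f (S ((arbitrary ℂ h).right i)))).right j) ((arbitrary ℂ h).left i)

section
variable {B : Type*} [Ring B] [Algebra ℂ B] (a : A →ₐ[ℂ] B) (b : Du A →ₐ[ℂ] B)
def Th : Du A ⊗[ℂ] A →ₗ[ℂ] B := LinearMap.mul' ℂ B ∘ₗ TensorProduct.map b.toLinearMap a.toLinearMap
@[simp] lemma Th_tmul (f : Du A) (h : A) : Th a b (f ⊗ₜ h) = b f * a h := rfl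

abbrev RelA := Rel (cv (B := B) a.toLinearMap) (cv (B := B) b.toLinearMap)

lemma ab_tt (hS : ∀ x : A, S (S x) = x) (hr : RelA a b) (h : A) (f : Du A) : a h * b f = Th a b (tt h f) := by
  rw [RelA, rel_iff] at hr
  let K : A ⊗[ℂ] A →ₗ[ℂ] B := LinearMap.mul' ℂ B ∘ₗ TensorProduct.map a.toLinearMap
    (b.toLinearMap ∘ₗ toL.symm.toLinearMap ∘ₗ (LinearMap.llcomp ℂ A A ℂ (toL f)) ∘ₗ LinearMap.mul ℂ A)
  have hK : ∀ x y, K (x ⊗ₜ y) = a x * b (lt f y) := fun x y => rfl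
  have h1 : ∀ (z h : A), (WithConv.toConv ((cv (B := B) a.toLinearMap).ofConv ∘ₗ lh.flip h) * cv b.toLinearMap : Cv (Du A) B).ofConv (lt f z) =
      K ((1 ⊗ₜ z) * comul (R := ℂ) h) := by
    intro z h
    have q := arbitrary ℂ h
    have r := arbitrary ℂ (lt f z)
    rw [r.convMul_apply, ← q.eq, mul_sum, map_sum]
    simp only [Algebra.TensorProduct.tmul_mul_tmul, hK, one_mul]
    have : ∀ k ∈ q.index, a (q.left k) * b (lt f (z * q.right k)) = ∑ j ∈ r.index, a (q.left k) * (r.left j (q.right k) • b (r.right j)) := by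
      intro k _
      have e : lt f (z * q.right k) = lt (lt f z) (q.right k) := by apply du_ext; intro x; simp [mul_assoc]
      rw [e, lt_eq r]; simp [mul_sum]
    rw [sum_congr rfl this, sum_comm]
    refine scr fun j _ => ?_
    simp [lh_repr _ q, sum_mul]
  have h2 : a h * b f = K (h ⊗ₜ 1) := by
    rw [hK]; congr 2; apply du_ext; intro x; simp
  rw [h2, ← theta_key' hS (arbitrary ℂ h), map_sum]
  rw [tt, map_sum]
  refine scr fun i _ => ?_
  rw [← h1, hr]
  rw [(arbitrary ℂ (lt f (S ((arbitrary ℂ h).right i)))).convMul_apply, map_sum]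
  rfl

def sw (f : Du A) (h : A) : Du A ⊗[ℂ] A →ₗ[ℂ] Du A ⊗[ℂ] A := TensorProduct.map (LinearMap.mulLeft ℂ f) (LinearMap.mulRight ℂ h)
lemma Th_sw (f : Du A) (h : A) (t) : Th a b (sw f h t) = b f * Th a b t * a h := by
  induction t using TensorProduct.induction_on with
  | zero => simp
  | add x y hx hy => simp [hx, hy, mul_add, add_mul]
  | tmul x y => simp [sw, mul_assoc]

lemma Th_mul (hS : ∀ x : A, S (S x) = x) {B' : Type*} [Ring B'] [Algebra ℂ B'] {a : A →ₐ[ℂ] B} {b : Du A →ₐ[ℂ] B} {a' : A →ₐ[ℂ] B'} {b' : Du A →ₐ[ℂ] B'}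
    (hr : RelA a b) (hr' : RelA a' b') (s t : Du A ⊗[ℂ] A) : ∃ u : Du A ⊗[ℂ] A, Th a b s * Th a b t = Th a b u ∧ Th a' b' s * Th a' b' t = Th a' b' u := by
  induction s using TensorProduct.induction_on with
  | zero => exact ⟨0, by simp⟩
  | add x y hx hy =>
    obtain ⟨u, hu, hu'⟩ := hx
    obtain ⟨v, hv, hv'⟩ := hy
    exact ⟨u + v, by simp [add_mul, hu, hv, hu', hv']⟩
  | tmul f h => 
    induction t using TensorProduct.induction_on with
    | zero => exact ⟨0, by simp⟩
    | add x y hx hy =>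
      obtain ⟨u, hu, hu'⟩ := hx
      obtain ⟨v, hv, hv'⟩ := hy
      exact ⟨u + v, by simp only [mul_add, map_add, hu, hv, and_self, hu', hv']⟩
    | tmul g k => 
      refine ⟨sw f k (tt h g), ?_, ?_⟩
      · rw [Th_sw, ← ab_tt a b hS hr]; simp [mul_assoc]
      · rw [Th_sw, ← ab_tt a' b' hS hr']; simp [mul_assoc]

lemma relA_iff {a : A →ₐ[ℂ] B} {b : Du A →ₐ[ℂ] B} : RelA a b ↔ ∀ (h : A),
    (cv (a.toLinearMap ∘ₗ lh.flip h) * cv b.toLinearMap : Cv (Du A) B) = cv b.toLinearMap * cv (a.toLinearMap ∘ₗ rh.flip h) := by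
  rw [RelA, rel_iff]
  exact ⟨fun H h => by ext f; exact H h f, fun H h f => by rw [← LinearMap.congr_fun (congrArg WithConv.ofConv (H h)) f]⟩
lemma relA_push {B' : Type*} [Ring B'] [Algebra ℂ B'] (j : B →ₐ[ℂ] B') (a : A →ₐ[ℂ] B) (b : Du A →ₐ[ℂ] B) (h : A) :
    (cv ((j.comp a).toLinearMap ∘ₗ lh.flip h) * cv (j.comp b).toLinearMap : Cv (Du A) B') = cv (j.toLinearMap ∘ₗ (cv (a.toLinearMap ∘ₗ lh.flip h) * cv b.toLinearMap : Cv (Du A) B).ofConv) ∧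
    (cv (j.comp b).toLinearMap * cv ((j.comp a).toLinearMap ∘ₗ rh.flip h) : Cv (Du A) B') = cv (j.toLinearMap ∘ₗ (cv b.toLinearMap * cv (a.toLinearMap ∘ₗ rh.flip h) : Cv (Du A) B).ofConv) := by
  exact ⟨(cv_map j (cv (a.toLinearMap ∘ₗ lh.flip h)) (cv b.toLinearMap)).symm, (cv_map j (cv b.toLinearMap) (cv (a.toLinearMap ∘ₗ rh.flip h))).symm⟩
lemma relA_map_iff {B' : Type*} [Ring B'] [Algebra ℂ B'] (j : B →ₐ[ℂ] B') (hj : Function.Injective j) {a : A →ₐ[ℂ] B} {b : Du A →ₐ[ℂ] B} :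
    RelA (j.comp a) (j.comp b) → RelA a b := by
  rw [relA_iff, relA_iff]
  intro H h
  have := H h
  rw [(relA_push j a b h).1, (relA_push j a b h).2] at this
  ext f
  exact hj (LinearMap.congr_fun (congrArg WithConv.ofConv this) f)
end

section
variable [IsSemisimpleRing A]
lemma hS_ss (x : A) : S (S x) = x := S_S (Classical.choice (exists_wed A)) x
lemma exists_Lam (A : Type*) [Ring A] [HopfAlgebra ℂ A] [FiniteDimensional ℂ A] [IsSemisimpleRing A] : ∃ L : A, IsInt L := by
  obtain ⟨W⟩ := exists_wed A
  obtain ⟨i, h⟩ := W.exists_triv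
  exact ⟨_, h.2.2⟩
def Lam (A : Type*) [Ring A] [HopfAlgebra ℂ A] [FiniteDimensional ℂ A] [IsSemisimpleRing A] : A := (exists_Lam A).choose
lemma Lam_int : IsInt (Lam A) := (exists_Lam A).choose_spec

lemma reg_nd {x : A} (h : ∀ y, reg (x * y) = 0) : x = 0 := (Classical.choice (exists_wed A)).reg_nondeg h
lemma n_ne : (finrank ℂ A : ℂ) ≠ 0 := by
  intro h
  have h1 : reg (1 : A) = 0 := by rw [reg_one, h]
  have : ∀ x : A, x = 0 := fun x => reg_nd fun y => by
    have := Module.finrank_zero_iff (R := ℂ) (M := A) |>.1 (by exact_mod_cast h)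
    rw [Subsingleton.elim (x * y) 0, map_zero]
  have h2 := (Lam_int (A := A)).norm
  rw [this (Lam A)] at h2
  simp at h2

def fo1 : Du A →ₗ[ℂ] Module.Dual ℂ (Du A) :=
  LinearMap.mk₂ ℂ (fun x y => (y * x) (Lam A)) (by simp [mul_add]) (by simp) (by simp [add_mul]) (by simp)
def fo2 : A →ₗ[ℂ] Module.Dual ℂ A :=
  LinearMap.mk₂ ℂ (fun x y => reg (x * y)) (by simp [add_mul]) (by simp) (by simp [mul_add]) (by simp)
@[simp] lemma fo1_apply (x y : Du A) : fo1 x y = (y * x) (Lam A) := rfl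
@[simp] lemma fo2_apply (x y : A) : fo2 x y = reg (x * y) := rfl
lemma Th_sep {B : Type*} [Ring B] [Algebra ℂ B] (a : A →ₐ[ℂ] B) (b : Du A →ₐ[ℂ] B) (τ : B →ₗ[ℂ] ℂ)
    (hτ : ∀ f h, τ (b f * a h) = finrank ℂ A * (f (Lam A) * reg h)) (t : Du A ⊗[ℂ] A) (h : ∀ f k, τ (b f * Th a b t * a k) = 0) : t = 0 := by
  refine tens_sep fo1 fo2 (fun x hx => Lam_int.dual_nondeg hx) (fun x hx => reg_nd hx) t fun v w => ?_
  have := h v w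
  rw [← Th_sw] at this
  have key : ∀ t, τ (Th a b (sw v w t)) = finrank ℂ A * LinearMap.mul' ℂ ℂ (TensorProduct.map (fo1.flip v) (fo2.flip w) t) := by
    intro t
    induction t using TensorProduct.induction_on with
    | zero => simp
    | add x y hx hy => simp only [map_add, hx, hy, mul_add]
    | tmul x y => 
      have := hτ (v * x) (y * w)
      exact this
  rw [key] at this
  exact (mul_eq_zero.1 this).resolve_left n_ne

abbrev ThN : Du A ⊗[ℂ] A →ₗ[ℂ] NN A := Th aN bN
lemma ThN_sep (t : Du A ⊗[ℂ] A) (h : ∀ f k, LinearMap.trace ℂ (TT A) (bN f * ThN t * aN k) = 0) : t = 0 :=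
  Th_sep aN bN (LinearMap.trace ℂ (TT A)) (trN hS_ss Lam_int) t h
lemma ThN_inj : Function.Injective (ThN (A := A)) := (injective_iff_map_eq_zero _).2 fun t ht => ThN_sep t fun f k => by simp [ht]

def Dsub (A : Type*) [Ring A] [HopfAlgebra ℂ A] [FiniteDimensional ℂ A] [IsSemisimpleRing A] : Subalgebra ℂ (NN A) where
  carrier := LinearMap.range (ThN (A := A))
  mul_mem' := by
    rintro _ _ ⟨s, rfl⟩ ⟨t, rfl⟩
    obtain ⟨u, hu, -⟩ := Th_mul (B := NN A) hS_ss (relN (A := A) hS_ss) (relN (A := A) hS_ss) s t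
    exact ⟨u, hu.symm⟩
  add_mem' := fun h k => (LinearMap.range _).add_mem h k
  algebraMap_mem' := fun r => ⟨r • (1 ⊗ₜ 1), by 
    rw [map_smul, Algebra.algebraMap_eq_smul_one]
    exact congrArg (r • ·) (by simp [ThN])⟩

def Db (A : Type*) [Ring A] [HopfAlgebra ℂ A] [FiniteDimensional ℂ A] [IsSemisimpleRing A] : Type _ := ↥(Dsub A)
instance : Ring (Db A) := inferInstanceAs (Ring ↥(Dsub A))
instance : Algebra ℂ (Db A) := inferInstanceAs (Algebra ℂ ↥(Dsub A))
def dv : Db A →ₐ[ℂ] NN A := (Dsub A).val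
lemma dv_inj : Function.Injective (dv (A := A)) := Subtype.val_injective
def da : A →ₐ[ℂ] Db A := (aN (A := A)).codRestrict (Dsub A) fun x => ⟨1 ⊗ₜ x, by simp [ThN]⟩
def db : Du A →ₐ[ℂ] Db A := (bN (A := A)).codRestrict (Dsub A) fun x => ⟨x ⊗ₜ 1, by simp [ThN]⟩
@[simp] lemma dv_da (x : A) : dv (da x) = aN x := rfl
@[simp] lemma dv_db (x : Du A) : dv (db x) = bN x := rfl
lemma relD : RelA (da (A := A)) db := relA_map_iff (B' := NN A) (dv (A := A)) dv_inj (relN hS_ss)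
def ThD : Du A ⊗[ℂ] A →ₗ[ℂ] Db A := Th da db
lemma dv_ThD (t : Du A ⊗[ℂ] A) : dv (ThD t) = ThN t := by
  induction t using TensorProduct.induction_on with
  | zero => simp
  | add x y hx hy => simp only [map_add, hx, hy]
  | tmul x y => simp [ThD, ThN]
lemma ThD_bij : Function.Bijective (ThD (A := A)) := by
  constructor
  · intro s t h; apply ThN_inj; rw [← dv_ThD, ← dv_ThD, h]
  · rintro ⟨x, t, rfl⟩; exact ⟨t, dv_inj (dv_ThD t)⟩
def PB : (Du A ⊗[ℂ] A) ≃ₗ[ℂ] Db A := LinearEquiv.ofBijective ThD ThD_bij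
lemma PB_apply (t : Du A ⊗[ℂ] A) : PB t = Th da db t := rfl
@[simp] lemma PB_tmul (f : Du A) (h : A) : PB (f ⊗ₜ h) = db f * da h := rfl
instance : FiniteDimensional ℂ (Db A) := Module.Finite.equiv (PB (A := A))
lemma finrank_Db : finrank ℂ (Db A) = finrank ℂ A ^ 2 := by
  rw [← (PB (A := A)).finrank_eq, Module.finrank_tensorProduct, finrank_du, sq]

lemma Db_ind {P : Db A → Prop} (x : Db A) (h1 : ∀ x y, P x → P y → P (x + y)) (h2 : ∀ f h, P (db f * da h)) : P x := by
  obtain ⟨t, rfl⟩ := (PB (A := A)).surjective x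
  induction t using TensorProduct.induction_on with
  | zero => simpa using h2 0 0
  | add x y hx hy => rw [map_add]; exact h1 _ _ hx hy
  | tmul x y => exact h2 _ _
lemma Db_ext {M : Type*} [AddCommGroup M] [Module ℂ M] {F G : Db A →ₗ[ℂ] M} (h : ∀ f x, F (db f * da x) = G (db f * da x)) : F = G := by
  ext x
  induction x using Db_ind with
  | h1 x y hx hy => simp [hx, hy]
  | h2 f x => exact h f x
lemma Db_algExt {B : Type*} [Ring B] [Algebra ℂ B] {F G : Db A →ₐ[ℂ] B} (h1 : ∀ x, F (da x) = G (da x)) (h2 : ∀ x, F (db x) = G (db x)) : F = G := by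
  apply AlgHom.toLinearMap_injective
  apply Db_ext; intro f x; simp [h1, h2]

def Dlift {B : Type*} [Ring B] [Algebra ℂ B] {a : A →ₐ[ℂ] B} {b : Du A →ₐ[ℂ] B} (hr : RelA a b) : Db A →ₐ[ℂ] B :=
  AlgHom.ofLinearMap (Th a b ∘ₗ (PB (A := A)).symm.toLinearMap) (by
    have : (1 : Db A) = PB ((1 : Du A) ⊗ₜ (1 : A)) := by simp
    rw [this]; simp [-PB_tmul]) (by
    intro x y
    obtain ⟨s, rfl⟩ := (PB (A := A)).surjective x
    obtain ⟨t, rfl⟩ := (PB (A := A)).surjective y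
    obtain ⟨u, hu, hu'⟩ := Th_mul hS_ss relD hr s t
    rw [PB_apply s, PB_apply t, hu, ← PB_apply, ← PB_apply, ← PB_apply]
    simp [hu'])
lemma Dlift_ba {B : Type*} [Ring B] [Algebra ℂ B] {a : A →ₐ[ℂ] B} {b : Du A →ₐ[ℂ] B} (hr : RelA a b) (f : Du A) (h : A) :
    Dlift hr (db f * da h) = b f * a h := by
  rw [← PB_tmul]; simp [Dlift, -PB_tmul]
@[simp] lemma Dlift_a {B : Type*} [Ring B] [Algebra ℂ B] {a : A →ₐ[ℂ] B} {b : Du A →ₐ[ℂ] B} (hr : RelA a b) (h : A) :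
    Dlift hr (da h) = a h := by simpa using Dlift_ba hr 1 h
@[simp] lemma Dlift_b {B : Type*} [Ring B] [Algebra ℂ B] {a : A →ₐ[ℂ] B} {b : Du A →ₐ[ℂ] B} (hr : RelA a b) (f : Du A) :
    Dlift hr (db f) = b f := by simpa using Dlift_ba hr f 1

instance : IsSemisimpleRing (Db A) := by
  haveI : IsArtinianRing (Db A) := IsArtinianRing.of_finite ℂ (Db A)
  rw [IsArtinianRing.isSemisimpleRing_iff_jacobson, eq_bot_iff]
  intro x hx
  obtain ⟨n, hn⟩ := IsSemiprimaryRing.isNilpotent (R := Db A)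
  obtain ⟨t, rfl⟩ := (PB (A := A)).surjective x
  have : t = 0 := ThN_sep t fun f k => by
    have h1 : db f * PB t * da k ∈ Ring.jacobson (Db A) := Ideal.mul_mem_right _ _ (Ideal.mul_mem_left _ _ hx)
    have h2 : (db f * PB t * da k) ^ n = 0 := by
      have := Ideal.pow_mem_pow h1 n
      rw [hn] at this; simpa using this
    have h3 : bN f * ThN t * aN k = dv (db f * PB t * da k) := by rw [map_mul, map_mul, ← dv_ThD]; rfl
    rw [h3]
    refine (LinearMap.isNilpotent_trace_of_isNilpotent ?_).eq_zero
    exact ⟨n, by rw [← map_pow, h2, map_zero]⟩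
  simp [this]
end
end

section
variable {A : Type*} [Ring A] [HopfAlgebra ℂ A] [FiniteDimensional ℂ A]

section
variable {B : Type*} [Ring B] [Algebra ℂ B]
lemma relA_map {B' : Type*} [Ring B'] [Algebra ℂ B'] (j : B →ₐ[ℂ] B') {a : A →ₐ[ℂ] B} {b : Du A →ₐ[ℂ] B} (H : RelA a b) :
    RelA (j.comp a) (j.comp b) := by
  rw [relA_iff] at *
  intro h
  rw [(relA_push j a b h).1, (relA_push j a b h).2, H]

def cA {C : Type*} [Ring C] [Algebra ℂ C] (a : A →ₐ[ℂ] C) (j k : C →ₐ[ℂ] B) (hjk : ∀ x y, j x * k y = k y * j x) : A →ₐ[ℂ] B :=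
  (Algebra.TensorProduct.lift (j.comp a) (k.comp a) fun x y => hjk _ _).comp (Bialgebra.comulAlgHom ℂ A)
def cB {C : Type*} [Ring C] [Algebra ℂ C] (b : Du A →ₐ[ℂ] C) (j k : C →ₐ[ℂ] B) (hjk : ∀ x y, j x * k y = k y * j x) : Du A →ₐ[ℂ] B :=
  (Algebra.TensorProduct.lift (k.comp b) (j.comp b) fun x y => (hjk _ _).symm).comp (Bialgebra.comulAlgHom ℂ (Du A))
lemma cA_repr {C : Type*} [Ring C] [Algebra ℂ C] (a : A →ₐ[ℂ] C) (j k : C →ₐ[ℂ] B) (hjk : ∀ x y, j x * k y = k y * j x) {h : A} {ι : Type*} (r : Coalgebra.Repr ℂ h ι) :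
    cA a j k hjk h = ∑ i ∈ r.index, j (a (r.left i)) * k (a (r.right i)) := by
  simp [cA, ← r.eq]; exact scr fun _ _ => rfl
lemma cB_repr {C : Type*} [Ring C] [Algebra ℂ C] (b : Du A →ₐ[ℂ] C) (j k : C →ₐ[ℂ] B) (hjk : ∀ x y, j x * k y = k y * j x) {h : Du A} {ι : Type*} (r : Coalgebra.Repr ℂ h ι) :
    cB b j k hjk h = ∑ i ∈ r.index, k (b (r.left i)) * j (b (r.right i)) := by
  simp [cB, ← r.eq]; exact scr fun _ _ => rfl

lemma cA_conv {C : Type*} [Ring C] [Algebra ℂ C] (a : A →ₐ[ℂ] C) (j k : C →ₐ[ℂ] B) (hjk : ∀ x y, j x * k y = k y * j x) :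
    cv (B := B) (cA a j k hjk).toLinearMap = cv (j.comp a).toLinearMap * cv (k.comp a).toLinearMap := by
  ext h
  have r := arbitrary ℂ h
  rw [r.convMul_apply]; exact cA_repr a j k hjk r
lemma cB_conv {C : Type*} [Ring C] [Algebra ℂ C] (b : Du A →ₐ[ℂ] C) (j k : C →ₐ[ℂ] B) (hjk : ∀ x y, j x * k y = k y * j x) :
    cv (B := B) (cB b j k hjk).toLinearMap = cv (k.comp b).toLinearMap * cv (j.comp b).toLinearMap := by
  ext h
  have r := arbitrary ℂ h
  rw [r.convMul_apply]; exact cB_repr b j k hjk r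

lemma rel_c {C : Type*} [Ring C] [Algebra ℂ C] {a : A →ₐ[ℂ] C} {b : Du A →ₐ[ℂ] C} (H : RelA a b) (j k : C →ₐ[ℂ] B) (hjk : ∀ x y, j x * k y = k y * j x) :
    RelA (cA a j k hjk) (cB b j k hjk) := by
  have e1 := cA_conv a j k hjk
  have e2 := cB_conv b j k hjk
  have h1 := relA_map j H
  have h2 := relA_map k H
  have h3 : al (cv (B := B) (j.comp a).toLinearMap) * be (cv (k.comp b).toLinearMap) = be (cv (k.comp b).toLinearMap) * al (cv (j.comp a).toLinearMap) :=
    al_be_comm _ _ fun h f => hjk _ _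
  have h4 : al (cv (B := B) (k.comp a).toLinearMap) * be (cv (j.comp b).toLinearMap) = be (cv (j.comp b).toLinearMap) * al (cv (k.comp a).toLinearMap) :=
    al_be_comm _ _ fun h f => (hjk _ _).symm
  rw [RelA, Rel, e1, e2, al_mul, be_mul]
  rw [RelA, Rel] at h1 h2
  generalize al (cv (B := B) (j.comp a).toLinearMap) = Y at *
  generalize al (cv (B := B) (k.comp a).toLinearMap) = X at *
  generalize be (cv (B := B) (k.comp b).toLinearMap) = P at *
  generalize be (cv (B := B) (j.comp b).toLinearMap) = G at *
  calc Y * X * ee * (P * G) = Y * (X * ee * P) * G := by simp only [mul_assoc]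
    _ = (Y * P) * ee * (X * G) := by rw [h2]; simp only [mul_assoc]
    _ = P * (Y * ee * G) * X := by rw [h3, h4]; simp only [mul_assoc]
    _ = P * G * ee * (Y * X) := by rw [h1]; simp only [mul_assoc]
end

lemma rel_eps : RelA (Bialgebra.counitAlgHom ℂ A) (Bialgebra.counitAlgHom ℂ (Du A)) := by
  rw [relA_iff]
  intro h
  have : cv (B := ℂ) (Bialgebra.counitAlgHom ℂ (Du A)).toLinearMap = (1 : Cv (Du A) ℂ) := by
    ext f; simp
  rw [this, one_mul, mul_one]
  congr 1
  ext f
  show eps (lh f h) = eps (rh f h)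
  have h1 := du_lh f 1 h
  have h2 := du_rh f 1 h
  rw [one_mul, du_one] at h1
  rw [mul_one, du_one] at h2
  exact h1.trans h2.symm

def Srep {f : Du A} {ι : Type*} (r : Coalgebra.Repr ℂ f ι) : Coalgebra.Repr ℂ (S f) ι where
  index := r.index
  left i := S (r.right i)
  right i := S (r.left i)
  eq := by
    refine E2_sep fun x y => ?_
    rw [E2_comul]
    simp only [map_sum, E2_tmul, du_antipode]
    rw [show antipode ℂ (x * y) = antipode ℂ y * antipode ℂ x from S_mul x y, ← du_repr r]
    exact scr fun i _ => mul_comm _ _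

section
variable [IsSemisimpleRing A]
lemma S_lh (f : Du A) (h : A) : S (lh f h) = rh (S f) (S h) := by
  refine du_sep fun k => ?_
  rw [du_rh, ← du_antipode, du_lh, ← du_antipode, S_mul, hS_du hS_ss]
lemma S_rh (f : Du A) (h : A) : S (rh f h) = lh (S f) (S h) := by
  refine du_sep fun k => ?_
  rw [du_lh, ← du_antipode, du_rh, ← du_antipode, S_mul, hS_du hS_ss]

def opS {C : Type*} [Ring C] [HopfAlgebra ℂ C] {B : Type*} [Ring B] [Algebra ℂ B] (a : C →ₐ[ℂ] B) : C →ₐ[ℂ] Bᵐᵒᵖ :=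
  AlgHom.ofLinearMap ((MulOpposite.opLinearEquiv ℂ).toLinearMap ∘ₗ a.toLinearMap ∘ₗ S) (by simp) (by
    intro x y; simp only [LinearMap.comp_apply]; rw [S_mul]; simp)
@[simp] lemma opS_apply {C : Type*} [Ring C] [HopfAlgebra ℂ C] {B : Type*} [Ring B] [Algebra ℂ B] (a : C →ₐ[ℂ] B) (x : C) :
    opS a x = MulOpposite.op (a (S x)) := rfl

lemma rel_S : RelA (opS (da (A := A))) (opS db) := by
  rw [relA_iff]
  intro h
  ext f
  have r := arbitrary ℂ f
  have := LinearMap.congr_fun (congrArg WithConv.ofConv (relA_iff.1 (relD (A := A)) (S h))) (S f)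
  rw [(Srep r).convMul_apply, (Srep r).convMul_apply] at this
  rw [r.convMul_apply, r.convMul_apply]
  apply MulOpposite.unop_injective
  simp only [LinearMap.comp_apply, LinearMap.flip_apply, AlgHom.toLinearMap_apply, opS_apply, Finset.unop_sum, MulOpposite.unop_mul, MulOpposite.unop_op, Srep] at this ⊢
  simp only [S_lh, S_rh]
  exact this.symm
end
end

section
variable {A : Type*} [Ring A] [HopfAlgebra ℂ A] [FiniteDimensional ℂ A] [IsSemisimpleRing A]

abbrev inL : Db A →ₐ[ℂ] Db A ⊗[ℂ] Db A := Algebra.TensorProduct.includeLeft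
abbrev inR : Db A →ₐ[ℂ] Db A ⊗[ℂ] Db A := Algebra.TensorProduct.includeRight
lemma inLR (x y : Db A) : inL x * inR y = inR y * inL x := by simp

def dD : Db A →ₐ[ℂ] Db A ⊗[ℂ] Db A := Dlift (rel_c relD inL inR inLR)
def dE : Db A →ₐ[ℂ] ℂ := Dlift rel_eps
def dS : Db A →ₐ[ℂ] (Db A)ᵐᵒᵖ := Dlift rel_S

section
variable {B : Type*} [Ring B] [Algebra ℂ B]
lemma dD_a (g : Db A ⊗[ℂ] Db A →ₐ[ℂ] B) :
    cv ((g.comp dD).comp da).toLinearMap = cv ((g.comp inL).comp da).toLinearMap * cv ((g.comp inR).comp da).toLinearMap := by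
  rw [← cA_conv da (g.comp inL) (g.comp inR) fun x y => by simp only [AlgHom.comp_apply, ← map_mul, inLR]]
  congr 1
  ext h
  have r := arbitrary ℂ h
  simp only [AlgHom.toLinearMap_apply]
  rw [cA_repr _ _ _ _ r]
  simp only [AlgHom.comp_apply, dD, Dlift_a]
  rw [cA_repr _ _ _ _ r, map_sum]
  simp only [map_mul]
lemma dD_b (g : Db A ⊗[ℂ] Db A →ₐ[ℂ] B) :
    cv ((g.comp dD).comp db).toLinearMap = cv ((g.comp inR).comp db).toLinearMap * cv ((g.comp inL).comp db).toLinearMap := by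
  rw [← cB_conv db (g.comp inL) (g.comp inR) fun x y => by simp only [AlgHom.comp_apply, ← map_mul, inLR]]
  congr 1
  ext h
  have r := arbitrary ℂ h
  simp only [AlgHom.toLinearMap_apply]
  rw [cB_repr _ _ _ _ r]
  simp only [AlgHom.comp_apply, dD, Dlift_b]
  rw [cB_repr _ _ _ _ r, map_sum]
  simp only [map_mul]
lemma Dcv_ext {F G : Db A →ₐ[ℂ] B} (h1 : cv (F.comp da).toLinearMap = cv (G.comp da).toLinearMap) (h2 : cv (F.comp db).toLinearMap = cv (G.comp db).toLinearMap) : F = G :=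
  Db_algExt (fun x => LinearMap.congr_fun (congrArg WithConv.ofConv h1) x) (fun x => LinearMap.congr_fun (congrArg WithConv.ofConv h2) x)
lemma cv_eps_a (g : ℂ →ₐ[ℂ] B) : cv ((g.comp dE).comp (da (A := A))).toLinearMap = 1 := by
  ext x
  show g (dE (da x)) = algebraMap ℂ B (eps x)
  rw [dE, Dlift_a]; exact AlgHom.commutes g _
lemma cv_eps_b (g : ℂ →ₐ[ℂ] B) : cv ((g.comp dE).comp (db (A := A))).toLinearMap = 1 := by
  ext x
  show g (dE (db x)) = algebraMap ℂ B (eps x)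
  rw [dE, Dlift_b]; exact AlgHom.commutes g _
end

abbrev D2 (A : Type*) [Ring A] [HopfAlgebra ℂ A] [FiniteDimensional ℂ A] [IsSemisimpleRing A] := Db A ⊗[ℂ] Db A
lemma dD_coassoc : (Algebra.TensorProduct.assoc ℂ ℂ ℂ (Db A) (Db A) (Db A)).toAlgHom.comp ((Algebra.TensorProduct.map (dD (A := A)) (.id ℂ (Db A))).comp dD)
    = (Algebra.TensorProduct.map (.id ℂ (Db A)) (dD (A := A))).comp dD := by
  set g := (Algebra.TensorProduct.assoc ℂ ℂ ℂ (Db A) (Db A) (Db A)).toAlgHom.comp (Algebra.TensorProduct.map (dD (A := A)) (.id ℂ (Db A))) with hg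
  set k := (Algebra.TensorProduct.map (.id ℂ (Db A)) (dD (A := A))) with hk
  set g' := (Algebra.TensorProduct.assoc ℂ ℂ ℂ (Db A) (Db A) (Db A)).toAlgHom.comp (Algebra.TensorProduct.includeLeft : D2 A →ₐ[ℂ] D2 A ⊗[ℂ] Db A) with hg'
  set k' := (Algebra.TensorProduct.includeRight : D2 A →ₐ[ℂ] Db A ⊗[ℂ] D2 A) with hk'
  have h1 : g.comp inL = g'.comp dD := by ext x; simp [hg, hg']
  have h2 : k.comp inR = k'.comp dD := by ext x; simp [hk, hk']
  have h3 : g.comp inR = k'.comp inR := by ext x; simp [hg, hk', Algebra.TensorProduct.one_def]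
  have h4 : k.comp inL = g'.comp inL := by ext x; simp [hk, hg', Algebra.TensorProduct.one_def]
  have h5 : g'.comp inR = k'.comp inL := by ext x; simp [hk', hg', Algebra.TensorProduct.one_def]
  show g.comp dD = k.comp dD
  apply Dcv_ext
  · rw [dD_a, dD_a, h1, h2, dD_a, dD_a, h3, h4, h5, mul_assoc]
  · rw [dD_b, dD_b, h1, h2, dD_b, dD_b, h3, h4, h5, mul_assoc]

lemma dD_r : (Algebra.TensorProduct.map (dE (A := A)) (.id ℂ (Db A))).comp dD = (Algebra.TensorProduct.lid ℂ (Db A)).symm.toAlgHom := by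
  set g := (Algebra.TensorProduct.map (dE (A := A)) (.id ℂ (Db A))) with hg
  have h1 : g.comp inL = (Algebra.TensorProduct.includeLeft : ℂ →ₐ[ℂ] ℂ ⊗[ℂ] Db A).comp dE := by ext x; simp [hg]
  have h2 : g.comp inR = (Algebra.TensorProduct.lid ℂ (Db A)).symm.toAlgHom := by ext x; simp [hg]
  apply Dcv_ext
  · rw [dD_a, h1, cv_eps_a, h2, one_mul]
  · rw [dD_b, h1, cv_eps_b, h2, mul_one]
lemma dD_l : (Algebra.TensorProduct.map (.id ℂ (Db A)) (dE (A := A))).comp dD = (Algebra.TensorProduct.rid ℂ ℂ (Db A)).symm.toAlgHom := by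
  set g := (Algebra.TensorProduct.map (.id ℂ (Db A)) (dE (A := A))) with hg
  have h1 : g.comp inR = (Algebra.TensorProduct.includeRight : ℂ →ₐ[ℂ] Db A ⊗[ℂ] ℂ).comp dE := by ext x; simp [hg]
  have h2 : g.comp inL = (Algebra.TensorProduct.rid ℂ ℂ (Db A)).symm.toAlgHom := by ext x; simp [hg]
  apply Dcv_ext
  · rw [dD_a, h1, cv_eps_a, h2, mul_one]
  · rw [dD_b, h1, cv_eps_b, h2, one_mul]

instance : Bialgebra ℂ (Db A) := Bialgebra.ofAlgHom (dD (A := A)) (dE (A := A)) dD_coassoc dD_r dD_l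
lemma comul_Db (x : Db A) : comul (R := ℂ) x = dD x := rfl
lemma counit_Db (x : Db A) : counit (R := ℂ) x = dE x := rfl
lemma eps_da (h : A) : counit (R := ℂ) (da h) = eps h := by rw [counit_Db, dE, Dlift_a]; rfl
lemma eps_db (h : Du A) : counit (R := ℂ) (db h) = eps h := by rw [counit_Db, dE, Dlift_b]; rfl

def Drep {f : Du A} {h : A} {ι κ : Type*} (r : Coalgebra.Repr ℂ f ι) (q : Coalgebra.Repr ℂ h κ) : Coalgebra.Repr ℂ (db f * da h) (ι × κ) where
  index := r.index ×ˢ q.index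
  left i := db (r.right i.1) * da (q.left i.2)
  right i := db (r.left i.1) * da (q.right i.2)
  eq := by
    rw [comul_Db, map_mul, dD, Dlift_a, Dlift_b, cA_repr _ _ _ _ q, cB_repr _ _ _ _ r, sum_mul_sum, sum_product]
    refine scr fun i _ => scr fun j _ => ?_
    simp
def Dant : Db A →ₗ[ℂ] Db A := (MulOpposite.opLinearEquiv ℂ).symm.toLinearMap ∘ₗ dS.toLinearMap
lemma Dant_ba (f : Du A) (h : A) : Dant (db f * da h) = da (S h) * db (S f) := by
  simp [Dant, dS]

instance : HopfAlgebra ℂ (Db A) where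
  antipode := Dant
  mul_antipode_rTensor_comul := by
    apply Db_ext
    intro f h
    have r := arbitrary ℂ f
    have q := arbitrary ℂ h
    simp only [LinearMap.comp_apply]
    rw [← (Drep r q).eq]
    simp only [map_sum, LinearMap.rTensor_tmul, LinearMap.mul'_apply, Drep, Dant_ba]
    rw [sum_product, sum_comm]
    have e : ∀ j, ∑ i ∈ r.index, da (S (q.left j)) * db (S (r.right i)) * (db (r.left i) * da (q.right j)) = eps f • da (S (q.left j) * q.right j) := by
      intro j
      have := congrArg (fun z => da (S (q.left j)) * db z * da (q.right j)) (S_flip' (hS_du hS_ss) r)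
      simp only [map_sum, mul_sum, sum_mul, map_mul, map_smul, map_one] at this
      simp only [mul_assoc] at this ⊢
      rw [this]; simp
    simp only [e]
    rw [← Finset.smul_sum, ← map_sum, sum_antipode_mul_eq_smul, Bialgebra.counit_mul, eps_da, eps_db]
    simp [Algebra.algebraMap_eq_smul_one, smul_smul]
  mul_antipode_lTensor_comul := by
    apply Db_ext
    intro f h
    have r := arbitrary ℂ f
    have q := arbitrary ℂ h
    simp only [LinearMap.comp_apply]
    rw [← (Drep r q).eq]
    simp only [map_sum, LinearMap.lTensor_tmul, LinearMap.mul'_apply, Drep, Dant_ba]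
    rw [sum_product]
    have e : ∀ i, ∑ j ∈ q.index, db (r.right i) * da (q.left j) * (da (S (q.right j)) * db (S (r.left i))) = eps h • db (r.right i * S (r.left i)) := by
      intro i
      have := congrArg (fun z => db (r.right i) * da z * db (S (r.left i))) (sum_mul_antipode_eq_smul q)
      simp only [map_sum, mul_sum, sum_mul, map_mul, map_smul, map_one] at this
      simp only [mul_assoc] at this ⊢
      rw [this]; simp
    simp only [e]
    rw [← Finset.smul_sum, ← map_sum, S_flip (hS_du hS_ss), Bialgebra.counit_mul, eps_da, eps_db]
    simp [Algebra.algebraMap_eq_smul_one, smul_smul]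
    rw [mul_comm]
lemma S_da (h : A) : S (da h) = da (S h) := by
  have := Dant_ba (A := A) 1 h; show Dant (da h) = _; simpa using this
lemma S_db (h : Du A) : S (db h) = db (S h) := by
  have := Dant_ba (A := A) h 1; show Dant (db h) = _; simpa using this
end

section
section
variable {A : Type*} [Ring A] [HopfAlgebra ℂ A] [FiniteDimensional ℂ A]
def dl (x : A) : Cv (Du A) A := cv (lh.flip x)
def dr (x : A) : Cv (Du A) A := cv (rh.flip x)
lemma dl_mul (x y : A) : dl (x * y) = dl x * dl y := by
  ext f
  have q := arbitrary ℂ f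
  have r := arbitrary ℂ x
  have p := arbitrary ℂ y
  rw [q.convMul_apply]
  have h1 : comul (R := ℂ) (x * y) = ∑ i ∈ r.index, ∑ k ∈ p.index, (r.left i * p.left k) ⊗ₜ[ℂ] (r.right i * p.right k) := by
    rw [Bialgebra.comul_mul, ← r.eq, ← p.eq, sum_mul_sum]
    simp
  show lh f (x * y) = ∑ j ∈ q.index, lh (q.left j) x * lh (q.right j) y
  simp only [lh_repr _ r, lh_repr _ p, sum_mul_sum]
  rw [sum_comm]
  have : lh f (x * y) = ∑ i ∈ r.index, ∑ k ∈ p.index, f (r.right i * p.right k) • (r.left i * p.left k) := by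
    simp [lh, h1]
  rw [this]
  refine scr fun i _ => ?_
  rw [sum_comm]
  refine scr fun k _ => ?_
  rw [← du_repr q, sum_smul]
  exact scr fun j _ => by rw [smul_mul_smul_comm]
lemma dr_mul (x y : A) : dr (x * y) = dr x * dr y := by
  ext f
  have q := arbitrary ℂ f
  have r := arbitrary ℂ x
  have p := arbitrary ℂ y
  rw [q.convMul_apply]
  have h1 : comul (R := ℂ) (x * y) = ∑ i ∈ r.index, ∑ k ∈ p.index, (r.left i * p.left k) ⊗ₜ[ℂ] (r.right i * p.right k) := by
    rw [Bialgebra.comul_mul, ← r.eq, ← p.eq, sum_mul_sum]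
    simp
  show rh f (x * y) = ∑ j ∈ q.index, rh (q.left j) x * rh (q.right j) y
  simp only [rh_repr _ r, rh_repr _ p, sum_mul_sum]
  rw [sum_comm]
  have : rh f (x * y) = ∑ i ∈ r.index, ∑ k ∈ p.index, f (r.left i * p.left k) • (r.right i * p.right k) := by
    simp [rh, h1]
  rw [this]
  refine scr fun i _ => ?_
  rw [sum_comm]
  refine scr fun k _ => ?_
  rw [← du_repr q, sum_smul]
  exact scr fun j _ => by rw [smul_mul_smul_comm]
lemma dl_add (x y : A) : dl (x + y) = dl x + dl y := by
  ext f; simp [dl]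
lemma dr_add (x y : A) : dr (x + y) = dr x + dr y := by
  ext f; simp [dr]
end

variable {A : Type*} [Ring A] [HopfAlgebra ℂ A] [FiniteDimensional ℂ A] [IsSemisimpleRing A]
lemma relD_repr (h : A) {f : Du A} {ι : Type*} (q : Coalgebra.Repr ℂ f ι) :
    ∑ i ∈ q.index, da (lh (q.left i) h) * db (q.right i) = ∑ i ∈ q.index, db (q.left i) * da (rh (q.right i) h) := by
  have := LinearMap.congr_fun (congrArg WithConv.ofConv (relA_iff.1 (relD (A := A)) h)) f
  rw [q.convMul_apply, q.convMul_apply] at this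
  exact this
def arep {h : A} {κ : Type*} (q : Coalgebra.Repr ℂ h κ) : Coalgebra.Repr ℂ (da h) κ where
  index := q.index
  left i := da (q.left i)
  right i := da (q.right i)
  eq := by
    rw [comul_Db, dD, Dlift_a, cA_repr _ _ _ _ q]
    exact scr fun j _ => by simp
def brep {f : Du A} {κ : Type*} (q : Coalgebra.Repr ℂ f κ) : Coalgebra.Repr ℂ (db f) κ where
  index := q.index
  left i := db (q.right i)
  right i := db (q.left i)
  eq := by
    rw [comul_Db, dD, Dlift_b, cB_repr _ _ _ _ q]
    exact scr fun j _ => by simp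

def fa : Du (Db A) →ₗ[ℂ] Du A := toL.symm.toLinearMap ∘ₗ (LinearMap.lcomp ℂ ℂ da.toLinearMap) ∘ₗ toL.toLinearMap
@[simp] lemma fa_apply (f : Du (Db A)) (x : A) : fa f x = f (da x) := rfl
def fb : Du (Db A) →ₗ[ℂ] A where
  toFun f := (exists_ev (toL f ∘ₗ db.toLinearMap)).choose
  map_add' f g := du_sep fun φ => by
    rw [← (exists_ev (toL (f + g) ∘ₗ db.toLinearMap)).choose_spec φ, map_add (toL φ), ← (exists_ev (toL f ∘ₗ db.toLinearMap)).choose_spec φ, ← (exists_ev (toL g ∘ₗ db.toLinearMap)).choose_spec φ]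
    simp
  map_smul' c f := du_sep fun φ => by
    rw [← (exists_ev (toL (c • f) ∘ₗ db.toLinearMap)).choose_spec φ, map_smul (toL φ), RingHom.id_apply, ← (exists_ev (toL f ∘ₗ db.toLinearMap)).choose_spec φ]
    simp
@[simp] lemma fb_spec (f : Du (Db A)) (φ : Du A) : φ (fb f) = f (db φ) :=
  ((exists_ev (toL f ∘ₗ db.toLinearMap)).choose_spec φ).symm
lemma fa_mul (f g : Du (Db A)) : fa (f * g) = fa f * fa g := by
  refine du_ext fun x => ?_
  have r := arbitrary ℂ x
  rw [fa_apply, du_mul f g (arep r), du_mul _ _ r]; rfl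
lemma fb_mul (f g : Du (Db A)) : fb (f * g) = fb g * fb f := by
  refine du_sep fun φ => ?_
  have r := arbitrary ℂ φ
  rw [fb_spec, du_mul f g (brep r), ← du_repr r]
  exact scr fun i _ => by rw [fb_spec, fb_spec, mul_comm]; rfl

def bp : Cv (Du (Db A)) (Db A) := cv (db.toLinearMap ∘ₗ fa)
def cp : Cv (Du (Db A)) (Db A) := cv (da.toLinearMap ∘ₗ fb)

def farep {f : Du (Db A)} {κ : Type*} (q : Coalgebra.Repr ℂ f κ) : Coalgebra.Repr ℂ (fa f) κ where
  index := q.index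
  left i := fa (q.left i)
  right i := fa (q.right i)
  eq := E2_sep fun x y => by
    rw [E2_comul]
    simp only [map_sum, E2_tmul, fa_apply, map_mul]
    exact du_repr q _ _
lemma fbrep {f : Du (Db A)} {κ : Type*} (q : Coalgebra.Repr ℂ f κ) : ∑ i ∈ q.index, fb (q.left i) ⊗ₜ[ℂ] fb (q.right i) = comul (R := ℂ) (fb f) :=
  IsInt.pr_sep fun φ ψ => by
    rw [pr_comul]
    simp only [map_sum, pr_tmul, fb_spec, map_mul]
    exact du_repr q _ _
end

section
variable {A : Type*} [Ring A] [HopfAlgebra ℂ A] [FiniteDimensional ℂ A] [IsSemisimpleRing A]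

lemma sum3 {ι κ μ : Type*} {q : Finset ι} {r : Finset κ} {p : Finset μ} {F : ι → κ → μ → ℂ} {G : κ → μ → ℂ} (h : ∀ i k, ∑ j ∈ q, F j i k = G i k) :
    ∑ j ∈ q, ∑ i ∈ r, ∑ k ∈ p, F j i k = ∑ i ∈ r, ∑ k ∈ p, G i k := by
  rw [sum_comm]
  refine scr fun i _ => ?_
  rw [sum_comm]
  exact scr fun k _ => h i k
lemma bp_a (h : A) : dl (da h) * bp = bp * dr (da h) := by
  ext f
  have q := arbitrary ℂ f
  have r := arbitrary ℂ h
  rw [q.convMul_apply, q.convMul_apply]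
  have := relD_repr h (farep q)
  have h1 : ∀ f, lh f (da h) = da (lh (fa f) h) := fun f => by
    rw [lh_repr _ (arep r), lh_repr _ r, map_sum]; exact scr fun i _ => by rw [map_smul]; rfl
  have h2 : ∀ f, rh f (da h) = da (rh (fa f) h) := fun f => by
    rw [rh_repr _ (arep r), rh_repr _ r, map_sum]; exact scr fun i _ => by rw [map_smul]; rfl
  calc _ = ∑ i ∈ q.index, lh (q.left i) (da h) * db (fa (q.right i)) := rfl
    _ = ∑ i ∈ q.index, db (fa (q.left i)) * rh (q.right i) (da h) := by simp only [h1, h2]; exact this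
lemma bp_b (φ : Du A) : dl (db φ) * bp = bp * dr (db φ) := by
  ext f
  have q := arbitrary ℂ f
  have r := arbitrary ℂ φ
  rw [q.convMul_apply, q.convMul_apply]
  have h1 : ∀ f, lh f (db φ) = db (∑ i ∈ r.index, f (db (r.left i)) • r.right i) := fun f => by
    rw [lh_repr _ (brep r), map_sum]; exact scr fun i _ => by rw [map_smul]; rfl
  have h2 : ∀ f, rh f (db φ) = db (∑ i ∈ r.index, f (db (r.right i)) • r.left i) := fun f => by
    rw [rh_repr _ (brep r), map_sum]; exact scr fun i _ => by rw [map_smul]; rfl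
  calc _ = ∑ i ∈ q.index, lh (q.left i) (db φ) * db (fa (q.right i)) := rfl
    _ = db (∑ j ∈ q.index, (∑ i ∈ r.index, q.left j (db (r.left i)) • r.right i) * fa (q.right j)) := by
        simp only [h1, map_sum db, map_mul]
    _ = db (∑ j ∈ q.index, fa (q.left j) * (∑ i ∈ r.index, q.right j (db (r.right i)) • r.left i)) := by
        congr 1
        refine du_ext fun y => ?_
        have p := arbitrary ℂ y
        have key := congrArg (fun z => f z) (relD_repr y r)
        simp only [map_sum, LinearMap.sum_apply, du_mul _ _ p, map_smul, LinearMap.smul_apply, fa_apply, lh_repr _ p, rh_repr _ p, sum_mul, mul_sum, smul_eq_mul, smul_mul_assoc, mul_smul_comm] at key ⊢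
        calc _ = ∑ i ∈ r.index, ∑ k ∈ p.index, r.right i (p.left k) * f (db (r.left i) * da (p.right k)) := by
                refine sum3 fun i k => ?_
                rw [← du_repr q, mul_sum]
                exact scr fun _ _ => by ring
          _ = ∑ i ∈ r.index, ∑ k ∈ p.index, r.left i (p.right k) * f (da (p.left k) * db (r.right i)) := key.symm
          _ = _ := by
                refine (sum3 fun i k => ?_).symm
                rw [← du_repr q, mul_sum]
                exact scr fun _ _ => by ring
    _ = ∑ i ∈ q.index, db (fa (q.left i)) * rh (q.right i) (db φ) := by simp only [h2, map_sum db, map_mul]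

lemma cp_a (h : A) : cp * dl (da h) = dr (da h) * cp := by
  ext f
  have q := arbitrary ℂ f
  have r := arbitrary ℂ h
  rw [q.convMul_apply, q.convMul_apply]
  have h1 : ∀ f, lh f (da h) = da (∑ i ∈ r.index, f (da (r.right i)) • r.left i) := fun f => by
    rw [lh_repr _ (arep r), map_sum]; exact scr fun i _ => by rw [map_smul]; rfl
  have h2 : ∀ f, rh f (da h) = da (∑ i ∈ r.index, f (da (r.left i)) • r.right i) := fun f => by
    rw [rh_repr _ (arep r), map_sum]; exact scr fun i _ => by rw [map_smul]; rfl
  calc _ = ∑ i ∈ q.index, da (fb (q.left i)) * lh (q.right i) (da h) := rfl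
    _ = da (∑ j ∈ q.index, fb (q.left j) * (∑ i ∈ r.index, q.right j (da (r.right i)) • r.left i)) := by
        simp only [h1, map_sum da, map_mul]
    _ = da (∑ j ∈ q.index, (∑ i ∈ r.index, q.left j (da (r.left i)) • r.right i) * fb (q.right j)) := by
        congr 1
        refine du_sep fun y => ?_
        have p := arbitrary ℂ y
        have key := congrArg (fun z => f z) (relD_repr h p)
        simp only [map_sum, LinearMap.sum_apply, ← du_repr p, map_smul, LinearMap.smul_apply, fb_spec, lh_repr _ r, rh_repr _ r, sum_mul, mul_sum, smul_eq_mul, smul_mul_assoc, mul_smul_comm] at key ⊢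
        rw [sum_comm] at key
        symm at key
        rw [sum_comm] at key
        calc _ = ∑ i ∈ r.index, ∑ k ∈ p.index, p.right k (r.left i) * f (db (p.left k) * da (r.right i)) := by
                refine sum3 fun i k => ?_
                rw [← du_repr q, mul_sum]
                exact scr fun _ _ => by ring
          _ = ∑ i ∈ r.index, ∑ k ∈ p.index, p.left k (r.right i) * f (da (r.left i) * db (p.right k)) := key
          _ = _ := by
                refine (sum3 fun i k => ?_).symm
                rw [← du_repr q, mul_sum]
                exact scr fun _ _ => by ring
    _ = ∑ i ∈ q.index, rh (q.left i) (da h) * da (fb (q.right i)) := by simp only [h2, map_sum da, map_mul]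

lemma cp_b (φ : Du A) : cp * dl (db φ) = dr (db φ) * cp := by
  ext f
  have q := arbitrary ℂ f
  have r := arbitrary ℂ φ
  rw [q.convMul_apply, q.convMul_apply]
  have h1 : ∀ f, lh f (db φ) = ∑ i ∈ r.index, r.left i (fb f) • db (r.right i) := fun f => by
    rw [lh_repr _ (brep r)]; exact scr fun i _ => by rw [fb_spec]; rfl
  have h2 : ∀ f, rh f (db φ) = ∑ i ∈ r.index, r.right i (fb f) • db (r.left i) := fun f => by
    rw [rh_repr _ (brep r)]; exact scr fun i _ => by rw [fb_spec]; rfl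
  have key := relD_repr (fb f) r
  have h3 : ∀ φ, lh φ (fb f) = ∑ j ∈ q.index, φ (fb (q.right j)) • fb (q.left j) := fun φ => by
    simp [lh, ← fbrep q]
  have h4 : ∀ φ, rh φ (fb f) = ∑ j ∈ q.index, φ (fb (q.left j)) • fb (q.right j) := fun φ => by
    simp [rh, ← fbrep q]
  simp only [h3, h4, map_sum, sum_mul, mul_sum, map_smul, smul_mul_assoc, mul_smul_comm] at key
  calc _ = ∑ i ∈ q.index, da (fb (q.left i)) * lh (q.right i) (db φ) := rfl
    _ = ∑ i ∈ q.index, rh (q.left i) (db φ) * da (fb (q.right i)) := by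
      simp only [h1, h2, sum_mul, mul_sum, smul_mul_assoc, mul_smul_comm]
      rw [sum_comm, key, sum_comm]

def Ph : Cv (Du (Db A)) (Db A) := bp * cp
lemma bp_all (x : Db A) : dl x * bp = bp * dr x := by
  induction x using Db_ind with
  | h1 x y hx hy => rw [dl_add, dr_add, add_mul, mul_add, hx, hy]
  | h2 f h => rw [dl_mul, dr_mul, mul_assoc, bp_a, ← mul_assoc, bp_b, mul_assoc]
lemma cp_all (x : Db A) : cp * dl x = dr x * cp := by
  induction x using Db_ind with
  | h1 x y hx hy => rw [dl_add, dr_add, add_mul, mul_add, hx, hy]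
  | h2 f h => rw [dl_mul, dr_mul, mul_assoc (dr _), ← cp_a, ← mul_assoc, cp_b, mul_assoc]
lemma Ph_all (x : Db A) : dl x * Ph = Ph * dl x := by
  rw [Ph, ← mul_assoc, bp_all, mul_assoc, ← cp_all, mul_assoc]
def Phi : Du (Db A) →ₗ[ℂ] Db A := Ph.ofConv
lemma Phi_repr {f : Du (Db A)} {κ : Type*} (q : Coalgebra.Repr ℂ f κ) : Phi f = ∑ i ∈ q.index, db (fa (q.left i)) * da (fb (q.right i)) := by
  rw [Phi, Ph, q.convMul_apply]; rfl

section
variable {A : Type*} [Ring A] [HopfAlgebra ℂ A] [FiniteDimensional ℂ A]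
def IsTr (f : Du A) : Prop := ∀ x y, f (x * y) = f (y * x)
lemma rt_eq {f : Du A} {ι : Type*} (q : Coalgebra.Repr ℂ f ι) (y : A) : rt f y = ∑ j ∈ q.index, q.right j y • q.left j := by
  refine du_ext fun x => ?_
  rw [rt_apply, ← du_repr q]
  simp [mul_comm]
lemma IsTr.swap {f : Du A} (h : IsTr f) {ι : Type*} (q : Coalgebra.Repr ℂ f ι) : ∑ i ∈ q.index, q.right i ⊗ₜ[ℂ] q.left i = comul (R := ℂ) f :=
  E2_sep fun x y => by
    rw [E2_comul, h, ← du_repr q]; simp [mul_comm]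
def IsTr.rep {f : Du A} (h : IsTr f) {ι : Type*} (q : Coalgebra.Repr ℂ f ι) : Coalgebra.Repr ℂ f ι where
  index := q.index
  left := q.right
  right := q.left
  eq := h.swap q
end

lemma Phi_one_side (f : Du (Db A)) (x : Db A) {ι : Type*} (r : Coalgebra.Repr ℂ x ι) :
    ∑ i ∈ r.index, r.left i * Phi (lt f (r.right i)) = ∑ i ∈ r.index, Phi (rt f (r.right i)) * r.left i := by
  have q := arbitrary ℂ f
  have := LinearMap.congr_fun (congrArg WithConv.ofConv (Ph_all x)) f
  rw [q.convMul_apply, q.convMul_apply] at this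
  have h2 : ∑ j ∈ q.index, lh (q.left j) x * Phi (q.right j) = ∑ j ∈ q.index, Phi (q.left j) * lh (q.right j) x := this
  simp only [lh_repr _ r, sum_mul, mul_sum, smul_mul_assoc, mul_smul_comm] at h2
  simp only [lt_eq q, rt_eq q, map_sum, map_smul, sum_mul, mul_sum, smul_mul_assoc, mul_smul_comm]
  rw [sum_comm, h2, sum_comm]

def GG (f : Du (Db A)) : Db A ⊗[ℂ] Db A →ₗ[ℂ] Db A :=
  TensorProduct.lift (LinearMap.mk₂ ℂ (fun y z => y * Phi (rt f z)) (fun _ _ _ => by simp [add_mul]) (fun _ _ _ => by simp)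
    (fun y z w => by rw [← mul_add, ← map_add]; congr 2; exact du_ext fun x => by simp [mul_add]) 
    (fun c y z => by rw [← mul_smul_comm, ← map_smul]; congr 2; exact du_ext fun x => by simp))
def GG' (f : Du (Db A)) : Db A ⊗[ℂ] Db A →ₗ[ℂ] Db A :=
  TensorProduct.lift (LinearMap.mk₂ ℂ (fun y z => Phi (rt f z) * y) (fun _ _ _ => by simp [mul_add]) (fun _ _ _ => by simp)
    (fun y z w => by rw [← add_mul, ← map_add]; congr 2; exact du_ext fun x => by simp [mul_add]) 
    (fun c y z => by rw [← smul_mul_assoc, ← map_smul]; congr 2; exact du_ext fun x => by simp))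
lemma GG_tmul (f : Du (Db A)) (y z : Db A) : GG f (y ⊗ₜ z) = y * Phi (rt f z) := rfl
lemma GG'_tmul (f : Du (Db A)) (y z : Db A) : GG' f (y ⊗ₜ z) = Phi (rt f z) * y := rfl

lemma Phi_central {f : Du (Db A)} (hf : IsTr f) (x : Db A) : x * Phi f = Phi f * x := by
  have r := arbitrary ℂ x
  have h1 := congrArg (GG f) (theta_key' hS_ss r)
  have h2 := congrArg (GG' f) (theta_key r)
  have e1 : rt f 1 = f := du_ext fun x => by simp
  rw [GG_tmul, e1] at h1
  rw [GG'_tmul, e1] at h2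
  rw [← h1, ← h2, map_sum, map_sum]
  refine scr fun i _ => ?_
  have p := arbitrary ℂ (r.left i)
  have := Phi_one_side (rt f (S (r.right i))) _ p
  rw [← p.eq, mul_sum, sum_mul, map_sum, map_sum]
  simp only [Algebra.TensorProduct.tmul_mul_tmul, one_mul, mul_one, GG_tmul, GG'_tmul]
  convert this using 4 with k _ k _
  · exact du_ext fun x => by simp only [rt_apply, lt_apply, mul_assoc]; rw [hf (p.right k), mul_assoc]
  · exact du_ext fun x => by simp only [rt_apply, mul_assoc]
end

section
variable {A : Type*} [Ring A] [HopfAlgebra ℂ A] [FiniteDimensional ℂ A] [IsSemisimpleRing A]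

def mulRep {C : Type*} [Ring C] [Bialgebra ℂ C] {x y : C} {ι κ : Type*} (r : Coalgebra.Repr ℂ x ι) (p : Coalgebra.Repr ℂ y κ) : Coalgebra.Repr ℂ (x * y) (ι × κ) where
  index := r.index ×ˢ p.index
  left i := r.left i.1 * p.left i.2
  right i := r.right i.1 * p.right i.2
  eq := by
    rw [Bialgebra.comul_mul, ← r.eq, ← p.eq, sum_mul_sum, sum_product]; simp

lemma Phi_mul (f : Du (Db A)) {g : Du (Db A)} (hg : IsTr g) : Phi (f * g) = Phi f * Phi g := by
  have q := arbitrary ℂ f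
  have p := arbitrary ℂ g
  rw [Phi_repr (mulRep q p), Phi_repr q, sum_mul]
  simp only [mulRep]
  rw [sum_product]
  refine scr fun i _ => ?_
  rw [mul_assoc, Phi_central hg, Phi_repr p, sum_mul, mul_sum]
  exact scr fun j _ => by simp only [fa_mul, fb_mul, map_mul, mul_assoc]

lemma Phi_symm {f g : Du (Db A)} (hf : IsTr f) (hg : IsTr g) : g (Phi f) = f (Phi g) := by
  have q := arbitrary ℂ f
  have p := arbitrary ℂ g
  have e : ∀ f g : Du (Db A), g (db (fa f)) = f (da (fb g)) := fun f g => by rw [← fb_spec, fa_apply]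
  rw [Phi_repr q, Phi_repr (hg.rep p), map_sum, map_sum]
  have h1 : ∀ i, g (db (fa (q.left i)) * da (fb (q.right i))) = ∑ j ∈ p.index, q.left i (da (fb (p.left j))) * q.right i (db (fa (p.right j))) := fun i => by
    rw [← du_repr p]
    exact scr fun j _ => by rw [e (q.left i), ← e (p.right j)]
  have h2 : ∀ j, f (db (fa ((hg.rep p).left j)) * da (fb ((hg.rep p).right j))) = ∑ i ∈ q.index, q.left i (da (fb (p.left j))) * q.right i (db (fa (p.right j))) := fun j => by
    rw [hf, du_repr q]; rfl
  simp only [h1, h2]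
  rw [sum_comm]; rfl

lemma Phi_one : Phi (1 : Du (Db A)) = 1 := by
  let q : Coalgebra.Repr ℂ (1 : Du (Db A)) Unit := ⟨{()}, fun _ => 1, fun _ => 1, by simp [Algebra.TensorProduct.one_def]⟩
  have h1 : fa (1 : Du (Db A)) = 1 := du_ext fun x => by rw [fa_apply, du_one, du_one]; exact eps_da x
  have h2 : fb (1 : Du (Db A)) = 1 := du_sep fun x => by rw [fb_spec, du_one]; exact eps_db x
  rw [Phi_repr q]; simp [q, h1, h2]

def mD : Du (Db A) := toL.symm (LinearMap.mul' ℂ ℂ ∘ₗ TensorProduct.map (ev (Lam A)) (toL (reg : Du A)) ∘ₗ PB.symm.toLinearMap)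
lemma mD_ba (φ : Du A) (h : A) : mD (db φ * da h) = φ (Lam A) * reg h := by
  rw [← PB_tmul]; simp [mD, -PB_tmul]
lemma mD_left (f : Du (Db A)) : f * mD = f 1 • mD := by
  apply toL.injective
  apply Db_ext
  intro φ h
  have r := arbitrary ℂ φ
  have q := arbitrary ℂ h
  rw [du_mul f mD (Drep r q)]
  have h1 : ∑ i ∈ r.index, r.left i (Lam A) • r.right i = φ (Lam A) • 1 := du_ext fun y => by
    have := du_repr r (Lam A) y
    rw [Lam_int.right] at this
    rw [map_smul, smul_eq_mul] at this
    simp [this, du_one, mul_comm]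
  have h2 : ∑ i ∈ q.index, reg (q.right i) • q.left i = (reg h : ℂ) • 1 := by
    rw [← lh_repr]
    refine du_sep fun k => ?_
    rw [du_lh, reg_left hS_ss]; simp [mul_comm]
  have h3 := congrArg₂ (fun z w => f (db z * da w)) h1 h2
  simp only [map_sum, map_smul, sum_mul_sum, smul_mul_smul_comm, map_one, mul_one, smul_eq_mul] at h3
  rw [map_smul, LinearMap.smul_apply, mD_ba, smul_eq_mul, mul_comm, ← h3]
  simp only [Drep, mD_ba]
  rw [sum_product]
  exact scr fun i _ => scr fun j _ => by ring
lemma reg_ba (φ : Du A) (h : A) : reg (db φ * da h) = finrank ℂ A * (φ (Lam A) * reg h) := by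
  have h1 := int_unique_l hS_ss (Lam_int (A := Db A)) (m := mD) mD_left
  have h2 := congrArg (fun z : Du (Db A) => z 1) h1
  have h3 := congrArg (fun z : Du (Db A) => z (db φ * da h)) h1
  have h4 := mD_ba (1 : Du A) (1 : A)
  rw [map_one, map_one, one_mul] at h4
  simp only [map_smul, LinearMap.smul_apply, smul_eq_mul] at h2 h3
  rw [h4, reg_one, reg_one, du_one, show counit (R := ℂ) (Lam A) = 1 from Lam_int.norm, finrank_Db] at h2
  rw [mD_ba] at h3
  rw [h3]
  have hn := n_ne (A := A)
  have : (finrank ℂ A : ℂ) * mD (Lam (Db A)) = 1 := by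
    apply mul_left_cancel₀ hn
    push_cast at h2
    linear_combination -h2
  rw [← mul_assoc, this, one_mul]
lemma Lam_Db : db reg * da (Lam A) = (finrank ℂ A : ℂ) • Lam (Db A) := by
  rw [← sub_eq_zero]
  apply reg_nd
  intro y
  rw [reg_comm, ← hS_ss y]
  generalize S y = y
  induction y using Db_ind with
  | h1 x y hx hy => rw [map_add, add_mul, map_add, hx, hy, add_zero]
  | h2 f h =>
    rw [S_mul, S_da, S_db, mul_sub, map_sub, mul_smul_comm, Lam_int.left, sub_eq_zero]
    rw [mul_assoc, ← mul_assoc (db _), ← map_mul, reg_left hS_ss, reg_comm, mul_assoc, ← map_mul, Lam_int.right]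
    simp only [map_smul, smul_mul_assoc, mul_smul_comm, LinearMap.smul_apply, reg_ba, smul_eq_mul]
    rw [Lam_int.reg_L, Lam_int.reg_L, show eps (da (S h) * db (S f)) = eps (S h) * (S f) 1 from (Bialgebra.counit_mul _ _).trans (by rw [eps_da, eps_db, ← du_counit])]
    ring
lemma reg_Phi {f : Du (Db A)} (hf : IsTr f) : reg (Phi f) = (finrank ℂ A : ℂ) ^ 2 * f (Lam (Db A)) := by
  have q := arbitrary ℂ f
  rw [Phi_repr q, map_sum]
  simp only [reg_ba, fa_apply, fb_spec]
  rw [← mul_sum, du_repr q, hf, Lam_Db, map_smul, smul_eq_mul]; ring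
lemma Phi_Lam (f : Du (Db A)) : Phi f * da (Lam A) = db (fa f) * da (Lam A) := by
  have q := arbitrary ℂ f
  have h1 : ∀ i, eps (fb (q.right i)) = q.right i 1 := fun i => by
    have := fb_spec (q.right i) 1; rwa [map_one db, du_one] at this
  have h2 : ∑ i ∈ q.index, q.right i 1 • q.left i = f := by
    rw [← rt_eq q]; exact du_ext fun x => by simp
  rw [Phi_repr q, sum_mul]
  conv_rhs => rw [← h2]
  rw [map_sum, map_sum, sum_mul]
  refine scr fun i _ => ?_
  rw [mul_assoc, ← map_mul, Lam_int.left, h1]; simp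
lemma tr_Phi_Lam {f : Du (Db A)} (hf : IsTr f) :
    tr (LinearMap.mulLeft ℂ (Phi f) * LinearMap.mulRight ℂ (da (Lam A))) = finrank ℂ A * f (da (Lam A)) := by
  obtain ⟨W⟩ := exists_wed (Db A)
  have : LinearMap.mulLeft ℂ (Phi f) * LinearMap.mulRight ℂ (da (Lam A)) = LinearMap.mulLeft ℂ 1 * LinearMap.mulRight ℂ (db (fa f) * da (Lam A)) := by
    ext x
    simp only [Module.End.mul_apply, LinearMap.mulLeft_apply, LinearMap.mulRight_apply]
    rw [← Phi_Lam, one_mul, ← mul_assoc, ← mul_assoc, Phi_central hf]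
  rw [this, W.tr_LR]
  have e2 := W.tr_LR (db (fa f) * da (Lam A)) 1
  have e3 := reg_ba (fa f) (Lam A)
  rw [Lam_int.reg_L, fa_apply, mul_one] at e3
  rw [← e3, reg_apply]
  rw [LinearMap.mulRight_one] at e2
  have e4 : Lm (db (fa f) * da (Lam A)) = LinearMap.mulLeft ℂ (db (fa f) * da (Lam A)) * LinearMap.id := rfl
  rw [e4, e2]
  exact scr fun i _ => mul_comm _ _
end

section
structure Fus (I : Type) [Fintype I] [DecidableEq I] where
  d : I → ℕ
  N : I → I → I → ℕ
  o : I
  st : I → I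
  d_pos : ∀ i, 0 < d i
  d_o : d o = 1
  d_st : ∀ i, d (st i) = d i
  st_st : ∀ i, st (st i) = i
  st_o : st o = o
  frob : ∀ i k l, N i k l = N (st i) l k
  N_o : ∀ i j, N i j o = if i = st j then 1 else 0
  o_N : ∀ j k, N o j k = if j = k then 1 else 0
  dd : ∀ i j, d i * d j = ∑ k, N i j k * d k

section
variable {A : Type*} [Ring A] [HopfAlgebra ℂ A] [FiniteDimensional ℂ A]

lemma IsTr.mul {f g : Du A} (hf : IsTr f) (hg : IsTr g) : IsTr (f * g) := by
  intro x y
  rw [← pr_comul, ← pr_comul, Bialgebra.comul_mul, Bialgebra.comul_mul]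
  generalize comul (R := ℂ) x = s
  generalize comul (R := ℂ) y = t
  induction s with
  | zero => simp
  | add a b ha hb => rw [add_mul, mul_add, map_add, map_add, ha, hb]
  | tmul a b =>
    induction t with
    | zero => simp
    | add a b ha hb => rw [add_mul, mul_add, map_add, map_add, ha, hb]
    | tmul c e => simp [Algebra.TensorProduct.tmul_mul_tmul, hf a c, hg b e]

variable [IsSemisimpleRing A]
lemma reg_S (x : A) : reg (S x) = reg x := by
  have h := int_unique_l (A := A) hS_ss Lam_int (m := S reg) (by
    intro f
    have := congrArg S (reg_right (A := A) hS_ss (S f))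
    rw [S_mul, hS_du hS_ss f] at this
    rw [this, map_smul, du_antipode, antipode_one])
  rw [du_antipode, Lam_int.S_L, Lam_int.reg_L, one_smul] at h
  rw [← du_antipode, h]

lemma reg_du (f : Du A) : reg f = (finrank ℂ A : ℂ) * f (Lam A) := by
  have h := lam_du (A := A) Lam_int f
  have e1 : (S * S : End ℂ A) = 1 := by ext x; simp [hS_ss]
  have e2 : (S * S : End ℂ (Du A)) = 1 := by ext x : 1; simp [hS_du hS_ss]
  rw [e1, e2, mul_one, LinearMap.trace_one] at h
  exact h

lemma Lam_cyc (f g : Du A) : (f * g) (Lam A) = (g * f) (Lam A) := by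
  have h := reg_comm f g
  rw [reg_du, reg_du] at h
  exact mul_left_cancel₀ (n_ne) h

lemma Lam_S (f : Du A) : (S f) (Lam A) = f (Lam A) := by rw [du_antipode, Lam_int.S_L]
end

namespace Wed
variable {A : Type*} [Ring A] [HopfAlgebra ℂ A] (W : Wed A)
def x (i : Fin W.n) : Du A := toL.symm (W.chi i)
lemma x_apply (i) (a : A) : W.x i a = W.chi i a := rfl
lemma x_tr (i) : IsTr (W.x i) := W.chi_mul_comm i

def rp (i : Fin W.n) : A →ₐ[ℂ] End ℂ (Fin (W.d i) → ℂ) := (Matrix.toLinAlgEquiv' : _ ≃ₐ[ℂ] _).toAlgHom.comp (W.rho i)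
lemma rp_apply (i) (a : A) : W.rp i a = Matrix.toLin' (W.rho i a) := rfl
lemma tr_rp (i) (a : A) : tr (W.rp i a) = W.x i a := by
  rw [rp_apply, x_apply, chi_apply]; exact Matrix.trace_toLin'_eq _

lemma x_sep {i j} (h : W.x i = W.x j) : i = j := by
  by_contra hij
  have h1 := W.chi_E i 0
  have h2 := W.chi_E_ne (Ne.symm hij) 0 0
  rw [← x_apply, ← h, x_apply, h1] at h2
  exact one_ne_zero h2

variable [FiniteDimensional ℂ A]
lemma x_exp {f : Du A} (hf : IsTr f) : f = ∑ k, f (W.E k 0 0) • W.x k := by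
  apply du_ext; intro a
  rw [W.class_eq (toL f) hf a]
  simp [x_apply]

def rr (i j) : A ⊗[ℂ] A →ₐ[ℂ] End ℂ ((Fin (W.d i) → ℂ) ⊗[ℂ] (Fin (W.d j) → ℂ)) :=
  (Module.endTensorEndAlgHom (R := ℂ) (A := ℂ)).comp (Algebra.TensorProduct.map (W.rp i) (W.rp j))
lemma rr_tmul (i j) (a b : A) : W.rr i j (a ⊗ₜ b) = TensorProduct.map (W.rp i a) (W.rp j b) := rfl
lemma tr_rr (i j) (t) : tr (W.rr i j t) = pr (W.x i) (W.x j) t := by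
  induction t with
  | zero => simp
  | add a b ha hb => rw [map_add, map_add, map_add, ha, hb]
  | tmul a b =>
    rw [pr_tmul, rr_tmul, ← tr_rp, ← tr_rp]
    exact (LinearMap.trace_tensorProduct' _ _)
def rd (i j) : A →ₐ[ℂ] End ℂ ((Fin (W.d i) → ℂ) ⊗[ℂ] (Fin (W.d j) → ℂ)) := (W.rr i j).comp (Bialgebra.comulAlgHom ℂ A)
lemma rd_apply (i j) (a : A) : W.rd i j a = W.rr i j (comul (R := ℂ) a) := rfl
lemma tr_rd (i j) (a : A) : tr (W.rd i j a) = (W.x i * W.x j) a := by rw [rd_apply, tr_rr, pr_comul]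

lemma mul_nat (i j k) : ∃ m : ℕ, (W.x i * W.x j) (W.E k 0 0) = m := by
  rw [← tr_rd]; exact W.mult_nat (W.rd i j) k

lemma S_nat (i k) : ∃ m : ℕ, (S (W.x i)) (W.E k 0 0) = m := by
  rw [du_antipode, ← tr_rp]
  exact trace_idem (by rw [← map_mul, ← S_mul, W.E_mul])

variable [IsSemisimpleRing A]
lemma orth {f : Du A} (hf : IsTr f) (j) : (f * S (W.x j)) (Lam A) = f (W.E j 0 0) := by
  have hd : (W.d j : ℂ) ≠ 0 := by have := W.ne j; exact_mod_cast (NeZero.ne (W.d j))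
  let u : A := (W.d j : ℂ)⁻¹ • ∑ a, W.E j a a
  have hu : S (W.x j) = rt reg (S u) := by
    apply du_ext; intro z
    rw [du_antipode, rt_apply, ← reg_S, S_mul, hS_ss, reg_apply, Lm, W.tr_L, sum_eq_single j]
    · simp only [u, smul_mul_assoc, map_smul, sum_mul, map_sum]
      rw [scr fun a _ => by rw [W.chi_mul_comm, W.chi_mul_E]]
      rw [smul_eq_mul, ← mul_assoc, mul_inv_cancel₀ hd, one_mul]; rfl
    · intro k _ hk
      simp only [u, smul_mul_assoc, map_smul, sum_mul, map_sum]
      rw [scr fun a _ => by rw [W.chi_mul_comm, W.chi_mul_E_ne hk]]; simp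
    · simp
  rw [hu, Lam_int.int_pair (reg_left hS_ss), Lam_int.reg_L, mul_one]
  simp only [u, map_smul, map_sum]
  have : ∀ a, f (W.E j a a) = f (W.E j 0 0) := fun a => by
    rw [← W.E_mul j a 0 a, hf, W.E_mul]
  simp [this]; field_simp

lemma orth' (i j) : (W.x i * S (W.x j)) (Lam A) = if i = j then 1 else 0 := by
  rw [W.orth (W.x_tr i), x_apply]
  split_ifs with h
  · subst h; exact W.chi_E _ _
  · exact W.chi_E_ne h _ _

lemma exists_fus : ∃ F : Fus (Fin W.n), F.d = W.d ∧ W.x F.o = 1 ∧ (∀ i, S (W.x i) = W.x (F.st i)) ∧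
    ∀ i j, W.x i * W.x j = ∑ k, (F.N i j k : ℂ) • W.x k := by
  obtain ⟨o, ho1, ho2, -⟩ := W.exists_triv
  have hxo : W.x o = 1 := du_ext fun a => by rw [x_apply, ho2, du_one]
  choose N hN using W.mul_nat
  choose t ht using W.S_nat
  have hm : ∀ i j, W.x i * W.x j = ∑ k, (N i j k : ℂ) • W.x k := fun i j => by
    rw [W.x_exp ((W.x_tr i).mul (W.x_tr j))]; simp only [hN]
  have hSt : ∀ i, ∃ j, S (W.x i) = W.x j := by
    intro i
    have htr : IsTr (S (W.x i)) := fun a b => by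
      rw [du_antipode, du_antipode, S_mul, S_mul, W.x_tr]
    have h1 := W.x_exp htr
    simp only [ht] at h1
    have h2 : (S (W.x i) * S (S (W.x i))) (Lam A) = 1 := by
      rw [hS_du hS_ss, Lam_cyc, W.orth']; simp
    have h3 : ∑ k, (t i k : ℂ) * t i k = 1 := by
      have h4 : S (S (W.x i)) = ∑ k, (t i k : ℂ) • S (W.x k) := by
        conv_lhs => rw [h1]
        simp
      rw [← h2, h4, mul_sum, ← ev_apply, map_sum]
      refine scr fun k _ => ?_
      rw [mul_smul_comm, map_smul, ev_apply, W.orth htr, ht, smul_eq_mul]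
    have h5 : ∑ k, t i k * t i k = 1 := by exact_mod_cast h3
    have h6 : ∃ j, t i j ≠ 0 := by
      by_contra hc; push Not at hc; simp [hc] at h5
    obtain ⟨j, hj⟩ := h6
    have h7 := Finset.add_sum_erase univ (fun k => t i k * t i k) (mem_univ j)
    rw [h5] at h7
    have h8 : 0 < t i j * t i j := by positivity
    have h9 : ∑ k ∈ Finset.univ.erase j, t i k * t i k = 0 := by omega
    have h10 : t i j = 1 := Nat.eq_one_of_mul_eq_one_right (n := t i j) (by omega)
    refine ⟨j, ?_⟩
    rw [h1, sum_eq_single j, h10]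
    · simp
    · intro k _ hk
      have := (Finset.sum_eq_zero_iff.1 h9) k (by simp [hk])
      simp at this; simp [this]
    · simp
  choose st hst using hSt
  have hNL : ∀ i j k, (N i j k : ℂ) = (W.x i * W.x j * S (W.x k)) (Lam A) := fun i j k => by
    rw [W.orth ((W.x_tr i).mul (W.x_tr j)), hN]
  have hstst : ∀ i, st (st i) = i := fun i => W.x_sep (by rw [← hst, ← hst, hS_du hS_ss])
  have hx1 : ∀ i, W.x i 1 = W.d i := W.chi_one
  have hsto : st o = o := W.x_sep (by rw [← hst, hxo, antipode_one])
  have hS1 : S (1 : Du A) = 1 := antipode_one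
  refine ⟨⟨W.d, N, o, st, fun i => ?_, ho1, fun i => ?_, hstst, hsto, fun i k l => ?_, fun i j => ?_, fun j k => ?_, fun i j => ?_⟩, rfl, hxo, hst, hm⟩
  · have := W.ne i; exact Nat.pos_of_ne_zero (NeZero.ne _)
  · have : ((W.d (st i) : ℕ) : ℂ) = W.d i := by rw [← hx1, ← hx1, ← hst, du_antipode, antipode_one]
    exact_mod_cast this
  · have : (N i k l : ℂ) = N (st i) l k := by
      rw [hNL, hNL, ← Lam_S (W.x (st i) * _ * _), S_mul, S_mul, hS_du hS_ss, ← hst, hS_du hS_ss, ← mul_assoc, Lam_cyc (W.x k * _), mul_assoc]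
    exact_mod_cast this
  · have : (N i j o : ℂ) = if i = st j then 1 else 0 := by
      rw [hNL, hxo, hS1, mul_one, ← W.orth', ← hst, hS_du hS_ss]
    exact_mod_cast this
  · have : (N o j k : ℂ) = if j = k then 1 else 0 := by
      rw [hNL, hxo, one_mul, W.orth']
    exact_mod_cast this
  · have : (W.d i * W.d j : ℂ) = ∑ k, N i j k * W.d k := by
      have h := congrArg (fun f : Du A => f 1) (hm i j)
      simp only [← pr_comul] at h
      rw [Bialgebra.comul_one, Algebra.TensorProduct.one_def, pr_tmul, hx1, hx1] at h
      rw [h]; simp [hx1]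
    exact_mod_cast this
end Wed
end

section
structure Mdl (I : Type) [Fintype I] [DecidableEq I] extends Fus I where
  s : I → I → ℂ
  m : I → ℕ
  n : ℕ
  npos : 0 < n
  s1 : ∀ i j, s i j = s j i
  s2 : ∀ j, s o j = d j
  s3 : ∀ i k j, s i j * s k j = d j * ∑ l, (N i k l : ℂ) * s l j
  s4 : ∀ i, ∑ j, (d j : ℂ) * s i j = if i = o then (n : ℂ) ^ 2 else 0
  s5 : ∀ i, ∑ j, (m j : ℂ) * s i j = n * m i
  s6 : ∑ i, d i ^ 2 = n ^ 2
  m_o : m o = 1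

variable {A : Type*} [Ring A] [HopfAlgebra ℂ A] [FiniteDimensional ℂ A] [IsSemisimpleRing A]

lemma Wed.x_Lam (W : Wed A) (F : Fus (Fin W.n)) (ho : W.x F.o = 1) (i) : W.x i (Lam A) = if i = F.o then 1 else 0 := by
  rw [← W.orth', ho]
  have hS1 : S (1 : Du A) = 1 := antipode_one
  rw [hS1, mul_one]

lemma exists_mdl (W : Wed (Db A)) : ∃ M : Mdl (Fin W.n), M.d = W.d ∧ W.x M.o = 1 ∧ (∀ i, S (W.x i) = W.x (M.st i)) ∧
    (∀ i j, W.x i * W.x j = ∑ k, (M.N i j k : ℂ) • W.x k) ∧ M.n = finrank ℂ A ∧ ∀ i, (M.m i : ℂ) = W.x i (da (Lam A)) := by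
  obtain ⟨F, h1, h2, h3, h4⟩ := W.exists_fus
  have hL : Lam A * Lam A = Lam A := by rw [Lam_int.left, Lam_int.norm, one_smul]
  have hm : ∀ i, ∃ m : ℕ, W.x i (da (Lam A)) = m := fun i => by
    rw [← W.tr_rp]
    exact trace_idem (by rw [← map_mul, ← map_mul, hL])
  choose m hm using hm
  have hc : ∀ i j, ∃ c : ℂ, W.rho j (Phi (W.x i)) = c • 1 := fun i j =>
    W.central_scalar j fun x => (Phi_central (W.x_tr i) x).symm
  choose c hc using hc
  have hs : ∀ i j, W.x j (Phi (W.x i)) = W.d j * c i j := fun i j => by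
    rw [W.x_apply, W.chi_apply, hc]; simp [mul_comm]
  refine ⟨⟨F, fun i j => W.x j (Phi (W.x i)), m, finrank ℂ A, ?_, fun i j => ?_, fun j => ?_, fun i k j => ?_,
    fun i => ?_, fun i => ?_, ?_, ?_⟩, h1, h2, h3, h4, rfl, fun i => (hm i).symm⟩
  · have := n_ne (A := A); exact Nat.pos_of_ne_zero (by exact_mod_cast this)
  · exact Phi_symm (W.x_tr i) (W.x_tr j)
  · rw [h2, Phi_one, h1, W.x_apply, W.chi_one]
  · skip
    have e1 : W.x j (Phi (W.x i * W.x k)) = W.d j * (c i j * c k j) := by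
      rw [Phi_mul _ (W.x_tr k), W.x_apply, W.chi_apply, map_mul, hc, hc]; simp; ring
    rw [h4] at e1
    simp only [map_sum, map_smul, smul_eq_mul] at e1
    rw [e1, hs, hs, h1]; ring
  · skip
    have e1 := reg_Phi (W.x_tr i)
    rw [reg_apply, Lm, W.tr_L, W.x_Lam F h2] at e1
    rw [h1]
    refine Eq.trans ?_ (e1.trans (by split_ifs <;> simp))
    rfl
  · skip
    have e1 := tr_Phi_Lam (W.x_tr i)
    rw [W.tr_LR, hm] at e1
    rw [← e1]
    refine scr fun j _ => ?_
    rw [← hm, mul_comm]; rfl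
  · rw [h1, ← W.finrank_eq, finrank_Db]
  · have e1 := hm F.o
    have e2 : eps (Lam A) = 1 := Lam_int.norm
    rw [h2, du_one] at e1
    have e3 := eps_da (Lam A)
    have : ((m F.o : ℕ) : ℂ) = 1 := by rw [← e1, ← e2]; exact e3
    exact_mod_cast this
end

section
universe u

def Fus.Cl {I : Type} [Fintype I] [DecidableEq I] (F : Fus I) (L : Finset I) : Prop :=
  F.o ∈ L ∧ (∀ i ∈ L, F.st i ∈ L) ∧ ∀ i ∈ L, ∀ j ∈ L, ∀ k, F.N i j k ≠ 0 → k ∈ L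

def Wed.Of {A : Type*} [Ring A] [HopfAlgebra ℂ A] [FiniteDimensional ℂ A] (W : Wed A) (F : Fus (Fin W.n)) : Prop :=
  F.d = W.d ∧ W.x F.o = 1 ∧ (∀ i, S (W.x i) = W.x (F.st i)) ∧ ∀ i j, W.x i * W.x j = ∑ k, (F.N i j k : ℂ) • W.x k

def NoChar (A : Type*) [Ring A] [HopfAlgebra ℂ A] : Prop := ∀ φ : A →ₐ[ℂ] ℂ, ∀ x, φ x = eps x

def Pn (n : ℕ) : Prop := Squarefree n ∧ n.primeFactors.card ≤ 3

namespace Wed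
variable {A : Type u} [Ring A] [HopfAlgebra ℂ A] [FiniteDimensional ℂ A] (W : Wed A)

lemma rep_zero {V : Type*} [AddCommGroup V] [Module ℂ V] [FiniteDimensional ℂ V] (r : A →ₐ[ℂ] End ℂ V)
    (k) (h : tr (r (W.E k 0 0)) = 0) (a b) : r (W.E k a b) = 0 := by
  have h0 : IsIdempotentElem (r (W.E k 0 0)) := by
    rw [IsIdempotentElem, ← map_mul, W.E_mul]
  have h1 : r (W.E k 0 0) = 0 := (LinearMap.IsIdempotentElem.trace_eq_zero_iff h0).1 h
  rw [← W.E_mul k a 0 b, ← W.E_mul k 0 0 b, map_mul, map_mul, h1]; simp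

lemma rep_zero' {V : Type*} [AddCommGroup V] [Module ℂ V] [FiniteDimensional ℂ V] (r : A →ₐ[ℂ] End ℂ V)
    {z : A} (h : ∀ k, W.rho k z = 0 ∨ tr (r (W.E k 0 0)) = 0) : r z = 0 := by
  rw [W.sum_E z]
  simp only [map_sum, map_smul]
  refine sum_eq_zero fun k _ => sum_eq_zero fun a _ => sum_eq_zero fun b _ => ?_
  rcases h k with h | h
  · rw [h]; simp
  · rw [W.rep_zero r k h]; simp

lemma x_E (i k) : W.x i (W.E k 0 0) = if i = k then 1 else 0 := by
  rw [x_apply]; split_ifs with h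
  · subst h; exact W.chi_E _ _
  · exact W.chi_E_ne h _ _

variable {W} {F : Fus (Fin W.n)}
lemma Of.mul_E (h : W.Of F) (i j k) : (W.x i * W.x j) (W.E k 0 0) = F.N i j k := by
  rw [h.2.2.2]; simp [x_E]

def J (W : Wed A) (L : Finset (Fin W.n)) : Ideal A where
  carrier := {z | ∀ i ∈ L, W.rho i z = 0}
  add_mem' := fun ha hb i hi => by rw [map_add, ha i hi, hb i hi, add_zero]
  zero_mem' := fun i hi => map_zero _
  smul_mem' := fun c x hx i hi => by rw [smul_eq_mul, map_mul, hx i hi, mul_zero]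
lemma mem_J {L : Finset (Fin W.n)} {z : A} : z ∈ W.J L ↔ ∀ i ∈ L, W.rho i z = 0 := Iff.rfl
instance (L : Finset (Fin W.n)) : (W.J L).IsTwoSided := ⟨fun {a} b ha i hi => by rw [map_mul, ha i hi, zero_mul]⟩

lemma J_mul (h : W.Of F) {L} (hL : F.Cl L) {f g : Du A} (hf : ∀ z ∈ W.J L, f z = 0) (hg : ∀ z ∈ W.J L, g z = 0)
    {z} (hz : z ∈ W.J L) : (f * g) z = 0 := by
  have key : ∀ {f : Du A}, (∀ z ∈ W.J L, f z = 0) → f = ∑ i, ∑ a, ∑ b, f (W.E i a b) • rt (W.x i) (W.E i b a) := by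
    intro f hf
    apply du_ext; intro y
    conv_lhs => rw [W.sum_E y]
    simp only [map_sum, map_smul, LinearMap.sum_apply, LinearMap.smul_apply, rt_apply]
    simp only [x_apply, chi_mul_E, smul_eq_mul, mul_comm]
  have hE : ∀ {f : Du A}, (∀ z ∈ W.J L, f z = 0) → ∀ i, i ∉ L → ∀ a b, f (W.E i a b) = 0 := by
    intro f hf i hi a b
    refine hf _ fun j hj => W.rho_E_ne (fun e : j = i => hi (e ▸ hj)) _ _
  rw [key hf, key hg, ← ev_apply]
  simp only [sum_mul, mul_sum, map_sum]
  refine sum_eq_zero fun j _ => sum_eq_zero fun a _ => sum_eq_zero fun b _ => ?_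
  refine sum_eq_zero fun i _ => sum_eq_zero fun a' _ => sum_eq_zero fun b' _ => ?_
  by_cases hi : j ∈ L
  swap
  · rw [ev_apply, hE hg j hi]; simp
  by_cases hj : i ∈ L
  swap
  · rw [ev_apply, hE hf i hj]; simp
  rw [smul_mul_smul_comm, map_smul, ev_apply, ← pr_comul, ← pr_left, ← pr_right, ← tr_rr, map_mul (W.rr i j), map_mul (W.rr i j), ← rd_apply,
    W.rep_zero' (W.rd i j) (z := z)]
  · simp
  intro k
  rw [tr_rd, h.mul_E]
  by_cases hk : k ∈ L
  · exact Or.inl (hz k hk)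
  · right
    by_contra hc
    exact hk (hL.2.2 i hj j hi k (by exact_mod_cast hc))

lemma sep2 {V : Type*} [AddCommGroup V] [Module ℂ V] [FiniteDimensional ℂ V] {t : V ⊗[ℂ] V}
    (h : ∀ f g : V →ₗ[ℂ] ℂ, LinearMap.mul' ℂ ℂ (TensorProduct.map f g t) = 0) : t = 0 := by
  let b := Module.finBasis ℂ V
  refine (b.tensorProduct b).ext_elem fun ij => ?_
  have key : ∀ u : V ⊗[ℂ] V, LinearMap.mul' ℂ ℂ (TensorProduct.map (b.coord ij.1) (b.coord ij.2) u) = (b.tensorProduct b).repr u ij := by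
    intro u
    induction u with
    | zero => simp
    | add x y hx hy => simp [hx, hy]
    | tmul x y => rw [Module.Basis.tensorProduct_repr_tmul_apply]; simp [mul_comm]
  rw [← key, h]; simp

lemma J_hopf (h : W.Of F) {L} (hL : F.Cl L) : (W.J L).IsHopfIdeal ℂ where
  counit_eq_zero := by
    intro x hx
    have h1 := W.x_apply F.o x
    rw [h.2.1, du_one, chi_apply, hx _ hL.1] at h1
    simpa using h1
  map_mkQ_comul_eq_zero := by
    intro x hx
    refine sep2 fun f g => ?_
    have h1 := J_mul h hL (f := toL.symm (f ∘ₗ ((W.J L).restrictScalars ℂ).mkQ)) (g := toL.symm (g ∘ₗ ((W.J L).restrictScalars ℂ).mkQ))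
      (fun z hz => by
        change f (((W.J L).restrictScalars ℂ).mkQ z) = 0
        exact (congrArg f ((Submodule.Quotient.mk_eq_zero _).2 hz)).trans (map_zero f)) (fun z hz => by
        change g (((W.J L).restrictScalars ℂ).mkQ z) = 0
        exact (congrArg g ((Submodule.Quotient.mk_eq_zero _).2 hz)).trans (map_zero g)) hx
    rw [du_mul'] at h1
    rw [← h1]
    change _ = LinearMap.mul' ℂ ℂ (TensorProduct.map (f ∘ₗ ((W.J L).restrictScalars ℂ).mkQ) (g ∘ₗ ((W.J L).restrictScalars ℂ).mkQ) _)
    rw [TensorProduct.map_comp]; rfl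
  antipode_mem := by
    intro x hx i hi
    have h1 : ∀ a b, rt (S (W.x i)) (S (W.E i b a)) x = 0 := by
      intro a b
      rw [rt_apply, h.2.2.1, x_apply, chi_apply, map_mul, hx _ (hL.2.1 i hi)]; simp
    ext a b
    rw [← chi_mul_E, chi_mul_comm]
    have := h1 a b
    rw [rt_apply, du_antipode, S_mul, S_S W, x_apply] at this
    simpa using this

lemma finrank_J (W : Wed A) (L) : finrank ℂ (A ⧸ W.J L) = ∑ i ∈ L, W.d i ^ 2 := by
  let ψ : A →ₗ[ℂ] (Π i : L, Matrix (Fin (W.d i)) (Fin (W.d i)) ℂ) := LinearMap.pi fun i => (W.rho i).toLinearMap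
  have hs : Function.Surjective ψ := fun M => ⟨W.e.symm fun i => if h : i ∈ L then M ⟨i, h⟩ else 0, by
    ext i : 1
    change W.rho i _ = _
    rw [rho_apply]; simp⟩
  have hk : LinearMap.ker ψ = (W.J L).restrictScalars ℂ := by
    ext z
    rw [LinearMap.mem_ker, Submodule.restrictScalars_mem, mem_J]
    constructor
    · intro h i hi
      exact congrFun h ⟨i, hi⟩
    · intro h; ext i : 1; exact h i i.2
  have e1 := (Submodule.Quotient.restrictScalarsEquiv ℂ (W.J L)).finrank_eq
  have e2 := (LinearMap.quotKerEquivOfSurjective ψ hs).finrank_eq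
  rw [hk] at e2
  refine e1.symm.trans (e2.trans ?_)
  rw [Module.finrank_pi_fintype, sum_coe_sort L (fun i => finrank ℂ (Matrix (Fin (W.d i)) (Fin (W.d i)) ℂ))]
  refine scr fun i _ => ?_
  rw [Module.finrank_matrix]; simp [sq]

end Wed

lemma Fus.Cl.sum {I : Type} [Fintype I] [DecidableEq I] {F : Fus I} {L : Finset I} (hL : F.Cl L) {i} (hi : i ∈ L) (l) :
    ∑ k ∈ L, F.d k * F.N i k l = if l ∈ L then F.d i * F.d l else 0 := by
  split_ifs with h
  · rw [← F.d_st, F.dd, ← sum_subset (Finset.subset_univ L)]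
    · exact scr fun k _ => by rw [F.frob i, mul_comm]
    · intro k _ hk
      by_contra hc
      exact hk (hL.2.2 _ (hL.2.1 i hi) l h k (fun e => hc (by rw [e, zero_mul])))
  · refine sum_eq_zero fun k hk => ?_
    by_contra hc
    exact h (hL.2.2 i hi k hk l (fun e => hc (by rw [e, mul_zero])))

namespace Wed
variable {A : Type u} [Ring A] [HopfAlgebra ℂ A] [FiniteDimensional ℂ A] [IsSemisimpleRing A] {W : Wed A} {F : Fus (Fin W.n)}

lemma dvd_of_cl (h : W.Of F) {L} (hL : F.Cl L) : ∑ i ∈ L, W.d i ^ 2 ∣ finrank ℂ A := by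
  set D := ∑ i ∈ L, W.d i ^ 2 with hD
  have hD0 : D ≠ 0 := by
    have h1 : W.d F.o ^ 2 ≤ D := single_le_sum (f := fun i => W.d i ^ 2) (fun _ _ => Nat.zero_le _) hL.1
    rw [← h.1, F.d_o] at h1; omega
  have hDc : (D : ℂ) ≠ 0 := by exact_mod_cast hD0
  let e : Du A := ∑ k ∈ L, (W.d k : ℂ) • W.x k
  have h1 : ∀ i ∈ L, W.x i * e = (W.d i : ℂ) • e := by
    intro i hi
    simp only [e, mul_sum, mul_smul_comm, h.2.2.2, Finset.smul_sum, smul_smul]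
    rw [sum_comm, ← sum_subset (Finset.subset_univ L)]
    · refine scr fun l hl => ?_
      rw [← sum_smul]; congr 1
      have := hL.sum hi l
      rw [if_pos hl, h.1] at this
      exact_mod_cast this
    · intro l _ hl
      rw [← sum_smul]
      have := hL.sum hi l
      rw [if_neg hl, h.1] at this
      have h2 : ∑ k ∈ L, (W.d k : ℂ) * F.N i k l = 0 := by exact_mod_cast this
      rw [h2, zero_smul]
  have h2 : e * e = (D : ℂ) • e := by
    conv_lhs => arg 1; simp only [e]
    rw [sum_mul, scr fun i hi => by rw [smul_mul_assoc, h1 i hi, smul_smul], ← sum_smul]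
    rw [hD]; push_cast; simp only [sq]
  let e' := (D : ℂ)⁻¹ • e
  have h3 : e' * e' = e' := by
    simp only [e']
    rw [smul_mul_smul_comm, h2, smul_smul]; congr 1; field_simp
  obtain ⟨k, hk⟩ := trace_idem (f := Lm e') (by refine LinearMap.ext fun y => ?_; change e' * (e' * y) = e' * y; rw [← mul_assoc, h3])
  have h4 := reg_du e'
  rw [reg_apply, hk] at h4
  have h5 : e' (Lam A) = (D : ℂ)⁻¹ := by
    simp only [e', e, map_smul, map_sum, LinearMap.smul_apply, LinearMap.sum_apply, W.x_Lam F h.2.1]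
    simp [hL.1, ← h.1, F.d_o]
  rw [h5] at h4
  refine ⟨k, ?_⟩
  have : (finrank ℂ A : ℂ) = D * k := by rw [h4]; field_simp
  exact_mod_cast this

theorem cl_triv (h : W.Of F) (hP : Pn (finrank ℂ A)) (hno : NoChar A)
    (IH : ∀ (B : Type u) [Ring B] [HopfAlgebra ℂ B] [FiniteDimensional ℂ B] [IsSemisimpleRing B],
      finrank ℂ B < finrank ℂ A → 1 < finrank ℂ B → Pn (finrank ℂ B) → ¬ NoChar B)
    {L} (hL : F.Cl L) : L = {F.o} ∨ L = univ := by
  by_contra hc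
  push Not at hc
  haveI := J_hopf h hL
  have hf := finrank_J W L
  have hdv := dvd_of_cl h hL
  have hdp : ∀ i, 0 < W.d i := fun i => h.1 ▸ F.d_pos i
  have h1 : 1 < ∑ i ∈ L, W.d i ^ 2 := by
    obtain ⟨j, hj, hjo⟩ : ∃ j ∈ L, j ≠ F.o := by
      by_contra h2; push Not at h2
      exact hc.1 (Finset.eq_singleton_iff_unique_mem.2 ⟨hL.1, h2⟩)
    rw [← Finset.add_sum_erase _ _ hL.1]
    have h3 : W.d j ^ 2 ≤ ∑ i ∈ L.erase F.o, W.d i ^ 2 :=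
      single_le_sum (f := fun i => W.d i ^ 2) (fun _ _ => Nat.zero_le _) (Finset.mem_erase.2 ⟨hjo, hj⟩)
    have h4 := pow_pos (hdp j) 2
    have h5 := pow_pos (hdp F.o) 2
    omega
  have h2 : ∑ i ∈ L, W.d i ^ 2 < finrank ℂ A := by
    rw [W.finrank_eq]
    obtain ⟨j, hj⟩ : ∃ j, j ∉ L := by
      by_contra h2; push Not at h2
      exact hc.2 (Finset.eq_univ_iff_forall.2 h2)
    exact sum_lt_sum_of_subset (Finset.subset_univ L) (mem_univ j) hj (pow_pos (hdp j) 2) fun _ _ _ => Nat.zero_le _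
  have hn : finrank ℂ A ≠ 0 := by omega
  haveI : IsSemisimpleRing (A ⧸ W.J L) := RingHom.isSemisimpleRing_of_surjective (Ideal.Quotient.mk (W.J L)) Ideal.Quotient.mk_surjective
  haveI : FiniteDimensional ℂ (A ⧸ W.J L) :=
    Module.Finite.of_surjective (Ideal.Quotient.mkₐ ℂ (W.J L)).toLinearMap Ideal.Quotient.mk_surjective
  rw [← hf] at h1 h2 hdv
  refine IH (A ⧸ W.J L) h2 h1 ⟨hP.1.squarefree_of_dvd hdv, (card_le_card (Nat.primeFactors_mono hdv hn)).trans hP.2⟩ ?_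
  intro φ y
  obtain ⟨z, rfl⟩ := Ideal.Quotient.mk_surjective y
  exact hno (φ.comp (Ideal.Quotient.mkₐ ℂ (W.J L))) z
end Wed
end

section
universe u
lemma tr_one {m : ℕ} (hm : m = 1) (M N : Matrix (Fin m) (Fin m) ℂ) : (M * N).trace = M.trace * N.trace ∧ M = M.trace • 1 := by
  subst hm
  refine ⟨by simp [Matrix.trace, Matrix.mul_apply], ?_⟩
  ext i j
  rw [Subsingleton.elim i 0, Subsingleton.elim j 0]
  simp [Matrix.trace]

section
variable {A : Type*} [Ring A] [HopfAlgebra ℂ A] [FiniteDimensional ℂ A] [IsSemisimpleRing A] {W : Wed A} {F : Fus (Fin W.n)}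
lemma Wed.d_one (h : W.Of F) (hno : NoChar A) {i} (hi : W.d i = 1) : i = F.o := by
  apply W.x_sep
  rw [h.2.1]
  apply du_ext; intro x
  rw [du_one]
  exact hno (AlgHom.ofLinearMap (W.chi i) (by rw [W.chi_one, hi]; simp) (fun a b => by
    rw [W.chi_apply, map_mul, (tr_one hi _ _).1]; rfl)) x

lemma Wed.chi_o (h : W.Of F) (x : A) : W.chi F.o x = eps x := by rw [← W.x_apply, h.2.1, du_one]

variable {WD : Wed (Db A)} {FD : Fus (Fin WD.n)}

lemma no_triv (h : W.Of F) (hD : WD.Of FD) (hno : NoChar A) (h1 : 1 < finrank ℂ A)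
    (hcl : ∀ L, F.Cl L → L = {F.o} ∨ L = univ) {X} (hX : X ≠ FD.o) (ht : ∀ a, WD.rho X (da a) = eps a • 1) : False := by
  have hc : ∀ a b, ∃ y : A, ∀ φ : Du A, WD.rho X (db φ) a b = φ y := fun a b =>
    exists_ev (WD.ent X a b ∘ₗ db.toLinearMap)
  choose c hc using hc
  have hcen : ∀ a b y, c a b * y = y * c a b := by
    intro a b y
    refine du_sep fun f => ?_
    have q := arbitrary ℂ f
    have e1 := congrArg (fun z => WD.rho X z a b) (relD_repr y q)
    have e2 : ∀ g : Du A, eps (lh g y) = g y := fun g => by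
      have := du_lh g 1 y; rw [one_mul, du_one] at this; exact this
    have e3 : ∀ g : Du A, eps (rh g y) = g y := fun g => by
      have := du_rh g 1 y; rw [mul_one, du_one] at this; exact this
    simp only [map_sum, map_mul, ht, e2, e3, smul_mul_assoc, mul_smul_comm, one_mul, mul_one, Matrix.sum_apply, Matrix.smul_apply, hc, smul_eq_mul] at e1
    rw [← du_repr q, ← du_repr q, e1]
    exact scr fun i _ => mul_comm _ _
  have hcm : ∀ a b (φ ψ : Du A), (φ * ψ) (c a b) = ∑ e, φ (c a e) * ψ (c e b) := by
    intro a b φ ψ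
    rw [← hc, map_mul, map_mul, Matrix.mul_apply]; simp only [hc]
  have hco : ∀ a b, eps (c a b) = (1 : Matrix _ _ ℂ) a b := by
    intro a b
    have := hc a b 1
    rw [map_one db, map_one, du_one] at this
    exact this.symm
  have hcc : ∀ a b, comul (R := ℂ) (c a b) = ∑ e, c a e ⊗ₜ c e b := fun a b => IsInt.pr_sep fun f g => by
    rw [pr_comul, hcm]; simp
  have hg : ∀ i a b, ∃ g : ℂ, W.rho i (c a b) = g • 1 := fun i a b => W.central_scalar i (hcen a b)
  choose γ' hg using hg
  let γ : ∀ i, Matrix (Fin (WD.d X)) (Fin (WD.d X)) ℂ := fun i => Matrix.of (γ' i)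
  have hrp : ∀ i a b, W.rp i (c a b) = γ i a b • 1 := fun i a b => by
    rw [W.rp_apply, hg, map_smul, Matrix.toLin'_one]; rfl
  have hrd : ∀ i j a b, W.rd i j (c a b) = (γ i * γ j) a b • 1 := by
    intro i j a b
    rw [W.rd_apply, hcc, map_sum, Matrix.mul_apply, sum_smul]
    refine scr fun e _ => ?_
    rw [W.rr_tmul, hrp, hrp, TensorProduct.map_smul_left, TensorProduct.map_smul_right, smul_smul]
    congr 1
    exact TensorProduct.map_id
  have hmul : ∀ i j k, F.N i j k ≠ 0 → γ k = γ i * γ j := by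
    intro i j k hk
    ext a b
    have e1 : c a b * W.E k 0 0 = γ k a b • W.E k 0 0 := by
      apply W.ext; intro l
      rw [map_mul, map_smul, hg]
      by_cases hl : l = k
      · subst hl; simp [γ]
      · rw [W.rho_E_ne hl]; simp
    have e2 := congrArg (fun z => tr (W.rd i j z)) e1
    simp only [map_mul, hrd, map_smul, smul_mul_assoc, one_mul, W.tr_rd, h.mul_E, smul_eq_mul] at e2
    exact (mul_right_cancel₀ (by exact_mod_cast hk) e2).symm
  have hgo : γ F.o = 1 := by
    ext a b
    rw [← hco, ← W.chi_o h, W.chi_apply, hg, ← h.1, Matrix.trace_smul, Matrix.trace_one]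
    simp [F.d_o, γ]
  have hst : ∀ i, F.N (F.st i) i F.o = 1 := fun i => by rw [F.N_o]; simp
  have hL : F.Cl (Finset.univ.filter fun i => γ i = 1) := by
    refine ⟨by simpa using hgo, fun i hi => ?_, fun i hi j hj k hk => ?_⟩
    · simp only [mem_filter, mem_univ, true_and] at hi ⊢
      have := hmul (F.st i) i F.o (by rw [hst]; simp)
      rw [hi, mul_one, hgo] at this; exact this.symm
    · simp only [mem_filter, mem_univ, true_and] at hi hj ⊢
      rw [hmul i j k hk, hi, hj, one_mul]
  rcases hcl _ hL with hL | hL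
  · have hV : ∃ V, V ≠ F.o := by
      by_contra hV
      push Not at hV
      rw [W.finrank_eq, sum_eq_single F.o (fun b _ hb => absurd (hV b) hb) (by simp), ← h.1, F.d_o] at h1
      simp at h1
    obtain ⟨V, hV⟩ := hV
    have e1 := hmul (F.st V) V F.o (by rw [hst]; simp)
    have e2 : ∀ k, F.N (F.st V) V k ≠ 0 → k = F.o := fun k hk => by
      have e3 := hmul _ _ _ hk
      rw [← e1, hgo] at e3
      have : k ∈ ({F.o} : Finset _) := by rw [← hL]; simpa using e3
      simpa using this
    have e3 := F.dd (F.st V) V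
    rw [sum_eq_single F.o (fun b _ hb => by
      by_contra hc; exact hb (e2 b (fun e => hc (by rw [e, zero_mul])))) (by simp), hst, F.d_o, F.d_st] at e3
    exact hV (W.d_one h hno (by rw [← h.1]; simpa using e3))
  · have e1 : ∀ i, γ i = 1 := fun i => by
      have : i ∈ Finset.univ.filter fun i => γ i = 1 := by rw [hL]; simp
      simpa using this
    have e2 : ∀ a b, c a b = (1 : Matrix (Fin (WD.d X)) (Fin (WD.d X)) ℂ) a b • 1 := fun a b => by
      apply W.ext; intro i
      rw [hg, map_smul, map_one, ← e1 i]; rfl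
    have e3 : ∀ φ, WD.rho X (db φ) = φ 1 • 1 := fun φ => by
      ext a b
      rw [hc, e2, map_smul]; simp [mul_comm]
    have e4 : ∀ z, WD.rho X z = eps z • 1 := by
      intro z
      induction z using Db_ind with
      | h1 x y hx hy => 
        have h5 : eps (x + y) = eps x + eps y := map_add (counit (R := ℂ) (A := Db A)) x y
        rw [h5, map_add, hx, hy, add_smul]
      | h2 f y =>
        have h7 : eps (db f * da y) = f 1 * eps y :=
          (Bialgebra.counit_mul _ _).trans (congrArg₂ _ (eps_db f) (eps_da y))
        rw [map_mul, e3, ht, h7]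
        simp [smul_smul, mul_comm]
    have e5 := congrFun (congrFun (e4 (WD.E X 0 0)) 0) 0
    rw [WD.rho_E, ← WD.chi_o hD, WD.chi_E_ne (Ne.symm hX)] at e5
    simp at e5

lemma inv_dim (h : W.Of F) (hD : WD.Of FD) (hno : NoChar A) (h1 : 1 < finrank ℂ A)
    (hcl : ∀ L, F.Cl L → L = {F.o} ∨ L = univ) {X} (hX : X ≠ FD.o) : 2 ≤ WD.d X := by
  by_contra hc
  have h2 := FD.d_pos X
  rw [hD.1] at h2
  have hd : WD.d X = 1 := by omega
  refine no_triv h hD hno h1 hcl hX fun a => ?_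
  refine (tr_one hd (WD.rho X (da a)) 1).2.trans ?_
  rw [← WD.chi_apply]
  congr 1
  exact hno ((AlgHom.ofLinearMap (WD.chi X) (by rw [WD.chi_one, hd]; simp) (fun a b => by
    rw [WD.chi_apply, map_mul, (tr_one hd _ _).1]; rfl)).comp da) a

lemma cl_big (h : W.Of F) (hD : WD.Of FD) (hno : NoChar A) (h1 : 1 < finrank ℂ A)
    (hcl : ∀ L, F.Cl L → L = {F.o} ∨ L = univ) {K} (hK : FD.Cl K) {X} (hXK : X ∈ K) (hX : X ≠ FD.o) :
    finrank ℂ A ≤ ∑ i ∈ K, WD.d i ^ 2 ∧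
      (∑ i ∈ K, WD.d i ^ 2 = finrank ℂ A → ∀ Y ∈ K, Y ≠ FD.o → WD.x Y (da (Lam A)) = 0) := by
  have hb : ∀ Y i, ∃ m : ℕ, WD.x Y (da (W.E i 0 0)) = m := fun Y i => by
    rw [← WD.tr_rp]; exact W.mult_nat ((WD.rp Y).comp da) i
  choose b hb using hb
  have hfa : ∀ Y, fa (WD.x Y) = ∑ i, (b Y i : ℂ) • W.x i := fun Y => by
    have : IsTr (fa (WD.x Y)) := fun x y => by simp only [fa_apply, map_mul]; exact WD.x_tr Y _ _
    rw [W.x_exp this]; simp only [fa_apply, hb]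
  have hL : F.Cl (Finset.univ.filter fun i => ∃ Y ∈ K, b Y i ≠ 0) := by
    refine ⟨?_, fun i hi => ?_, fun i hi j hj k hk => ?_⟩
    · simp only [mem_filter, mem_univ, true_and]
      refine ⟨FD.o, hK.1, fun e => ?_⟩
      have e1 := hb FD.o (W.E F.o 0 0 |> fun _ => F.o)
      rw [e, WD.x_apply, WD.chi_o hD] at e1
      have e2 := (eps_da (W.E F.o 0 0)).symm.trans e1
      rw [← W.chi_o h, W.chi_E] at e2
      simp at e2
    · simp only [mem_filter, mem_univ, true_and] at hi ⊢
      obtain ⟨Y, hY, hYi⟩ := hi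
      refine ⟨FD.st Y, hK.2.1 Y hY, fun e => hYi ?_⟩
      have e1 := hb (FD.st Y) (F.st i)
      rw [e, ← hD.2.2.1, du_antipode, S_da, ← fa_apply, ← du_antipode, hfa, map_sum] at e1
      simp only [map_smul, h.2.2.1, map_sum, LinearMap.sum_apply, LinearMap.smul_apply, W.x_E] at e1
      have e2 : ∀ x, (F.st x = F.st i) ↔ x = i := fun x => ⟨fun e => by rw [← F.st_st x, e, F.st_st], fun e => by rw [e]⟩
      simp only [e2] at e1
      simpa using e1
    · simp only [mem_filter, mem_univ, true_and] at hi hj ⊢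
      obtain ⟨Y, hY, hYi⟩ := hi
      obtain ⟨Z, hZ, hZj⟩ := hj
      have e1 := congrArg (fun f : Du A => f (W.E k 0 0)) (fa_mul (WD.x Y) (WD.x Z))
      simp only [hD.2.2.2] at e1
      simp only [map_sum, map_smul, hfa Y, hfa Z, LinearMap.sum_apply, LinearMap.smul_apply, fa_apply, hb, smul_eq_mul,
        sum_mul, mul_sum, smul_mul_smul_comm, h.mul_E] at e1
      by_contra hc
      push Not at hc
      have e2 : ∑ x, FD.N Y Z x * b x k = ∑ j, ∑ i, b Y i * b Z j * F.N i j k := by exact_mod_cast e1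
      rw [sum_eq_zero] at e2
      · have e3 := Finset.sum_eq_zero_iff.1 e2.symm j (mem_univ _)
        have e4 := Finset.sum_eq_zero_iff.1 e3 i (mem_univ _)
        simp [hYi, hZj, hk] at e4
      · intro x _
        by_cases hx : FD.N Y Z x = 0
        · rw [hx, zero_mul]
        · rw [hc x (hK.2.2 Y hY Z hZ x hx), mul_zero]
  rcases hcl _ hL with hL | hL
  · exfalso
    have hb0 : ∀ i, i ≠ F.o → b X i = 0 := fun i hi => by
      by_contra hc
      have : i ∈ ({F.o} : Finset _) := by rw [← hL]; simpa using ⟨X, hXK, hc⟩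
      exact hi (by simpa using this)
    refine no_triv h hD hno h1 hcl hX fun a => ?_
    have e1 := W.rep_zero' ((WD.rp X).comp da) (z := a - eps a • 1) (fun k => by
      by_cases hk : k = F.o
      · left; subst hk
        rw [(tr_one (h.1 ▸ F.d_o) (W.rho F.o _) 1).2, ← W.chi_apply, W.chi_o h]; simp
      · right
        rw [AlgHom.comp_apply, WD.tr_rp, hb, hb0 k hk]; simp)
    have e2 : WD.rho X (da (a - eps a • 1)) = 0 := by
      apply Matrix.toLin'.injective
      rw [map_zero]; exact e1
    rw [map_sub, map_sub, sub_eq_zero] at e2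
    rw [e2]; simp
  · let ψ : A →ₗ[ℂ] (Π i : K, Matrix (Fin (WD.d i)) (Fin (WD.d i)) ℂ) := LinearMap.pi fun i => ((WD.rho i).comp da).toLinearMap
    have hψ : ∀ a i, ψ a i = WD.rho i (da a) := fun a i => rfl
    have hinj : Function.Injective ψ := by
      rw [injective_iff_map_eq_zero]
      intro z hz
      apply W.ext; intro i
      have : i ∈ Finset.univ.filter fun i => ∃ Y ∈ K, b Y i ≠ 0 := by rw [hL]; simp
      simp only [mem_filter, mem_univ, true_and] at this
      obtain ⟨Y, hY, hYi⟩ := this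
      have e0 : WD.rho Y (da z) = 0 := by rw [← hψ z ⟨Y, hY⟩, hz]; rfl
      ext a c
      by_contra hc
      simp only [map_zero, Matrix.zero_apply] at hc
      have e1 := W.E_sandwich i z a c
      have e2 : W.E i 0 0 = (W.rho i z a c)⁻¹ • (W.E i 0 a * (W.E i a a * z * W.E i c c) * W.E i c 0) := by
        rw [e1, mul_smul_comm, smul_mul_assoc, smul_smul, inv_mul_cancel₀ hc, one_smul, W.E_mul, W.E_mul]
      have e3 := hb Y i
      rw [e2, WD.x_apply, WD.chi_apply] at e3
      simp only [map_smul, map_mul, e0] at e3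
      simp at e3
      exact hYi (by exact_mod_cast e3.symm)
    have hfr : finrank ℂ (Π i : K, Matrix (Fin (WD.d i)) (Fin (WD.d i)) ℂ) = ∑ i ∈ K, WD.d i ^ 2 := by
      rw [Module.finrank_pi_fintype, sum_coe_sort K (fun i => finrank ℂ (Matrix (Fin (WD.d i)) (Fin (WD.d i)) ℂ))]
      refine scr fun i _ => ?_
      rw [Module.finrank_matrix]; simp [sq]
    refine ⟨hfr ▸ LinearMap.finrank_le_finrank_of_injective hinj, fun heq Y hY hYo => ?_⟩
    have hsur := (LinearMap.injective_iff_surjective_of_finrank_eq_finrank (by rw [hfr, heq])).1 hinj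
    obtain ⟨z, hz⟩ := hsur (Pi.single ⟨Y, hY⟩ 1)
    have e1 : eps z = 0 := by
      have e2 := hψ z ⟨FD.o, hK.1⟩
      rw [hz, Pi.single_eq_of_ne (by simpa using Ne.symm hYo)] at e2
      have e3 := WD.chi_o hD (da z)
      rw [WD.chi_apply, ← e2] at e3
      rw [← eps_da]; simpa using e3.symm
    have e2 := hψ z ⟨Y, hY⟩
    rw [hz, Pi.single_eq_same] at e2
    have e3 := Lam_int.right z
    rw [e1, zero_smul] at e3
    have e4 := congrArg (fun y => WD.rho Y (da y)) e3
    simp only [map_mul, ← e2, mul_one, map_zero] at e4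
    rw [WD.x_apply, WD.chi_apply, e4]; simp
end
end

section
lemma int_of_rat {q : ℚ} (h : IsIntegral ℤ (q : ℂ)) : ∃ k : ℤ, q = k := by
  have h1 : IsIntegral ℤ q := (isIntegral_algebraMap_iff (R := ℤ) (A := ℚ) (B := ℂ) (algebraMap ℚ ℂ).injective).1 (by simpa using h)
  obtain ⟨k, hk⟩ := IsIntegrallyClosed.isIntegral_iff.1 h1
  exact ⟨k, by simpa using hk.symm⟩

lemma dvd_of_int {a b : ℕ} (hb : b ≠ 0) (h : IsIntegral ℤ ((a : ℂ) / b)) : b ∣ a := by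
  obtain ⟨k, hk⟩ := int_of_rat (q := a / b) (by push_cast; exact h)
  have hb' : (b : ℚ) ≠ 0 := by exact_mod_cast hb
  rw [div_eq_iff hb'] at hk
  have : (a : ℤ) = k * b := by exact_mod_cast hk
  exact Int.natCast_dvd_natCast.1 ⟨k, by rw [this, mul_comm]⟩

abbrev Kb := algebraicClosure ℚ ℂ

lemma ext_aut (τ : Kb ≃ₐ[ℚ] Kb) : ∃ σ : ℂ ≃+* ℂ, ∀ x : Kb, σ x = τ x := by
  obtain ⟨s, hs⟩ := exists_isTranscendenceBasis Kb ℂ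
  letI := IsAlgClosed.isAlgClosure_of_transcendence_basis _ hs
  let e : Algebra.adjoin Kb (Set.range ((↑) : s → ℂ)) ≃+* Algebra.adjoin Kb (Set.range ((↑) : s → ℂ)) :=
    (hs.1.aevalEquiv.symm.toRingEquiv.trans (MvPolynomial.mapEquiv s τ.toRingEquiv)).trans hs.1.aevalEquiv.toRingEquiv
  refine ⟨IsAlgClosure.equivOfEquiv ℂ ℂ e, fun x => ?_⟩
  have h1 := IsAlgClosure.equivOfEquiv_algebraMap ℂ ℂ e (algebraMap Kb _ x)
  have h2 : e (algebraMap Kb _ x) = algebraMap Kb _ (τ x) := by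
    show hs.1.aevalEquiv (MvPolynomial.map _ (hs.1.aevalEquiv.symm (algebraMap Kb _ x))) = _
    rw [AlgEquiv.commutes, MvPolynomial.algebraMap_eq, MvPolynomial.map_C, ← MvPolynomial.algebraMap_eq, AlgEquiv.commutes]
    rfl
  rw [h2] at h1
  exact h1

lemma exists_aut {x y : ℂ} (hx : IsIntegral ℤ x) (hy : Polynomial.aeval y (minpoly ℚ x) = 0) :
    ∃ σ : ℂ ≃+* ℂ, σ x = y := by
  have hx1 : IsAlgebraic ℚ x := (hx.tower_top (A := ℚ)).isAlgebraic
  have hy1 : IsAlgebraic ℚ y := ⟨_, minpoly.ne_zero hx1.isIntegral, hy⟩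
  haveI : Algebra.IsAlgebraic ℚ Kb := algebraicClosure.isAlgebraic ℚ ℂ
  haveI : IsAlgClosure ℚ Kb := algebraicClosure.isAlgClosure ℚ ℂ
  haveI : IsAlgClosed Kb := IsAlgClosure.isAlgClosed ℚ
  haveI : Normal ℚ Kb := IsAlgClosure.normal ℚ Kb
  have h1 : IsConjRoot ℚ (⟨x, hx1.isIntegral⟩ : Kb) ⟨y, hy1.isIntegral⟩ := by
    rw [isConjRoot_iff_aeval_eq_zero (Algebra.IsIntegral.isIntegral _)]
    apply Subtype.ext
    rw [← minpoly.algebraMap_eq (B := Kb) (B' := ℂ) (algebraMap Kb ℂ).injective]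
    have := Polynomial.aeval_algebraMap_apply ℂ (⟨y, hy1.isIntegral⟩ : Kb) (minpoly ℚ x)
    exact this.symm.trans hy
  obtain ⟨τ, hτ⟩ := (isConjRoot_iff_exists_algEquiv).1 h1
  obtain ⟨σ, hσ⟩ := ext_aut τ.symm
  refine ⟨σ, ?_⟩
  have := hσ ⟨x, hx1.isIntegral⟩
  rw [τ.symm_apply_eq.2 hτ.symm] at this
  exact this

lemma norm_one {z : ℂ} (hz : IsIntegral ℤ z) (h0 : z ≠ 0) (h : ∀ σ : ℂ ≃+* ℂ, ‖σ z‖ ≤ 1) : ‖z‖ = 1 := by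
  have hq : IsIntegral ℚ z := hz.tower_top
  set p := (minpoly ℚ z).map (algebraMap ℚ ℂ) with hp
  have hm : p.Monic := (minpoly.monic hq).map _
  have hsp : p.Splits := IsAlgClosed.splits p
  have hr : ∀ y ∈ p.roots, ‖y‖ ≤ 1 := fun y hy => by
    rw [Polynomial.mem_roots hm.ne_zero, Polynomial.IsRoot, hp, Polynomial.eval_map_algebraMap] at hy
    obtain ⟨σ, rfl⟩ := exists_aut hz hy
    exact h σ
  have hzr : z ∈ p.roots := by
    rw [Polynomial.mem_roots hm.ne_zero, Polynomial.IsRoot, hp, Polynomial.eval_map_algebraMap, minpoly.aeval]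
  have hc := hsp.coeff_zero_eq_prod_roots_of_monic hm
  have hc0 : ∃ k : ℤ, p.coeff 0 = k ∧ k ≠ 0 := by
    refine ⟨(minpoly ℤ z).coeff 0, ?_, fun e => minpoly.coeff_zero_ne_zero hq h0 ?_⟩
    rw [hp, minpoly.isIntegrallyClosed_eq_field_fractions' ℚ hz]
    · simp
    · rw [minpoly.isIntegrallyClosed_eq_field_fractions' ℚ hz]; simp [e]
  obtain ⟨k, hk, hk0⟩ := hc0
  have h1 : 1 ≤ ‖p.roots.prod‖ := by
    have h2 : ‖p.coeff 0‖ = ‖p.roots.prod‖ := by rw [hc]; simp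
    rw [← h2, hk, Complex.norm_intCast]
    exact_mod_cast Int.one_le_abs hk0
  obtain ⟨t, ht⟩ := Multiset.exists_cons_of_mem hzr
  have ht1 : ‖t.prod‖ ≤ 1 := by
    have : ∀ y ∈ t, ‖y‖ ≤ 1 := fun y hy => hr y (by rw [ht]; exact Multiset.mem_cons_of_mem hy)
    clear ht
    induction t using Multiset.induction with
    | empty => simp
    | cons a s ih =>
      rw [Multiset.prod_cons, norm_mul]
      exact mul_le_one₀ (this a (by simp)) (norm_nonneg _) (ih fun y hy => this y (by simp [hy]))
  rw [ht, Multiset.prod_cons, norm_mul] at h1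
  have := hr z hzr
  nlinarith [norm_nonneg z, norm_nonneg t.prod]

lemma int_of_fix {z : ℂ} (hz : IsIntegral ℤ z) (h : ∀ σ : ℂ ≃+* ℂ, σ z = z) : ∃ k : ℤ, z = k := by
  have hq : IsIntegral ℚ z := hz.tower_top
  set p := (minpoly ℚ z).map (algebraMap ℚ ℂ) with hp
  have hm : p.Monic := (minpoly.monic hq).map _
  have hsep : p.Separable := (minpoly.irreducible hq).separable.map
  have hr : ∀ y ∈ p.roots, y = z := fun y hy => by
    rw [Polynomial.mem_roots hm.ne_zero, Polynomial.IsRoot, hp, Polynomial.eval_map_algebraMap] at hy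
    obtain ⟨σ, rfl⟩ := exists_aut hz hy
    exact h σ
  have h1 : p.roots.card ≤ 1 := by
    have h2 := Polynomial.nodup_roots hsep
    have h3 := Multiset.eq_replicate_of_mem hr
    rw [h3, Multiset.nodup_iff_count_le_one] at h2
    simpa using h2 z
  rw [← (IsAlgClosed.splits p).natDegree_eq_card_roots, hp, Polynomial.natDegree_map] at h1
  have h2 : (minpoly ℚ z).natDegree = 1 := le_antisymm h1 (minpoly.natDegree_pos hq)
  obtain ⟨q, hq2⟩ := minpoly.natDegree_eq_one_iff.1 h2
  obtain ⟨k, hk⟩ := int_of_rat (q := q) (by rw [show (q : ℂ) = z from by simpa using hq2]; exact hz)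
  exact ⟨k, by rw [← hq2, hk]; simp⟩
end

section
open ComplexConjugate
variable {I : Type} [Fintype I] [DecidableEq I]

def Fus.IsC (F : Fus I) (f : I → ℂ) : Prop :=
  f F.o = 1 ∧ ∀ i k, f i * f k = ∑ l, (F.N i k l : ℂ) * f l

namespace Fus
variable {F : Fus I} {f g : I → ℂ} {K : Finset I}

lemma Cl.sum_eq (hK : F.Cl K) {i k : I} (hi : i ∈ K) (hk : k ∈ K) (h : I → ℂ) :
    ∑ l, (F.N i k l : ℂ) * h l = ∑ l ∈ K, (F.N i k l : ℂ) * h l := by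
  symm
  apply sum_subset (Finset.subset_univ K)
  intro l _ hl
  have : F.N i k l = 0 := by by_contra hc; exact hl (hK.2.2 i hi k hk l hc)
  simp [this]

lemma cl_univ : F.Cl univ := ⟨by simp, by simp, by simp⟩

lemma IsC.int (hf : F.IsC f) (i : I) : IsIntegral ℤ (f i) := by
  refine isIntegral_of_smul_mem_submodule (M := ℂ) (N := Submodule.span ℤ (Set.range f)) ?_
    (Submodule.fg_span (Set.finite_range f)) _ ?_
  · intro h
    have : f F.o ∈ (⊥ : Submodule ℤ ℂ) := h ▸ Submodule.subset_span ⟨_, rfl⟩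
    rw [hf.1] at this; simp at this
  · intro x hx
    induction hx using Submodule.span_induction with
    | mem x hx =>
      obtain ⟨k, rfl⟩ := hx
      rw [smul_eq_mul, hf.2]
      refine Submodule.sum_mem _ fun l _ => ?_
      rw [← nsmul_eq_mul]
      exact (Submodule.span ℤ (Set.range f)).toAddSubgroup.nsmul_mem (Submodule.subset_span (Set.mem_range_self l)) _
    | zero => simp
    | add x y _ _ hx hy => rw [smul_add]; exact add_mem hx hy
    | smul a x _ hx => rw [smul_comm]; exact Submodule.smul_mem _ _ hx

lemma dpos (F : Fus I) (i : I) : (0 : ℝ) < F.d i := by exact_mod_cast F.d_pos i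
lemma dne (F : Fus I) (i : I) : (F.d i : ℂ) ≠ 0 := by exact_mod_cast (F.d_pos i).ne'

lemma IsC.le (hf : F.IsC f) (i : I) : ‖f i‖ ≤ F.d i := by
  obtain ⟨l, -, hl⟩ := Finset.exists_max_image univ (fun l => ‖f l‖ / F.d l) ⟨F.o, by simp⟩
  have h0 : 1 ≤ ‖f l‖ / F.d l := by simpa [hf.1, F.d_o] using hl F.o (by simp)
  have hl0 : 0 < ‖f l‖ := by
    by_contra hc
    rw [le_antisymm (not_lt.1 hc) (norm_nonneg _)] at h0; norm_num at h0
  have h1 : ‖f i‖ * ‖f l‖ ≤ ∑ k, F.N i l k * ‖f k‖ := by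
    rw [← norm_mul, hf.2]
    refine (norm_sum_le _ _).trans (le_of_eq ?_)
    simp
  have h2 : ∑ k, F.N i l k * ‖f k‖ ≤ ∑ k, (F.N i l k : ℝ) * F.d k * (‖f l‖ / F.d l) := by
    refine sum_le_sum fun k _ => ?_
    rw [mul_assoc]
    refine mul_le_mul_of_nonneg_left ?_ (Nat.cast_nonneg _)
    have := hl k (by simp)
    rw [div_le_iff₀ (F.dpos k)] at this
    linarith
  have h3 : (∑ k, (F.N i l k : ℝ) * F.d k) = F.d i * F.d l := by exact_mod_cast (F.dd i l).symm
  rw [← sum_mul, h3] at h2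
  have h4 : (F.d i : ℝ) * F.d l * (‖f l‖ / F.d l) = F.d i * ‖f l‖ := by
    field_simp [(F.dpos l).ne']
  rw [h4] at h2
  exact le_of_mul_le_mul_right (h1.trans h2) hl0

lemma IsC.pair (hf : F.IsC f) (hg : F.IsC g) (hK : F.Cl K) {i : I} (hi : i ∈ K) :
    f i * ∑ k ∈ K, f k * conj (g k) = conj (g (F.st i)) * ∑ k ∈ K, f k * conj (g k) := by
  rw [mul_sum, mul_sum]
  have h1 : ∀ k ∈ K, f i * (f k * conj (g k)) = ∑ l ∈ K, (F.N i k l : ℂ) * f l * conj (g k) := fun k hk => by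
    rw [← mul_assoc, hf.2, hK.sum_eq hi hk, sum_mul]
  have h2 : ∀ k ∈ K, conj (g (F.st i)) * (f k * conj (g k)) = ∑ l ∈ K, (F.N i l k : ℂ) * f k * conj (g l) := fun k hk => by
    rw [mul_left_comm, ← map_mul, hg.2, hK.sum_eq (hK.2.1 i hi) hk, map_sum, mul_sum]
    refine scr fun l _ => ?_
    rw [F.frob i l k, map_mul, map_natCast]; ring
  rw [sum_congr rfl h1, sum_congr rfl h2, sum_comm]

lemma IsC.pos (hf : F.IsC f) (hK : F.Cl K) : ∑ k ∈ K, f k * conj (f k) ≠ 0 := by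
  have h1 : ∑ k ∈ K, f k * conj (f k) = ((∑ k ∈ K, ‖f k‖ ^ 2 : ℝ) : ℂ) := by
    push_cast; exact scr fun k _ => Complex.mul_conj' _
  rw [h1]
  have h2 : ‖f F.o‖ ^ 2 ≤ ∑ k ∈ K, ‖f k‖ ^ 2 :=
    single_le_sum (f := fun k => ‖f k‖ ^ 2) (fun _ _ => by positivity) hK.1
  rw [hf.1] at h2
  have : (0 : ℝ) < ∑ k ∈ K, ‖f k‖ ^ 2 := by norm_num at h2; linarith
  exact_mod_cast this.ne'

lemma IsC.conj (hf : F.IsC f) (i : I) : conj (f i) = f (F.st i) := by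
  have := mul_right_cancel₀ (hf.pos cl_univ) (hf.pair hf cl_univ (mem_univ (F.st i)))
  rw [this, F.st_st]

lemma IsC.orth (hf : F.IsC f) (hg : F.IsC g) (hK : F.Cl K) (h : ∃ i ∈ K, f i ≠ g i) :
    ∑ k ∈ K, f k * conj (g k) = 0 := by
  obtain ⟨i, hi, hne⟩ := h
  by_contra hc
  have := mul_right_cancel₀ hc (hf.pair hg hK hi)
  rw [hg.conj, F.st_st] at this
  exact hne this

lemma IsC.map (hf : F.IsC f) (σ : ℂ ≃+* ℂ) : F.IsC fun i => σ (f i) :=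
  ⟨by simp [hf.1], fun i k => by rw [← map_mul, hf.2, map_sum]; simp⟩

lemma isC_d (F : Fus I) : F.IsC fun i => F.d i :=
  ⟨by simp [F.d_o], fun i k => by
    show (F.d i : ℂ) * F.d k = ∑ l, (F.N i k l : ℂ) * F.d l
    exact_mod_cast F.dd i k⟩

lemma IsC.eq_d (hf : F.IsC f) {i k : I} (h : f i * f k = F.d i * F.d k) {l} (hl : F.N i k l ≠ 0) : f l = F.d l := by
  have h1 : ∑ l, (F.N i k l : ℝ) * (F.d l - (f l).re) = 0 := by
    have h2 := congrArg Complex.re ((hf.2 i k).symm.trans h)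
    have h3 : (F.d i : ℂ) * F.d k = ((∑ l, F.N i k l * F.d l : ℕ) : ℂ) := by rw [← F.dd]; push_cast; rfl
    rw [h3, Complex.natCast_re, Complex.re_sum] at h2
    push_cast at h2
    simp only [mul_sub, sum_sub_distrib]
    rw [← h2, sub_eq_zero]
    refine scr fun l _ => ?_
    rw [← Complex.ofReal_natCast, Complex.re_ofReal_mul]
  have hle : ∀ l, (f l).re ≤ F.d l := fun l => (Complex.re_le_norm _).trans (hf.le l)
  have h2 := (sum_eq_zero_iff_of_nonneg (fun l _ => mul_nonneg (Nat.cast_nonneg _) (sub_nonneg.2 (hle l)))).1 h1 l (by simp)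
  have h3 : (f l).re = F.d l := by
    rcases mul_eq_zero.1 h2 with h | h
    · exact absurd (by exact_mod_cast h) hl
    · linarith
  have h4 := hf.le l
  rw [← h3] at h4
  have h5 : (f l).im = 0 := Complex.abs_re_eq_norm.1 (le_antisymm (Complex.abs_re_le_norm _) (h4.trans (le_abs_self _)))
  exact Complex.ext (by simp [h3]) (by simp [h5])

lemma IsC.cl (hf : F.IsC f) : F.Cl (Finset.univ.filter fun i => f i = F.d i) := by
  refine ⟨by simp [hf.1, F.d_o], fun i hi => ?_, fun i hi j hj k hk => ?_⟩
  · simp only [mem_filter, mem_univ, true_and] at hi ⊢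
    rw [← hf.conj, hi, F.d_st]; simp
  · simp only [mem_filter, mem_univ, true_and] at hi hj ⊢
    exact hf.eq_d (by rw [hi, hj]) hk

lemma IsC.eq_d' (hf : F.IsC f) {i : I} (h : ‖f i‖ = F.d i) {l} (hl : F.N i (F.st i) l ≠ 0) : f l = F.d l := by
  refine hf.eq_d ?_ hl
  rw [← hf.conj, Complex.mul_conj', h, F.d_st]; push_cast; ring

lemma Cl.inter {K' : Finset I} (h : F.Cl K) (h' : F.Cl K') : F.Cl (K ∩ K') := by
  refine ⟨by simp [h.1, h'.1], fun i hi => ?_, fun i hi j hj k hk => ?_⟩ <;> simp only [mem_inter] at *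
  · exact ⟨h.2.1 i hi.1, h'.2.1 i hi.2⟩
  · exact ⟨h.2.2 i hi.1 j hj.1 k hk, h'.2.2 i hi.2 j hj.2 k hk⟩

lemma exists_V {X : I} (h : 2 ≤ F.d X) : ∃ V, V ≠ F.o ∧ F.N X (F.st X) V ≠ 0 := by
  by_contra hc
  push Not at hc
  have h1 := F.dd X (F.st X)
  rw [sum_eq_single F.o (fun V _ hV => by rw [hc V hV, zero_mul]) (by simp), F.N_o, F.st_st, F.d_o, F.d_st] at h1
  simp at h1; omega
end Fus
end

section
open ComplexConjugate
variable {I : Type} [Fintype I] [DecidableEq I]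

namespace Mdl
variable (M : Mdl I)

def c (Y X : I) : ℂ := M.s X Y / M.d Y

lemma s_eq (X Y : I) : M.s X Y = M.d Y * M.c Y X := by
  rw [c, mul_div_cancel₀ _ (M.dne Y)]

lemma isC (Y : I) : M.IsC (M.c Y) := by
  refine ⟨by rw [c, M.s2, div_self (M.dne Y)], fun i k => ?_⟩
  have h := M.s3 i k Y
  simp only [s_eq] at h
  have h0 := M.dne Y
  have h1 : (M.d Y : ℂ) ^ 2 * (M.c Y i * M.c Y k) = M.d Y ^ 2 * ∑ l, (M.N i k l : ℂ) * M.c Y l := by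
    rw [show (M.d Y : ℂ) ^ 2 * (M.c Y i * M.c Y k) = M.d Y * M.c Y i * (M.d Y * M.c Y k) by ring, h, mul_sum, mul_sum]
    exact scr fun l _ => by ring
  exact mul_left_cancel₀ (pow_ne_zero 2 h0) h1

lemma c_symm (X Y : I) : M.d Y * M.c Y X = M.d X * M.c X Y := by rw [← s_eq, ← s_eq, M.s1]

lemma c_o (X : I) : M.c M.o X = M.d X := by
  have := M.c_symm X M.o
  rw [(M.isC X).1, M.d_o] at this; simpa using this

lemma conj_s (X Y : I) : conj (M.s X Y) = M.s X (M.st Y) := by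
  rw [M.s1, s_eq, map_mul, (M.isC X).conj, map_natCast, ← s_eq, M.s1]

lemma ss (X Z : I) : ∑ Y, M.s X Y * M.s Z Y = if X = M.st Z then (M.n : ℂ) ^ 2 else 0 := by
  simp only [M.s3, mul_sum]
  rw [sum_comm]
  have : ∀ l, ∑ Y, (M.d Y : ℂ) * ((M.N X Z l : ℂ) * M.s l Y) = M.N X Z l * if l = M.o then (M.n : ℂ) ^ 2 else 0 := fun l => by
    rw [← M.s4 l, mul_sum]; exact scr fun _ _ => by ring
  rw [scr fun l _ => this l, sum_eq_single M.o (fun b _ hb => by simp [hb]) (by simp), M.N_o]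
  by_cases h : X = M.st Z <;> simp [h]

lemma nc : (M.n : ℂ) ≠ 0 := by exact_mod_cast M.npos.ne'

lemma sum_sq (Y : I) : ∑ X, M.s X Y * conj (M.s X Y) = (M.n : ℂ) ^ 2 := by
  have := M.ss Y (M.st Y)
  rw [M.st_st, if_pos rfl] at this
  rw [← this]
  refine scr fun X _ => ?_
  rw [conj_s, M.s1 X, M.s1 X]

lemma sum_c (Y : I) : ∑ X, M.c Y X * conj (M.c Y X) = (M.n : ℂ) ^ 2 / M.d Y ^ 2 := by
  rw [← M.sum_sq Y, sum_div]
  refine scr fun X _ => ?_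
  rw [c, map_div₀, map_natCast, div_mul_div_comm, sq]

lemma d_dvd (Y : I) : M.d Y ∣ M.n := by
  have h : IsIntegral ℤ (((M.n ^ 2 : ℕ) : ℂ) / (M.d Y ^ 2 : ℕ)) := by
    push_cast
    rw [← sum_c]
    exact IsIntegral.sum _ fun X _ => ((M.isC Y).int X).mul (by rw [(M.isC Y).conj]; exact (M.isC Y).int _)
  exact (Nat.pow_dvd_pow_iff two_ne_zero).1 (dvd_of_int (pow_ne_zero 2 (M.d_pos Y).ne') h)

lemma all_c {f : I → ℂ} (hf : M.IsC f) : ∃ Y, f = M.c Y := by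
  by_contra hc
  push Not at hc
  have h1 : ∀ Y, ∑ k, f k * M.s (M.st k) Y = 0 := fun Y => by
    obtain ⟨i, hi⟩ := Function.ne_iff.1 (hc Y)
    have := hf.orth (M.isC Y) Fus.cl_univ ⟨i, by simp, hi⟩
    rw [← mul_zero (M.d Y : ℂ), ← this, mul_sum]
    refine scr fun k _ => ?_
    rw [(M.isC Y).conj, s_eq]; ring
  have h2 : ∑ Y, (M.d Y : ℂ) * ∑ k, f k * M.s (M.st k) Y = 0 := by simp [h1]
  simp only [mul_sum] at h2
  rw [sum_comm] at h2
  have h3 : ∀ k, ∑ Y, (M.d Y : ℂ) * (f k * M.s (M.st k) Y) = f k * if M.st k = M.o then (M.n : ℂ) ^ 2 else 0 := fun k => by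
    rw [← M.s4, mul_sum]; exact scr fun _ _ => by ring
  rw [scr fun k _ => h3 k, sum_eq_single M.o (fun k _ hk => ?_) (by simp), M.st_o, hf.1] at h2
  · simp [M.npos.ne'] at h2
  · rw [if_neg, mul_zero]
    intro e; exact hk (by rw [← M.st_st k, e, M.st_o])

lemma gal (σ : ℂ ≃+* ℂ) (Y : I) : ∃ Y', M.d Y' = M.d Y ∧ (∀ X, σ (M.s X Y) = M.s X Y') ∧ ∀ X, σ (M.c Y X) = M.c Y' X := by
  obtain ⟨Y', hY'⟩ := M.all_c ((M.isC Y).map σ)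
  have h1 : ∀ X, σ (M.c Y X) = M.c Y' X := fun X => congrFun hY' X
  have h2 : M.d Y' = M.d Y := by
    have h3 := congrArg σ (M.sum_c Y)
    have h4 := M.sum_c Y'
    rw [map_sum, map_div₀, map_pow, map_pow, map_natCast, map_natCast] at h3
    have h5 : ∑ X, σ (M.c Y X * conj (M.c Y X)) = ∑ X, M.c Y' X * conj (M.c Y' X) :=
      scr fun X _ => by rw [map_mul, (M.isC Y).conj, (M.isC Y').conj, h1, h1]
    rw [← h5, h3, div_eq_div_iff (pow_ne_zero 2 (M.dne _)) (pow_ne_zero 2 (M.dne _))] at h4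
    have h6 := mul_left_cancel₀ (pow_ne_zero 2 M.nc) h4
    have h7 : M.d Y' ^ 2 = M.d Y ^ 2 := by exact_mod_cast h6
    exact Nat.pow_left_injective two_ne_zero h7
  exact ⟨Y', h2, fun X => by rw [s_eq, s_eq, map_mul, h1, h2, map_natCast], h1⟩

def Cen (L : Finset I) : Finset I := Finset.univ.filter fun W => ∀ V ∈ L, M.s W V = M.d W * M.d V

variable {M}
lemma mem_Cen {L : Finset I} {W : I} : W ∈ M.Cen L ↔ ∀ V ∈ L, M.c V W = M.d W := by
  simp only [Cen, mem_filter, mem_univ, true_and]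
  refine forall₂_congr fun V _ => ?_
  rw [s_eq, mul_comm, mul_left_inj' (M.dne V)]

lemma mem_Cen' {L : Finset I} {W : I} : W ∈ M.Cen L ↔ ∀ V ∈ L, M.c W V = M.d V := by
  rw [mem_Cen]
  refine forall₂_congr fun V _ => ?_
  rw [← mul_right_inj' (M.dne V), c_symm, mul_comm (M.d V : ℂ) (M.d W), mul_right_inj' (M.dne W)]

lemma Cen_cl (L : Finset I) : M.Cl (M.Cen L) := by
  have h := fun V => (M.isC V).cl
  refine ⟨mem_Cen.2 fun V hV => by simpa using (h V).1, fun i hi => mem_Cen.2 fun V hV => ?_, fun i hi j hj k hk => mem_Cen.2 fun V hV => ?_⟩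
  · simpa using (h V).2.1 i (by simpa using mem_Cen.1 hi V hV)
  · simpa using (h V).2.2 i (by simpa using mem_Cen.1 hi V hV) j (by simpa using mem_Cen.1 hj V hV) k hk

lemma sum_K {K : Finset I} (hK : M.Cl K) (V : I) :
    ∑ W ∈ K, (M.d W : ℂ) * M.c V W = if V ∈ M.Cen K then ((∑ W ∈ K, M.d W ^ 2 : ℕ) : ℂ) else 0 := by
  split_ifs with h
  · push_cast
    refine scr fun W hW => ?_
    rw [mem_Cen'.1 h W hW, sq]
  · rw [mem_Cen'] at h
    push Not at h
    rw [← (M.isC V).orth M.isC_d hK h]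
    refine scr fun W _ => by rw [map_natCast, mul_comm]

lemma D_mul {K : Finset I} (hK : M.Cl K) : (∑ W ∈ K, M.d W ^ 2) * ∑ W ∈ M.Cen K, M.d W ^ 2 = M.n ^ 2 := by
  have h1 : ∑ V, ∑ W ∈ K, (M.d V : ℂ) ^ 2 * (M.d W * M.c V W) = (M.n : ℂ) ^ 2 := by
    rw [sum_comm]
    have h2 : ∀ W, ∑ V, (M.d V : ℂ) ^ 2 * (M.d W * M.c V W) = if W = M.o then (M.n : ℂ) ^ 2 else 0 := fun W => by
      rw [show (if W = M.o then (M.n : ℂ) ^ 2 else 0) = M.d W * if W = M.o then (M.n : ℂ) ^ 2 else 0 by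
        split_ifs with h <;> simp [h, M.d_o], ← M.s4, mul_sum]
      exact scr fun V _ => by rw [s_eq]; ring
    rw [scr fun W _ => h2 W, Finset.sum_ite_eq', if_pos hK.1]
  have h3 : ∀ V, ∑ W ∈ K, (M.d V : ℂ) ^ 2 * (M.d W * M.c V W) = if V ∈ M.Cen K then (M.d V : ℂ) ^ 2 * ((∑ W ∈ K, M.d W ^ 2 : ℕ) : ℂ) else 0 := fun V => by
    rw [← mul_sum, sum_K hK]; split_ifs <;> simp
  rw [scr fun V _ => h3 V, sum_ite_mem, univ_inter, ← sum_mul] at h1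
  rw [mul_comm]
  exact_mod_cast h1

lemma sub_Cen {L : Finset I} : L ⊆ M.Cen (M.Cen L) := fun V hV => mem_Cen.2 fun W hW => mem_Cen'.1 hW V hV

structure Hyp (M : Mdl I) : Prop where
  pn : Pn M.n
  n1 : 1 < M.n
  inv : ∀ X, X ≠ M.o → 2 ≤ M.d X
  big : ∀ K, M.Cl K → ∀ X ∈ K, X ≠ M.o → M.n ≤ ∑ i ∈ K, M.d i ^ 2 ∧
    (∑ i ∈ K, M.d i ^ 2 = M.n → ∀ Y ∈ K, Y ≠ M.o → M.m Y = 0)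
end Mdl
end

section
open ComplexConjugate
variable {I : Type} [Fintype I] [DecidableEq I]

lemma prime_of_card {b : ℕ} (h : Squarefree b) (hc : b.primeFactors.card = 1) : b.Prime := by
  obtain ⟨p, hp⟩ := Finset.card_eq_one.1 hc
  have h1 := Nat.prod_primeFactors_of_squarefree h
  rw [hp, Finset.prod_singleton] at h1
  rw [← h1]
  exact Nat.prime_of_mem_primeFactors (by rw [hp]; simp : p ∈ b.primeFactors)

lemma card_pos_of {b : ℕ} (h : 2 ≤ b) : 1 ≤ b.primeFactors.card :=
  Finset.card_pos.2 (Nat.nonempty_primeFactors.2 (by omega))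

lemma cof_prime {a b : ℕ} (hP : Pn (a * b)) (ha : 2 ≤ a) (hp : ¬ a.Prime) (hb : 2 ≤ b) : b.Prime ∧ (a * b).primeFactors.card = 3 := by
  have hc := Nat.coprime_of_squarefree_mul hP.1
  have h1 := hP.2
  have hsq := (Nat.squarefree_mul hc).1 hP.1
  have e : (a * b).primeFactors.card = a.primeFactors.card + b.primeFactors.card := by
    rw [hc.primeFactors_mul, card_union_of_disjoint hc.disjoint_primeFactors]
  rw [e] at h1 ⊢
  have h2 := card_pos_of ha
  have h3 := card_pos_of hb
  have h4 : a.primeFactors.card ≠ 1 := fun h => hp (prime_of_card hsq.1 h)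
  exact ⟨prime_of_card hsq.2 (by omega), by omega⟩

lemma int_div {z : ℂ} {a b : ℕ} (ha : a ≠ 0) (hb : b ≠ 0) (h : a.Coprime b) (h1 : IsIntegral ℤ (z / a)) (h2 : IsIntegral ℤ (z / b)) :
    IsIntegral ℤ (z / (a * b)) := by
  have ha' : (a : ℂ) ≠ 0 := by exact_mod_cast ha
  have hb' : (b : ℂ) ≠ 0 := by exact_mod_cast hb
  obtain ⟨u, v, huv⟩ := Nat.isCoprime_iff_coprime.2 h
  have e : z / (a * b) = u * (z / b) + v * (z / a) := by
    have : (u : ℂ) * a + v * b = 1 := by exact_mod_cast huv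
    field_simp
    linear_combination (-z) * this
  rw [e]
  exact ((isIntegral_algebraMap (R := ℤ) (x := u)).mul h2).add ((isIntegral_algebraMap (R := ℤ) (x := v)).mul h1)

namespace Mdl
variable {M : Mdl I}

lemma exists_Y (h : M.Hyp) {X : I} (hX : X ≠ M.o) : ∃ Y, Y ≠ M.o ∧ ¬ M.d X ∣ M.d Y ∧ M.s X Y ≠ 0 := by
  by_contra hc
  push Not at hc
  have h1 := M.s4 X
  rw [if_neg hX, ← Finset.add_sum_erase _ _ (mem_univ M.o), M.s1, M.s2, M.d_o] at h1
  have h2 : IsIntegral ℤ (((1 : ℕ) : ℂ) / M.d X) := by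
    have e : ((1 : ℕ) : ℂ) / M.d X = - ∑ Y ∈ Finset.univ.erase M.o, (M.d Y / M.d X : ℂ) ^ 2 * M.c Y X := by
      have e1 : ∑ Y ∈ Finset.univ.erase M.o, (M.d Y / M.d X : ℂ) ^ 2 * M.c Y X = (∑ Y ∈ Finset.univ.erase M.o, (M.d Y : ℂ) * M.s X Y) / M.d X ^ 2 := by
        rw [sum_div]
        exact scr fun Y _ => by rw [s_eq]; ring
      rw [e1, eq_neg_of_add_eq_zero_right h1]
      have := M.dne X
      field_simp
    rw [e]
    refine (IsIntegral.sum _ fun Y hY => ?_).neg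
    rcases eq_or_ne (M.s X Y) 0 with h0 | h0
    · rw [c, h0]; simp [isIntegral_zero]
    · obtain ⟨k, hk⟩ : M.d X ∣ M.d Y := by
        by_contra hd; exact h0 (hc Y (Finset.ne_of_mem_erase hY) hd)
      rw [hk, Nat.cast_mul, mul_div_cancel_left₀ _ (M.dne X)]
      exact ((isIntegral_natCast (R := ℤ) k).pow 2).mul ((M.isC Y).int X)
  have h3 := dvd_of_int (M.d_pos X).ne' h2
  have := h.inv X hX
  rw [Nat.dvd_one] at h3; omega

lemma d_lt (h : M.Hyp) (X : I) : M.d X < M.n := by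
  have h1 := M.s6
  rcases eq_or_ne X M.o with rfl | hX
  · rw [M.d_o]; exact h.n1
  have h2 : ∑ i ∈ {X, M.o}, M.d i ^ 2 ≤ ∑ i, M.d i ^ 2 := sum_le_sum_of_subset (Finset.subset_univ _)
  rw [sum_pair hX, h1, M.d_o] at h2
  exact lt_of_pow_lt_pow_left₀ 2 (Nat.zero_le _) (by omega)

lemma two_le_cof (h : M.Hyp) {X : I} {b : ℕ} (hb : M.n = M.d X * b) : 2 ≤ b := by
  have h1 := M.d_lt h X
  rcases b with _ | _ | b
  · have := M.npos; omega
  · omega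
  · omega

lemma exists_prime (h : M.Hyp) : ∃ X, (M.d X).Prime := by
  by_contra hc
  push Not at hc
  obtain ⟨X, hX⟩ : ∃ X, X ≠ M.o := by
    by_contra hn
    push Not at hn
    have := M.s6
    rw [sum_eq_single M.o (fun b _ hb => absurd (hn b) hb) (by simp), M.d_o] at this
    have := h.n1; nlinarith
  obtain ⟨Y, hY, hd, hs⟩ := M.exists_Y h hX
  obtain ⟨a, ha⟩ := M.d_dvd X
  obtain ⟨b, hb⟩ := M.d_dvd Y
  have hpa : a.Prime := (cof_prime (ha ▸ h.pn) (h.inv X hX) (hc X) (M.two_le_cof h ha)).1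
  have hpb : b.Prime := (cof_prime (hb ▸ h.pn) (h.inv Y hY) (hc Y) (M.two_le_cof h hb)).1
  have hab : a.Coprime b := by
    rw [Nat.coprime_primes hpa hpb]
    rintro rfl
    exact hd (Nat.eq_of_mul_eq_mul_right hpa.pos (ha.symm.trans hb)).dvd
  have ha0 : (a : ℂ) ≠ 0 := by exact_mod_cast hpa.ne_zero
  have hb0 : (b : ℂ) ≠ 0 := by exact_mod_cast hpb.ne_zero
  have ha' : (M.n : ℂ) = M.d X * a := by exact_mod_cast ha
  have hb' : (M.n : ℂ) = M.d Y * b := by exact_mod_cast hb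
  have hn := M.nc
  have hint : IsIntegral ℤ (M.s X Y / M.n) := by
    have h1 := int_div (z := M.s X Y * a * b / M.n) hpa.ne_zero hpb.ne_zero hab ?_ ?_
    · convert h1 using 1; field_simp
    · convert (M.isC Y).int X using 1
      rw [c, hb']; have := M.dne Y; field_simp
    · convert (M.isC X).int Y using 1
      rw [c, ha', M.s1]; have := M.dne X; field_simp
  have hlt : ∀ Y', Y' ≠ M.o → ‖M.s X Y'‖ < M.n := fun Y' hY' => by
    have h1 := M.sum_sq X
    simp only [Complex.mul_conj'] at h1
    have h2 : ∑ Z, ‖M.s Z X‖ ^ 2 = (M.n : ℝ) ^ 2 := by exact_mod_cast h1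
    have h3 : ∑ Z ∈ {Y', M.o}, ‖M.s Z X‖ ^ 2 ≤ ∑ Z, ‖M.s Z X‖ ^ 2 :=
      sum_le_sum_of_subset_of_nonneg (Finset.subset_univ _) (fun _ _ _ => by positivity)
    rw [sum_pair hY', h2, M.s2, M.s1, Complex.norm_natCast] at h3
    have := M.dpos X
    exact lt_of_pow_lt_pow_left₀ 2 (Nat.cast_nonneg _) (by nlinarith)
  have hσ : ∀ σ : ℂ ≃+* ℂ, ‖σ (M.s X Y / M.n)‖ < 1 := fun σ => by
    obtain ⟨Y', h1, h2, -⟩ := M.gal σ Y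
    rw [map_div₀, map_natCast, h2, norm_div, Complex.norm_natCast, div_lt_one (by exact_mod_cast M.npos)]
    refine hlt Y' ?_
    rintro rfl
    have := h.inv Y hY
    rw [M.d_o] at h1; omega
  have h1 := norm_one hint (div_ne_zero hs hn) (fun σ => (hσ σ).le)
  have h2 := hσ (RingEquiv.refl ℂ)
  rw [RingEquiv.refl_apply, h1] at h2
  exact lt_irrefl _ h2

lemma lagr (h : M.Hyp) : ∃ K, M.Cl K ∧ M.Cen K = K ∧ ∑ i ∈ K, M.d i ^ 2 = M.n := by
  obtain ⟨X, hp⟩ := M.exists_prime h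
  have hX : X ≠ M.o := by rintro rfl; rw [M.d_o] at hp; exact Nat.not_prime_one hp
  obtain ⟨Y, hY, hd, hs⟩ := M.exists_Y h hX
  have hn : ‖M.c Y X‖ = M.d X := by
    have h1 := int_div (z := M.s X Y) hp.ne_zero (M.d_pos Y).ne' ((Nat.Prime.coprime_iff_not_dvd hp).2 hd)
      (by rw [M.s1]; exact (M.isC X).int Y) ((M.isC Y).int X)
    have e : M.s X Y / (M.d X * M.d Y) = M.c Y X / M.d X := by rw [c, div_div, mul_comm]
    rw [e] at h1
    have h2 := norm_one h1 (div_ne_zero (div_ne_zero hs (M.dne Y)) (M.dne X)) fun σ => by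
      obtain ⟨Y', -, -, h2⟩ := M.gal σ Y
      rw [map_div₀, map_natCast, h2, norm_div, Complex.norm_natCast, div_le_one (M.dpos X)]
      exact (M.isC Y').le X
    rwa [norm_div, Complex.norm_natCast, div_eq_one_iff_eq (M.dpos X).ne'] at h2
  set L := Finset.univ.filter fun V => M.N X (M.st X) V ≠ 0 with hL
  obtain ⟨V, hV, hVL⟩ := Fus.exists_V (h.inv X hX)
  have hK := Cen_cl (M := M) L
  have hYK : Y ∈ M.Cen L := mem_Cen'.2 fun V hV => (M.isC Y).eq_d' hn (by simpa [hL] using hV)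
  have hK' := Cen_cl (M := M) (M.Cen L)
  have hVK : V ∈ M.Cen (M.Cen L) := sub_Cen (by simpa [hL] using hVL)
  have hD := D_mul hK
  set K := M.Cen L
  have b1 := (h.big _ hK Y hYK hY).1
  have b2 := (h.big _ hK' V hVK hV).1
  have hpos := M.npos
  have e1 : ∑ i ∈ K, M.d i ^ 2 = M.n := by nlinarith
  have e2 : ∑ i ∈ M.Cen K, M.d i ^ 2 = M.n := by nlinarith
  have hsub : ∀ {A B : Finset I}, A ⊆ B → ∑ i ∈ B, M.d i ^ 2 ≤ ∑ i ∈ A, M.d i ^ 2 → A = B := fun {A B} hAB hle => by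
    by_contra hne
    obtain ⟨i, hi, hi'⟩ := Finset.exists_of_ssubset (hAB.ssubset_of_ne hne)
    exact absurd (sum_lt_sum_of_subset hAB hi hi' (pow_pos (M.d_pos i) 2) (fun _ _ _ => Nat.zero_le _)) (not_lt.2 hle)
  by_cases hZ : ∃ Z ∈ K ∩ M.Cen K, Z ≠ M.o
  · obtain ⟨Z, hZ, hZo⟩ := hZ
    have b3 := (h.big _ (hK.inter hK') Z hZ hZo).1
    have e3 := hsub Finset.inter_subset_left (e1 ▸ b3)
    have e4 := hsub Finset.inter_subset_right (e2 ▸ b3)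
    exact ⟨K, hK, e4.symm.trans e3, e1⟩
  · exfalso
    push Not at hZ
    have h1 : ∑ W ∈ K, M.c Y W * conj (M.c Y W) = (M.n : ℂ) / (M.d Y ^ 2 : ℕ) := by
      have h2 : ∀ W, M.c Y W * conj (M.c Y W) = (∑ l, (M.N Y (M.st Y) l : ℂ) * (M.d l * (M.d W * M.c l W))) / (M.d Y ^ 2 : ℕ) := fun W => by
        have h3 := (M.isC W).2 Y (M.st Y)
        rw [← (M.isC W).conj] at h3
        have h4 : (M.d Y : ℂ) ^ 2 * (M.c Y W * conj (M.c Y W)) = M.d W ^ 2 * (M.c W Y * conj (M.c W Y)) := by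
          have h5 := M.c_symm W Y
          have h6 := congrArg conj h5
          simp only [map_mul, map_natCast] at h6
          linear_combination (M.d Y * conj (M.c Y W)) * h5 + (M.d W * M.c W Y) * h6
        rw [eq_div_iff (by exact_mod_cast pow_ne_zero 2 (M.dne Y)), mul_comm]
        push_cast
        rw [h4, h3, mul_sum]
        refine scr fun l _ => ?_
        have h5 := M.c_symm W l
        linear_combination (-M.d W * M.N Y (M.st Y) l : ℂ) * h5
      rw [scr fun W _ => h2 W, ← sum_div, sum_comm]
      congr 1
      simp only [← mul_sum]
      rw [sum_eq_single M.o, M.N_o, M.st_st, sum_K hK, if_pos hK'.1, e1, M.d_o]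
      · simp
      · intro l _ hl
        rw [sum_K hK]
        by_cases h0 : M.N Y (M.st Y) l = 0
        · simp [h0]
        · rw [if_neg, mul_zero, mul_zero]
          intro hl'
          exact hl (hZ l (Finset.mem_inter.2 ⟨hK.2.2 Y hYK _ (hK.2.1 Y hYK) l h0, hl'⟩))
      · simp
    have h2 := dvd_of_int (pow_ne_zero 2 (M.d_pos Y).ne') (h1 ▸ IsIntegral.sum _ fun W _ =>
      ((M.isC Y).int W).mul (by rw [(M.isC Y).conj]; exact (M.isC Y).int _))
    rw [sq] at h2
    have h3 := Nat.isUnit_iff.1 (h.pn.1 _ h2)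
    have := h.inv Y hY
    omega
end Mdl
end

section
open ComplexConjugate
structure Tab (κ J : Type) [Fintype κ] [DecidableEq κ] [Fintype J] [DecidableEq J] where
  d : κ → ℕ
  o : κ
  st : κ → κ
  N : κ → κ → κ → ℕ
  ch : J → κ → ℂ
  w : J → ℕ
  j0 : J
  n : ℕ
  pn : Pn n
  n1 : 1 < n
  d_o : d o = 1
  d_two : ∀ X, X ≠ o → 2 ≤ d X
  d_st : ∀ X, d (st X) = d X
  st_st : ∀ X, st (st X) = X
  d_dvd : ∀ X, d X ∣ n
  mul : ∀ c X Z, ch c X * ch c Z = ∑ l, (N X Z l : ℂ) * ch c l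
  N_o : ∀ X Z, N X Z o = if X = st Z then 1 else 0
  ch_o : ∀ c, ch c o = 1
  ch_j : ∀ X, ch j0 X = d X
  w_j : w j0 = 1
  int : ∀ c X, IsIntegral ℤ (ch c X)
  le : ∀ c X, ‖ch c X‖ ≤ d X
  cj : ∀ c X, conj (ch c X) = ch c (st X)
  inj : ∀ c c', (∀ X, ch c X = ch c' X) → c = c'
  orth : ∀ c c', c ≠ c' → ∑ X, ch c X * conj (ch c' X) = 0
  wsum : ∀ X, ∑ c, (w c : ℂ) * ch c X = if X = o then (n : ℂ) else 0
  wint : ∀ c X, IsIntegral ℤ (w c * ch c X / d X)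
  gc : ∀ (σ : ℂ ≃+* ℂ) c, ∃ c', ∀ X, σ (ch c X) = ch c' X
  gr : ∀ (σ : ℂ ≃+* ℂ) X, ∃ X', d X' = d X ∧ ∀ c, σ (ch c X) = ch c X'
  star : ∀ c X, X ≠ o → ‖ch c X‖ = d X → c = j0

variable {I : Type} [Fintype I] [DecidableEq I]
namespace Mdl
variable {M : Mdl I}

lemma exists_tab (h : M.Hyp) : ∃ (κ J : Type) (_ : Fintype κ) (_ : DecidableEq κ) (_ : Fintype J) (_ : DecidableEq J), Nonempty (Tab κ J) := by
  classical
  obtain ⟨K, hK, hKK, hD⟩ := M.lagr h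
  have hX : ∃ X ∈ K, X ≠ M.o := by
    by_contra hc
    push Not at hc
    have : K ⊆ {M.o} := fun X hX => by simpa using hc X hX
    have h1 := sum_le_sum_of_subset (f := fun i => M.d i ^ 2) this
    have := h.n1
    simp [M.d_o] at h1; omega
  obtain ⟨X0, hX0, hX0o⟩ := hX
  have hm := (h.big K hK X0 hX0 hX0o).2 hD
  let r : I → K → ℂ := fun Y X => M.c Y X
  let J := {f : K → ℂ // f ∈ Finset.univ.image r}
  letI : Fintype J := Finset.fintypeCoeSort (Finset.univ.image r)
  letI : DecidableEq J := Classical.decEq J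
  let res : I → J := fun Y => ⟨r Y, by simp⟩
  have hres : ∀ c : J, ∃ Y, res Y = c := fun ⟨f, hf⟩ => by
    obtain ⟨Y, -, hY⟩ := Finset.mem_image.1 hf
    exact ⟨Y, Subtype.ext hY⟩
  have hch : ∀ Y (X : K), (res Y).1 X = M.c Y X := fun _ _ => rfl
  have hfib : ∀ (c : J) (X : K), ((∑ Y with res Y = c, M.m Y * M.d Y : ℕ) : ℂ) * c.1 X = ∑ Y with res Y = c, (M.m Y : ℂ) * M.s X Y := fun c X => by
    push_cast
    rw [sum_mul]
    refine scr fun Y hY => ?_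
    rw [← (Finset.mem_filter.1 hY).2, hch, s_eq]; ring
  have hstar : ∀ (c : J) (X : K), X.1 ≠ M.o → ‖c.1 X‖ = M.d X → c = res M.o := fun c X hX hn => by
    obtain ⟨Y, rfl⟩ := hres c
    obtain ⟨V, hV, hVN⟩ := Fus.exists_V (h.inv X hX)
    have hVK : V ∈ K := hK.2.2 X X.2 _ (hK.2.1 X X.2) V hVN
    have hd : M.c Y V = M.d V := (M.isC Y).eq_d' hn hVN
    have hcl := hK.inter (M.isC Y).cl
    have hb := (h.big _ hcl V (by simp [hVK, hd]) hV).1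
    refine Subtype.ext (funext fun Z => ?_)
    show M.c Y Z = M.c M.o Z
    rw [c_o]
    by_contra hZ
    have : ∑ i ∈ K ∩ Finset.univ.filter (fun i => M.c Y i = M.d i), M.d i ^ 2 < ∑ i ∈ K, M.d i ^ 2 :=
      sum_lt_sum_of_subset Finset.inter_subset_left Z.2 (by simp [hZ]) (pow_pos (M.d_pos Z) 2) (fun _ _ _ => Nat.zero_le _)
    omega
  have hsK : ∀ g : I → ℂ, ∑ X : K, g X = ∑ X ∈ K, g X := fun g => sum_coe_sort K g
  refine ⟨K, J, inferInstance, inferInstance, inferInstance, inferInstance, ⟨⟨fun X => M.d X, ⟨M.o, hK.1⟩, fun X => ⟨M.st X, hK.2.1 X X.2⟩,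
    fun X Y Z => M.N X Y Z, fun c X => c.1 X, fun c => ∑ Y with res Y = c, M.m Y * M.d Y, res M.o, M.n, h.pn, h.n1, M.d_o,
    fun X hX => h.inv X fun e => hX (Subtype.ext e), fun X => M.d_st X, fun X => Subtype.ext (M.st_st X), fun X => M.d_dvd X, ?_, ?_, ?_, ?_, ?_, ?_, ?_, ?_, ?_, ?_, ?_, ?_, ?_, ?_, ?_⟩⟩⟩
  · intro c X Z
    obtain ⟨Y, rfl⟩ := hres c
    simp only [hch]
    rw [hsK fun l => (M.N X Z l : ℂ) * M.c Y l, (M.isC Y).2, hK.sum_eq X.2 Z.2]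
  · intro X Z
    rw [M.N_o]
    simp [Subtype.ext_iff]
  · intro c
    obtain ⟨Y, rfl⟩ := hres c
    exact (M.isC Y).1
  · exact fun X => M.c_o X
  · rw [sum_eq_single M.o, M.m_o, M.d_o]
    · intro Y hY hYo
      rw [hm Y _ hYo, zero_mul]
      rw [← hKK, mem_Cen']
      intro V hV
      have := congrFun (congrArg Subtype.val (Finset.mem_filter.1 hY).2) ⟨V, hV⟩
      rw [hch, hch] at this
      exact this.trans (M.c_o V)
    · intro h; simp at h
  · intro c X
    obtain ⟨Y, rfl⟩ := hres c
    exact (M.isC Y).int X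
  · intro c X
    obtain ⟨Y, rfl⟩ := hres c
    exact (M.isC Y).le X
  · intro c X
    obtain ⟨Y, rfl⟩ := hres c
    exact (M.isC Y).conj X
  · exact fun c c' h => Subtype.ext (funext h)
  · intro c c' hc
    obtain ⟨Y, rfl⟩ := hres c
    obtain ⟨Y', rfl⟩ := hres c'
    simp only [hch]
    rw [hsK fun X => M.c Y X * conj (M.c Y' X)]
    refine (M.isC Y).orth (M.isC Y') hK ?_
    by_contra hn
    push Not at hn
    exact hc (Subtype.ext (funext fun X => hn X X.2))
  · intro X
    rw [scr fun c _ => hfib c X, sum_fiberwise, M.s5]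
    by_cases hX : X.1 = M.o
    · simp [hX, M.m_o, Subtype.ext_iff]
    · simp [hX, hm X X.2 hX, Subtype.ext_iff]
  · intro c X
    rw [hfib, sum_div]
    refine IsIntegral.sum _ fun Y _ => ?_
    rw [mul_div_assoc, M.s1]
    exact (isIntegral_natCast (R := ℤ) _).mul ((M.isC X).int Y)
  · intro σ c
    obtain ⟨Y, rfl⟩ := hres c
    obtain ⟨Y', -, -, h⟩ := M.gal σ Y
    exact ⟨res Y', fun X => h X⟩
  · intro σ X
    obtain ⟨X', h1, h2, -⟩ := M.gal σ X
    have h3 : ∀ Y, σ (M.c Y X) = M.c Y X' := fun Y => by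
      rw [c, c, map_div₀, map_natCast, M.s1, h2, M.s1]
    refine ⟨⟨X', ?_⟩, h1, fun c => ?_⟩
    · rw [← hKK, mem_Cen]
      intro V hV
      rw [← h3, mem_Cen.1 (hKK.symm ▸ X.2) V hV, map_natCast, h1]
    · obtain ⟨Y, rfl⟩ := hres c
      exact h3 Y
  · exact fun c X hX => hstar c X fun e => hX (Subtype.ext e)
end Mdl
end

section
open ComplexConjugate
namespace Tab
variable {κ J : Type} [Fintype κ] [DecidableEq κ] [Fintype J] [DecidableEq J] {T : Tab κ J}

lemma col (c : J) : (T.w c : ℂ) * ∑ X, T.ch c X * conj (T.ch c X) = T.n := by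
  have h : ∑ X, (∑ c', (T.w c' : ℂ) * T.ch c' X) * conj (T.ch c X) = T.n := by
    simp only [T.wsum]
    rw [sum_eq_single T.o (fun X _ hX => by simp [hX]) (by simp), T.ch_o]; simp
  rw [← h]
  simp only [sum_mul]
  rw [sum_comm, sum_eq_single c _ (by simp), mul_sum]
  · exact scr fun _ _ => by ring
  · intro c' _ hc
    rw [← mul_zero (T.w c' : ℂ), ← T.orth c' c hc, mul_sum]
    exact scr fun _ _ => by ring

lemma row (X Z : κ) : ∑ c, (T.w c : ℂ) * (T.ch c X * conj (T.ch c Z)) = if X = Z then (T.n : ℂ) else 0 := by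
  simp only [T.cj, T.mul, mul_sum]
  rw [sum_comm]
  have h : ∀ l, ∑ c, (T.w c : ℂ) * ((T.N X (T.st Z) l : ℂ) * T.ch c l) = T.N X (T.st Z) l * if l = T.o then (T.n : ℂ) else 0 := fun l => by
    rw [← T.wsum, mul_sum]; exact scr fun _ _ => by ring
  rw [scr fun l _ => h l, sum_eq_single T.o (fun l _ hl => by simp [hl]) (by simp), T.N_o, T.st_st]
  split_ifs <;> simp_all

lemma nc : (T.n : ℂ) ≠ 0 := by have := T.n1; exact_mod_cast (by omega)

lemma w0 (c : J) : (T.w c : ℂ) ≠ 0 := left_ne_zero_of_mul (T.col c ▸ T.nc)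

def L (T : Tab κ J) (c : J) : ℕ := T.n / T.w c

lemma int' (c X) : IsIntegral ℤ (conj (T.ch c X)) := by rw [T.cj]; exact T.int c _

lemma wL (c : J) : T.w c * T.L c = T.n := by
  refine Nat.mul_div_cancel' (dvd_of_int (by exact_mod_cast T.w0 c) ?_)
  rw [← T.col c, mul_div_cancel_left₀ _ (T.w0 c)]
  exact IsIntegral.sum _ fun X _ => (T.int c X).mul (T.int' c X)

lemma nf (c : J) : ∑ X, T.ch c X * conj (T.ch c X) = T.L c := by
  apply mul_left_cancel₀ (T.w0 c)
  rw [T.col]; exact_mod_cast (T.wL c).symm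

lemma nfr (c : J) : ∑ X, ‖T.ch c X‖ ^ 2 = T.L c := by
  have h := T.nf c
  simp only [Complex.mul_conj'] at h
  exact_mod_cast h

lemma L_j : T.L T.j0 = T.n := by rw [L, T.w_j, Nat.div_one]

lemma L_gal {σ : ℂ ≃+* ℂ} {c c' : J} (h : ∀ X, σ (T.ch c X) = T.ch c' X) : T.L c' = T.L c := by
  have h1 := congrArg σ (T.nf c)
  rw [map_sum, map_natCast] at h1
  have h2 := T.nf c'
  rw [← scr fun X _ => (by rw [T.cj, T.cj, map_mul, h, h] : σ (T.ch c X * conj (T.ch c X)) = T.ch c' X * conj (T.ch c' X)), h1] at h2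
  exact_mod_cast h2.symm

lemma dne (X : κ) : (T.d X : ℂ) ≠ 0 := by
  have := Nat.pos_of_dvd_of_pos (T.d_dvd X) (by have := T.n1; omega)
  exact_mod_cast this.ne'

lemma dposr (X : κ) : (0 : ℝ) < T.d X := by
  have := Nat.pos_of_dvd_of_pos (T.d_dvd X) (by have := T.n1; omega)
  exact_mod_cast this

lemma burn {c : J} {X : κ} (hc : c ≠ T.j0) (hX : X ≠ T.o) (hg : (T.w c).Coprime (T.d X)) : T.ch c X = 0 := by
  by_contra h0
  have hw := T.w0 c
  have hd := T.dne X
  have h1 := int_div (z := T.w c * T.ch c X) (by exact_mod_cast hw) (by exact_mod_cast hd) hg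
    (by rw [mul_div_cancel_left₀ _ hw]; exact T.int c X) (T.wint c X)
  rw [mul_div_mul_left _ _ hw] at h1
  have h2 := norm_one h1 (div_ne_zero h0 hd) fun σ => by
    obtain ⟨c', h⟩ := T.gc σ c
    rw [map_div₀, map_natCast, h, norm_div, Complex.norm_natCast, div_le_one (T.dposr X)]
    exact T.le c' X
  rw [norm_div, Complex.norm_natCast, div_eq_one_iff_eq (T.dposr X).ne'] at h2
  exact hc (T.star c X hX h2)

lemma dsum {c : J} (hc : c ≠ T.j0) : ∑ X, (T.d X : ℂ) * T.ch c X = 0 := by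
  rw [← T.orth c _ hc]
  exact scr fun X _ => by rw [T.ch_j, map_natCast, mul_comm]

lemma dsum' {c : J} (hc : c ≠ T.j0) : 1 + ∑ X ∈ Finset.univ.erase T.o, (T.d X : ℂ) * T.ch c X = 0 := by
  rw [← T.dsum hc, ← Finset.add_sum_erase _ _ (mem_univ T.o), T.d_o, T.ch_o]; simp

lemma not_int {t : ℕ} (ht : 2 ≤ t) {z : ℂ} (hz : IsIntegral ℤ z) (h : 1 + t * z = 0) : False := by
  have h0 : (t : ℂ) ≠ 0 := by exact_mod_cast (by omega)
  have : IsIntegral ℤ (((1 : ℕ) : ℂ) / t) := by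
    have e : ((1 : ℕ) : ℂ) / t = -z := by field_simp; push_cast; linear_combination h
    rw [e]; exact hz.neg
  have := Nat.dvd_one.1 (dvd_of_int (by omega) this)
  omega

lemma typ {c : J} (hc : c ≠ T.j0) : (T.L c).Prime ∧ T.n.primeFactors.card = 3 := by
  have hwL := T.wL c
  have hn := T.n1
  have hs := T.dsum' hc
  have hw2 : 2 ≤ T.w c := by
    by_contra hlt
    have : T.w c ≠ 0 := by exact_mod_cast T.w0 c
    rw [sum_eq_zero] at hs
    · simp at hs
    · intro X hX
      rw [T.burn hc (Finset.ne_of_mem_erase hX) (by rw [show T.w c = 1 by omega]; exact Nat.coprime_one_left _), mul_zero]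
  have hwp : ¬ (T.w c).Prime := fun hp => by
    have h1 : ∑ X ∈ Finset.univ.erase T.o, (T.d X : ℂ) * T.ch c X = T.w c * ∑ X ∈ Finset.univ.erase T.o, ((T.d X / T.w c : ℕ) : ℂ) * T.ch c X := by
      rw [mul_sum]
      refine scr fun X hX => ?_
      by_cases hd : T.w c ∣ T.d X
      · obtain ⟨k, hk⟩ := hd
        rw [hk, Nat.mul_div_cancel_left _ hp.pos]; push_cast; ring
      · rw [T.burn hc (Finset.ne_of_mem_erase hX) ((Nat.Prime.coprime_iff_not_dvd hp).2 hd)]; simp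
    rw [h1] at hs
    exact not_int hw2 (IsIntegral.sum _ fun X _ => (isIntegral_natCast (R := ℤ) _).mul (T.int c X)) hs
  have hL2 : 2 ≤ T.L c := by
    by_contra hlt
    have hL0 : T.L c ≠ 0 := by rintro h; rw [h] at hwL; omega
    have h1 := T.nfr c
    rw [show T.L c = 1 by omega, ← Finset.add_sum_erase _ _ (mem_univ T.o), T.ch_o] at h1
    have h2 : ∑ X ∈ Finset.univ.erase T.o, ‖T.ch c X‖ ^ 2 = 0 := by simpa using h1
    rw [sum_eq_zero_iff_of_nonneg (fun _ _ => by positivity)] at h2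
    rw [sum_eq_zero] at hs
    · simp at hs
    · intro X hX
      have := h2 X hX
      simp at this
      rw [this, mul_zero]
  have := cof_prime (hwL ▸ T.pn) hw2 hwp hL2
  rwa [hwL] at this

lemma vanish {c : J} {X : κ} (hc : c ≠ T.j0) (hX : T.L c ∣ T.d X) : T.ch c X = 0 := by
  by_contra h0
  have hp := (T.typ hc).1
  have hw := T.w0 c
  have hL : (T.L c : ℂ) ≠ 0 := by exact_mod_cast hp.ne_zero
  have hLr : (1 : ℝ) < T.L c := by exact_mod_cast hp.one_lt
  have hco : (T.w c).Coprime (T.L c) := Nat.coprime_of_squarefree_mul (T.wL c ▸ T.pn.1)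
  have h1 := int_div (z := T.w c * T.ch c X) (by exact_mod_cast hw) hp.ne_zero hco
    (by rw [mul_div_cancel_left₀ _ hw]; exact T.int c X) (by
      obtain ⟨k, hk⟩ := hX
      have hd := T.dne X
      have h2 := (T.wint c X).mul (isIntegral_natCast (R := ℤ) k)
      rw [hk] at h2 hd
      push_cast at h2 hd
      rwa [div_mul_eq_mul_div, mul_div_mul_right _ _ (right_ne_zero_of_mul hd)] at h2)
  rw [mul_div_mul_left _ _ hw] at h1
  have hb : ∀ c', T.L c' = T.L c → ‖T.ch c' X‖ ^ 2 ≤ T.L c := fun c' h => by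
    rw [← h, ← T.nfr c']
    exact single_le_sum (f := fun X => ‖T.ch c' X‖ ^ 2) (fun _ _ => by positivity) (mem_univ X)
  have h2 := norm_one h1 (div_ne_zero h0 hL) fun σ => by
    obtain ⟨c', h⟩ := T.gc σ c
    rw [map_div₀, map_natCast, h, norm_div, Complex.norm_natCast, div_le_one (by positivity)]
    nlinarith [hb c' (T.L_gal h), norm_nonneg (T.ch c' X)]
  rw [norm_div, Complex.norm_natCast, div_eq_one_iff_eq (by positivity)] at h2
  have := hb c rfl
  rw [h2] at this
  nlinarith

lemma card3 : T.n.primeFactors.card = 3 := by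
  by_cases h : ∃ c, c ≠ T.j0
  · exact (T.typ h.choose_spec).2
  · exfalso
    push Not at h
    have h1 := T.wsum T.o
    rw [sum_eq_single T.j0 (fun c _ hc => absurd (h c) hc) (by simp), T.w_j, T.ch_o, if_pos rfl] at h1
    have : (1 : ℕ) = T.n := by rw [Nat.cast_one, mul_one] at h1; exact_mod_cast h1
    have := T.n1; omega

lemma not_prime : ¬ T.n.Prime := fun h => by
  have := T.card3
  rw [h.primeFactors] at this; simp at this

def Ty (T : Tab κ J) (l : ℕ) : Finset J := Finset.univ.filter fun c => T.L c = l

lemma mem_Ty {l c} : c ∈ T.Ty l ↔ T.L c = l := by simp [Ty]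

lemma Ty_ne {l c} (hl : l.Prime) (h : c ∈ T.Ty l) : c ≠ T.j0 := by
  rintro rfl
  rw [mem_Ty, L_j] at h
  exact T.not_prime (h ▸ hl)

lemma tsum (g : J → ℂ) : ∑ c, (T.w c : ℂ) * g c = g T.j0 + ∑ l ∈ T.n.primeFactors, ((T.n / l : ℕ) : ℂ) * ∑ c ∈ T.Ty l, g c := by
  rw [← Finset.add_sum_erase _ _ (mem_univ T.j0), T.w_j, Nat.cast_one, one_mul]
  congr 1
  have hn : T.n ≠ 0 := by have := T.n1; omega
  rw [← sum_fiberwise_of_maps_to (s := Finset.univ.erase T.j0) (t := T.n.primeFactors) (g := T.L)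
    (fun c hc => Nat.mem_primeFactors.2 ⟨(T.typ (Finset.ne_of_mem_erase hc)).1, Dvd.intro_left _ (T.wL c), hn⟩)]
  refine scr fun l hl => ?_
  have hp := Nat.prime_of_mem_primeFactors hl
  rw [mul_sum]
  have e : (Finset.univ.erase T.j0).filter (fun c => T.L c = l) = T.Ty l := by
    ext c
    simp only [mem_filter, mem_erase, mem_univ, and_true, mem_Ty, and_iff_right_iff_imp]
    exact fun h => T.Ty_ne hp (mem_Ty.2 h)
  rw [e]
  refine scr fun c hc => ?_
  rw [← T.wL c, mem_Ty.1 hc, Nat.mul_div_cancel _ hp.pos]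

end Tab
end

section
open ComplexConjugate
namespace Tab
variable {κ J : Type} [Fintype κ] [DecidableEq κ] [Fintype J] [DecidableEq J] {T : Tab κ J}

lemma B_int (l : ℕ) (X : κ) : ∃ k : ℤ, ∑ c ∈ T.Ty l, T.ch c X = k := by
  refine int_of_fix (IsIntegral.sum _ fun c _ => T.int c X) fun σ => ?_
  choose g hg using T.gc σ
  have hi : Function.Injective g := fun c c' h => T.inj c c' fun X => σ.injective (by rw [hg, hg, h])
  rw [map_sum]
  refine sum_equiv (Equiv.ofBijective g (Finite.injective_iff_bijective.1 hi)) (fun c => ?_) (fun c _ => hg c X)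
  rw [mem_Ty, mem_Ty, Equiv.ofBijective_apply, T.L_gal (hg c)]

lemma cop {l : ℕ} (hl : l ∈ T.n.primeFactors) : (T.n / l).Coprime l := by
  have := Nat.div_mul_cancel (Nat.dvd_of_mem_primeFactors hl)
  exact Nat.coprime_of_squarefree_mul (this.symm ▸ T.pn.1)

lemma cong0 {l : ℕ} (hl : l ∈ T.n.primeFactors) {X : κ} {b : ℤ} (hb : ∑ c ∈ T.Ty l, T.ch c X = b) :
    (l : ℤ) ∣ ((T.n / l : ℕ) : ℤ) * b + T.d X := by
  choose B hB using fun l => T.B_int l X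
  have h := T.wsum X
  rw [T.tsum, T.ch_j] at h
  simp only [hB] at h
  have h1 : (T.d X : ℤ) + ∑ l' ∈ T.n.primeFactors, ((T.n / l' : ℕ) : ℤ) * B l' = if X = T.o then (T.n : ℤ) else 0 := by
    apply Int.cast_injective (α := ℂ)
    split_ifs at h ⊢ <;> (push_cast; exact h)
  have hbl : B l = b := by rw [hB] at hb; exact_mod_cast hb
  rw [← Finset.add_sum_erase _ _ hl, hbl] at h1
  have h2 : (l : ℤ) ∣ ∑ l' ∈ T.n.primeFactors.erase l, ((T.n / l' : ℕ) : ℤ) * B l' := by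
    refine Finset.dvd_sum fun l' hl' => Dvd.dvd.mul_right (Int.natCast_dvd_natCast.2 ?_) _
    have hm := mem_of_mem_erase hl'
    have h3 : l ∣ T.n / l' * l' := by
      rw [Nat.div_mul_cancel (Nat.dvd_of_mem_primeFactors hm)]; exact Nat.dvd_of_mem_primeFactors hl
    refine Nat.Coprime.dvd_of_dvd_mul_right ?_ h3
    exact (Nat.coprime_primes (Nat.prime_of_mem_primeFactors hl) (Nat.prime_of_mem_primeFactors hm)).2 (Finset.ne_of_mem_erase hl').symm
  have h3 : (l : ℤ) ∣ if X = T.o then (T.n : ℤ) else 0 := by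
    split_ifs
    · exact Int.natCast_dvd_natCast.2 (Nat.dvd_of_mem_primeFactors hl)
    · simp
  obtain ⟨u, hu⟩ := h3.sub h2
  exact ⟨u, by linear_combination h1 + hu⟩

def Sp (T : Tab κ J) : Submodule ℤ (J → ℂ) := Submodule.span ℤ (Set.range fun X c => T.ch c X)

lemma Sp_ch (X : κ) : (fun c => T.ch c X) ∈ T.Sp := Submodule.subset_span ⟨X, rfl⟩
lemma Sp_cj (X : κ) : (fun c => conj (T.ch c X)) ∈ T.Sp := by simp only [T.cj]; exact T.Sp_ch _
lemma Sp_one : (1 : J → ℂ) ∈ T.Sp := by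
  convert T.Sp_ch T.o using 1
  funext c; rw [T.ch_o]; rfl

lemma Sp_mul {f g : J → ℂ} (hf : f ∈ T.Sp) (hg : g ∈ T.Sp) : f * g ∈ T.Sp := by
  have h := Submodule.mul_mem_mul hf hg
  rw [Sp, Submodule.span_mul_span] at h
  refine (Submodule.span_le.2 ?_) h
  rintro _ ⟨_, ⟨X, rfl⟩, _, ⟨Z, rfl⟩, rfl⟩
  have e : (fun c => T.ch c X) * (fun c => T.ch c Z) = ∑ l, (T.N X Z l : ℤ) • fun c => T.ch c l := by
    funext c
    simp [T.mul]
  show (fun c => T.ch c X) * (fun c => T.ch c Z) ∈ T.Sp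
  rw [e]
  exact Submodule.sum_mem _ fun l _ => Submodule.smul_mem _ _ (T.Sp_ch l)

lemma sum_o (l : ℕ) : ∑ c ∈ T.Ty l, T.ch c T.o = (((T.Ty l).card : ℤ) : ℂ) := by simp [T.ch_o]

lemma cong {l : ℕ} (hl : l ∈ T.n.primeFactors) {g : J → ℂ} (hg : g ∈ T.Sp) :
    ∃ z k : ℤ, g T.j0 = z ∧ ∑ c ∈ T.Ty l, g c = ((((T.Ty l).card : ℤ) * z + l * k : ℤ) : ℂ) := by
  induction hg using Submodule.span_induction with
  | mem g hg =>
    obtain ⟨X, rfl⟩ := hg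
    obtain ⟨b, hb⟩ := T.B_int l X
    have h1 := T.cong0 hl hb
    have h2 := T.cong0 hl (T.sum_o l)
    have h3 : (l : ℤ) ∣ ((T.n / l : ℕ) : ℤ) * (b - (T.Ty l).card * T.d X) := by
      obtain ⟨u, hu⟩ := h1.sub (h2.mul_right (T.d X : ℤ))
      rw [T.d_o] at hu
      push_cast at hu
      exact ⟨u, by push_cast; linear_combination hu⟩
    obtain ⟨k, hk⟩ := (Nat.isCoprime_iff_coprime.2 (T.cop hl).symm).dvd_of_dvd_mul_left h3
    exact ⟨T.d X, k, by simp [T.ch_j], by rw [hb, ← hk]; congr 1; ring⟩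
  | zero => exact ⟨0, 0, by simp, by simp⟩
  | add f g _ _ h1 h2 =>
    obtain ⟨z, k, h3, h4⟩ := h1
    obtain ⟨z', k', h5, h6⟩ := h2
    refine ⟨z + z', k + k', by simp [h3, h5], ?_⟩
    simp only [Pi.add_apply, sum_add_distrib]
    rw [h4, h6]; push_cast; ring
  | smul a f _ h1 =>
    obtain ⟨z, k, h3, h4⟩ := h1
    refine ⟨a * z, a * k, by simp [h3], ?_⟩
    simp only [Pi.smul_apply, ← Finset.smul_sum]
    rw [h4, zsmul_eq_mul]; push_cast; ring

lemma a_sum : ∑ l ∈ T.n.primeFactors, T.n / l * (T.Ty l).card + 1 = T.n := by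
  have h := T.wsum T.o
  rw [T.tsum, T.ch_o, if_pos rfl] at h
  simp only [T.ch_o, sum_const, nsmul_eq_mul, mul_one] at h
  rw [add_comm] at h
  exact_mod_cast h

def A (T : Tab κ J) (l : ℕ) (X Z : κ) : ℂ := ∑ c ∈ T.Ty l, T.ch c X * conj (T.ch c Z)

lemma A_cong {l : ℕ} (hl : l ∈ T.n.primeFactors) (X Z : κ) : ∃ k : ℤ, T.A l X Z = (((T.Ty l).card * (T.d X * T.d Z) + l * k : ℤ) : ℂ) := by
  obtain ⟨z, k, h1, h2⟩ := T.cong hl (T.Sp_mul (T.Sp_ch X) (T.Sp_cj Z))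
  refine ⟨k, ?_⟩
  have : z = T.d X * T.d Z := by
    simp [T.ch_j] at h1
    exact_mod_cast h1.symm
  rw [← this]; exact h2

lemma A_sum (X Z : κ) : (T.d X * T.d Z : ℂ) + ∑ l ∈ T.n.primeFactors, ((T.n / l : ℕ) : ℂ) * T.A l X Z = if X = Z then (T.n : ℂ) else 0 := by
  rw [← T.row, T.tsum, T.ch_j, T.ch_j, map_natCast]; rfl

lemma A_re (l X) : T.A l X X = ((∑ c ∈ T.Ty l, ‖T.ch c X‖ ^ 2 : ℝ) : ℂ) := by
  simp [A, Complex.mul_conj']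

lemma A_lt {l : ℕ} (hl : l ∈ T.n.primeFactors) (X : κ) : ∑ c ∈ T.Ty l, ‖T.ch c X‖ ^ 2 < l := by
  have h := T.A_sum X X
  rw [if_pos rfl] at h
  simp only [A_re] at h
  have h1 : (T.d X * T.d X : ℝ) + ∑ l ∈ T.n.primeFactors, ((T.n / l : ℕ) : ℝ) * ∑ c ∈ T.Ty l, ‖T.ch c X‖ ^ 2 = T.n := by exact_mod_cast h
  have h2 := single_le_sum (f := fun l => ((T.n / l : ℕ) : ℝ) * ∑ c ∈ T.Ty l, ‖T.ch c X‖ ^ 2) (fun l _ => by positivity) hl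
  have h3 : (((T.n / l : ℕ) : ℝ)) * l = T.n := by exact_mod_cast Nat.div_mul_cancel (Nat.dvd_of_mem_primeFactors hl)
  have h4 := T.dposr X
  have h5 : 0 < ((T.n / l : ℕ) : ℝ) := by
    have := T.n1
    exact_mod_cast Nat.div_pos (Nat.le_of_mem_primeFactors hl) (Nat.pos_of_mem_primeFactors hl)
  have h6 : ((T.n / l : ℕ) : ℝ) * ∑ c ∈ T.Ty l, ‖T.ch c X‖ ^ 2 < (T.n / l : ℕ) * l := by
    rw [h3]; nlinarith
  exact lt_of_mul_lt_mul_left h6 h5.le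

lemma a_lt {l : ℕ} (hl : l ∈ T.n.primeFactors) : (T.Ty l).card < l := by
  have := T.A_lt hl T.o
  simp [T.ch_o] at this
  exact this

lemma A_deg {l : ℕ} (hl : l ∈ T.n.primeFactors) {X Y : κ} (h : T.d X = T.d Y) : T.A l X X = T.A l Y Y := by
  obtain ⟨k, hk⟩ := T.A_cong hl X X
  obtain ⟨k', hk'⟩ := T.A_cong hl Y Y
  rw [h] at hk
  have hp : (0 : ℤ) < l := by exact_mod_cast Nat.pos_of_mem_primeFactors hl
  have b : ∀ {X : κ} {z : ℤ}, T.A l X X = z → 0 ≤ z ∧ z < l := fun {X z} hz => by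
    rw [A_re] at hz
    have e : ∑ c ∈ T.Ty l, ‖T.ch c X‖ ^ 2 = (z : ℝ) := by exact_mod_cast hz
    have := T.A_lt hl X
    have h0 : 0 ≤ ∑ c ∈ T.Ty l, ‖T.ch c X‖ ^ 2 := by positivity
    rw [e] at this h0
    exact ⟨by exact_mod_cast h0, by exact_mod_cast this⟩
  have b1 := b hk
  have b2 := b hk'
  rw [hk, hk']
  congr 1
  have e : ((T.Ty l).card * (T.d Y * T.d Y) + l * k : ℤ) % l = ((T.Ty l).card * (T.d Y * T.d Y) + l * k' : ℤ) % l := by simp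
  rwa [Int.emod_eq_of_lt b1.1 b1.2, Int.emod_eq_of_lt b2.1 b2.2] at e

def Agr (T : Tab κ J) (l : ℕ) (X Y : κ) : Prop := ∀ c ∈ T.Ty l, T.ch c X = T.ch c Y

lemma ex_t {X Y : κ} (hd : T.d X = T.d Y) (hne : X ≠ Y) : ∃ l0 ∈ T.n.primeFactors, ¬ T.Agr l0 X Y ∧ T.A l0 X X - T.A l0 X Y = l0 ∧
    ∀ l ∈ T.n.primeFactors, l ≠ l0 → T.Agr l X Y := by
  have h1 : ∀ l, ∃ t : ℤ, l ∈ T.n.primeFactors → T.A l X X - T.A l X Y = l * t ∧ 0 ≤ t ∧ (T.Agr l X Y ↔ t = 0) := fun l => by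
    by_cases hl : l ∈ T.n.primeFactors
    swap
    · exact ⟨0, fun h => absurd h hl⟩
    obtain ⟨k, hk⟩ := T.A_cong hl X X
    obtain ⟨k', hk'⟩ := T.A_cong hl X Y
    have e : T.A l X X - T.A l X Y = l * (k - k' : ℤ) := by
      rw [hk, hk', hd]; push_cast; ring
    have hr : T.A l Y X = T.A l X Y := by
      have : conj (T.A l X Y) = T.A l Y X := by
        simp only [A, map_sum, map_mul, Complex.conj_conj]
        exact scr fun _ _ => mul_comm _ _
      rw [← this, hk', map_intCast]
    have e2 : ((∑ c ∈ T.Ty l, ‖T.ch c X - T.ch c Y‖ ^ 2 : ℝ) : ℂ) = ((2 * (l * (k - k' : ℤ)) : ℝ) : ℂ) := by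
      push_cast
      simp only [← Complex.mul_conj', map_sub]
      have : ∑ c ∈ T.Ty l, (T.ch c X - T.ch c Y) * (conj (T.ch c X) - conj (T.ch c Y)) = T.A l X X - T.A l X Y - T.A l Y X + T.A l Y Y := by
        simp only [A, ← sum_sub_distrib, ← sum_add_distrib]
        exact scr fun _ _ => by ring
      rw [this, hr, ← T.A_deg hl hd]
      push_cast at e
      linear_combination 2 * e
    have e3 : ∑ c ∈ T.Ty l, ‖T.ch c X - T.ch c Y‖ ^ 2 = 2 * (l * (k - k' : ℤ) : ℝ) := by exact_mod_cast e2
    have hp : (0 : ℝ) < l := by exact_mod_cast Nat.pos_of_mem_primeFactors hl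
    have h0 : 0 ≤ ∑ c ∈ T.Ty l, ‖T.ch c X - T.ch c Y‖ ^ 2 := by positivity
    refine ⟨k - k', fun _ => ⟨e, ?_, ?_⟩⟩
    · rw [e3] at h0
      have : (0 : ℝ) ≤ (k - k' : ℤ) := by
        by_contra hc
        push Not at hc
        nlinarith
      exact_mod_cast this
    · have : T.Agr l X Y ↔ ∑ c ∈ T.Ty l, ‖T.ch c X - T.ch c Y‖ ^ 2 = 0 := by
        rw [sum_eq_zero_iff_of_nonneg (fun _ _ => by positivity)]
        exact forall₂_congr fun c _ => by simp [sub_eq_zero]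
      rw [this, e3]
      simp only [mul_eq_zero, hp.ne', OfNat.ofNat_ne_zero, false_or]
      exact_mod_cast Iff.rfl
  choose t ht using h1
  have hs : ∑ l ∈ T.n.primeFactors, t l = 1 := by
    have h2 := T.A_sum X X
    have h3 := T.A_sum X Y
    rw [if_pos rfl] at h2
    rw [if_neg hne, ← hd] at h3
    have h4 : ∑ l ∈ T.n.primeFactors, ((T.n / l : ℕ) : ℂ) * (T.A l X X - T.A l X Y) = T.n := by
      simp only [mul_sub, sum_sub_distrib]
      linear_combination h2 - h3
    have h5 : (T.n : ℂ) * ∑ l ∈ T.n.primeFactors, (t l : ℂ) = T.n * 1 := by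
      rw [mul_one, ← h4, mul_sum, h4, ← h4]
      refine scr fun l hl => ?_
      rw [(ht l hl).1, h4, ← mul_assoc]
      congr 1
      exact_mod_cast (Nat.div_mul_cancel (Nat.dvd_of_mem_primeFactors hl)).symm
    exact_mod_cast mul_left_cancel₀ T.nc h5
  obtain ⟨l0, hl0, h0⟩ : ∃ l0 ∈ T.n.primeFactors, t l0 ≠ 0 := by
    by_contra hc
    push Not at hc
    rw [sum_eq_zero hc] at hs
    exact zero_ne_one hs
  have hge := (ht l0 hl0).2.1
  rw [← Finset.add_sum_erase _ _ hl0] at hs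
  have hnn : ∀ l ∈ T.n.primeFactors.erase l0, 0 ≤ t l := fun l hl => (ht l (mem_of_mem_erase hl)).2.1
  have hr := sum_nonneg hnn
  have h1 : t l0 = 1 := by omega
  have h2 : ∑ l ∈ T.n.primeFactors.erase l0, t l = 0 := by omega
  rw [sum_eq_zero_iff_of_nonneg hnn] at h2
  refine ⟨l0, hl0, by rw [(ht l0 hl0).2.2]; exact h0, by rw [(ht l0 hl0).1, h1]; simp, fun l hl hne => ?_⟩
  rw [(ht l hl).2.2]
  exact h2 l (Finset.mem_erase.2 ⟨hne, hl⟩)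
end Tab
end

section
open ComplexConjugate
namespace Tab
variable {κ J : Type} [Fintype κ] [DecidableEq κ] [Fintype J] [DecidableEq J] {T : Tab κ J}

lemma odd : ¬ 2 ∣ T.n := fun h2 => by
  have hl : 2 ∈ T.n.primeFactors := Nat.mem_primeFactors.2 ⟨Nat.prime_two, h2, by have := T.n1; omega⟩
  have ha := T.a_lt hl
  have h1 := T.cong0 hl (T.sum_o 2)
  rw [T.d_o] at h1
  have ha1 : (T.Ty 2).card = 1 := by
    by_contra hne
    rw [show (T.Ty 2).card = 0 by omega] at h1
    norm_num at h1
  obtain ⟨c, hc⟩ := Finset.card_eq_one.1 ha1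
  have hcT : c ∈ T.Ty 2 := by rw [hc]; simp
  have hcj := T.Ty_ne Nat.prime_two hcT
  have hv : ∀ X, ∃ v : ℤ, T.ch c X = v := fun X => by
    obtain ⟨k, hk⟩ := T.B_int 2 X
    rw [hc, sum_singleton] at hk
    exact ⟨k, hk⟩
  choose v hv using hv
  have h3 := T.nf c
  have h4 := T.dsum' hcj
  simp only [hv, map_intCast] at h3 h4
  rw [mem_Ty.1 hcT] at h3
  have h5 : ∑ X, v X * v X = 2 := by exact_mod_cast h3
  have h6 : 1 + ∑ X ∈ Finset.univ.erase T.o, (T.d X : ℤ) * v X = 0 := by exact_mod_cast h4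
  have hvo : v T.o = 1 := by have := hv T.o; rw [T.ch_o] at this; exact_mod_cast this.symm
  rw [← Finset.add_sum_erase _ _ (mem_univ T.o), hvo] at h5
  obtain ⟨X, hX, hX0⟩ : ∃ X ∈ Finset.univ.erase T.o, v X ≠ 0 := by
    by_contra hn
    push Not at hn
    rw [sum_eq_zero fun X hX => by rw [hn X hX, mul_zero]] at h6
    omega
  rw [← Finset.add_sum_erase _ _ hX] at h5 h6
  have h7 : 0 < v X * v X := mul_self_pos.2 hX0
  have hnn : ∀ Y ∈ (Finset.univ.erase T.o).erase X, 0 ≤ v Y * v Y := fun Y _ => mul_self_nonneg _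
  have h8 := sum_nonneg hnn
  have h9 : ∑ Y ∈ (Finset.univ.erase T.o).erase X, v Y * v Y = 0 := by omega
  rw [sum_eq_zero_iff_of_nonneg hnn] at h9
  rw [sum_eq_zero fun Y hY => by rw [mul_self_eq_zero.1 (h9 Y hY), mul_zero]] at h6
  have hd := T.d_two X (Finset.ne_of_mem_erase hX)
  rcases mul_self_eq_one_iff.1 (by omega : v X * v X = 1) with h | h <;> rw [h] at h6 <;> omega

lemma sqs (s : Finset κ) {f : κ → ℂ} (hf : ∀ X, IsIntegral ℤ (f X)) : ∃ b, IsIntegral ℤ b ∧ (∑ X ∈ s, f X) ^ 2 = ∑ X ∈ s, f X ^ 2 + 2 * b := by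
  induction s using Finset.induction_on with
  | empty => exact ⟨0, isIntegral_zero, by simp⟩
  | insert a s ha ih =>
    obtain ⟨b, hb, h⟩ := ih
    refine ⟨b + f a * ∑ X ∈ s, f X, hb.add ((hf a).mul (IsIntegral.sum _ fun X _ => hf X)), ?_⟩
    rw [sum_insert ha, sum_insert ha]
    linear_combination h

lemma nonreal {c : J} (hc : c ≠ T.j0) : ∃ X, conj (T.ch c X) ≠ T.ch c X := by
  by_contra hr
  push Not at hr
  have hodd := T.odd
  obtain ⟨b, hb, h⟩ := sqs univ (T.int c)
  have h1 := T.nf c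
  simp only [hr, ← sq] at h1
  have h2 := T.dsum hc
  have h3 : ∀ X, (T.d X : ℂ) = 1 + 2 * ((T.d X / 2 : ℕ) : ℂ) := fun X => by
    have : ¬ 2 ∣ T.d X := fun h => hodd (h.trans (T.d_dvd X))
    have : T.d X = 1 + 2 * (T.d X / 2) := by omega
    exact_mod_cast this
  have h4 : ∑ X, T.ch c X = - (2 * ∑ X, ((T.d X / 2 : ℕ) : ℂ) * T.ch c X) := by
    rw [mul_sum, eq_neg_iff_add_eq_zero, ← sum_add_distrib, ← h2]
    exact scr fun X _ => by linear_combination (- T.ch c X) * h3 X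
  have hi : IsIntegral ℤ (∑ X, ((T.d X / 2 : ℕ) : ℂ) * T.ch c X) := IsIntegral.sum _ fun X _ => (isIntegral_natCast (R := ℤ) _).mul (T.int c X)
  rw [h4, h1] at h
  have e : (T.L c : ℂ) / (2 : ℕ) = (∑ X, ((T.d X / 2 : ℕ) : ℂ) * T.ch c X) ^ 2 + (∑ X, ((T.d X / 2 : ℕ) : ℂ) * T.ch c X) ^ 2 - b := by
    push_cast; linear_combination (-1 / 2 : ℂ) * h
  exact hodd ((dvd_of_int two_ne_zero (e ▸ ((hi.pow 2).add (hi.pow 2)).sub hb)).trans (Dvd.intro_left _ (T.wL c)))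

lemma sq0 {c : J} (hc : c ≠ T.j0) : ∑ X, T.ch c X * T.ch c X = 0 := by
  obtain ⟨c', h⟩ := T.gc Complex.conjAe.toRingEquiv c
  have h' : ∀ X, conj (T.ch c X) = T.ch c' X := h
  rw [← T.orth c c' ?_]
  · exact scr fun X _ => by rw [← h', Complex.conj_conj]
  · rintro rfl
    obtain ⟨X, hX⟩ := T.nonreal hc
    exact hX (h' X)

lemma cj_st (c X) : conj (T.ch c (T.st X)) = T.ch c X := by rw [T.cj, T.st_st]

lemma st_o : T.st T.o = T.o := by
  by_contra h
  have := T.d_two _ h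
  rw [T.d_st, T.d_o] at this; omega

lemma sd {X : κ} (hX : X ≠ T.o) : X ≠ T.st X := by
  intro hst
  have h1 : ∑ X, ∑ c, (T.w c : ℂ) * (T.ch c X * conj (T.ch c (T.st X))) = T.n := by
    simp only [cj_st]
    rw [sum_comm, sum_eq_single T.j0, T.w_j]
    · rw [← L_j, ← T.nf]
      exact scr fun X _ => by simp [T.ch_j]
    · intro c _ hc
      rw [← mul_sum, T.sq0 hc, mul_zero]
    · simp
  simp only [row] at h1
  rw [← sum_filter, sum_const, nsmul_eq_mul] at h1
  have h2 : (Finset.univ.filter fun X => X = T.st X).card = 1 := by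
    have := mul_right_cancel₀ T.nc (h1.trans (one_mul _).symm)
    exact_mod_cast this
  exact hX (Finset.card_le_one.1 h2.le X (by simpa using hst) T.o (by simpa using T.st_o.symm))

open Classical in
def Own (T : Tab κ J) (l : ℕ) : Finset κ := Finset.univ.filter fun X => X ≠ T.o ∧ ¬ T.Agr l X (T.st X)

lemma own_card {l : ℕ} (hl : l ∈ T.n.primeFactors) : (T.Own l).card = (T.Ty l).card := by
  classical
  have hp := Nat.prime_of_mem_primeFactors hl
  have h1 : ∑ X, (T.A l X X - T.A l X (T.st X)) = l * (T.Ty l).card := by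
    simp only [A, ← sum_sub_distrib, cj_st]
    rw [sum_comm, sum_congr rfl (g := fun _ => (l : ℂ)), sum_const, nsmul_eq_mul, mul_comm]
    intro c hc
    rw [sum_sub_distrib, T.nf, T.sq0 (T.Ty_ne hp hc), mem_Ty.1 hc, sub_zero]
  have h2 : ∀ X, T.A l X X - T.A l X (T.st X) = if X ∈ T.Own l then (l : ℂ) else 0 := fun X => by
    simp only [Own, mem_filter, mem_univ, true_and]
    have hz : T.Agr l X (T.st X) → T.A l X X - T.A l X (T.st X) = 0 := fun h => by
      rw [sub_eq_zero]
      exact scr fun c hc => by rw [h c hc]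
    by_cases hX : X = T.o
    · rw [if_neg (by simp [hX]), hX, T.st_o, sub_self]
    · obtain ⟨l0, h0, h1, h2, h3⟩ := T.ex_t (T.d_st X).symm (T.sd hX)
      by_cases h : l = l0
      · subst h
        rw [if_pos ⟨hX, h1⟩, h2]
      · have := h3 l hl h
        rw [if_neg (by simp [this]), hz this]
  simp only [h2] at h1
  rw [sum_ite_mem, univ_inter, sum_const, nsmul_eq_mul, mul_comm] at h1
  exact_mod_cast mul_left_cancel₀ (by exact_mod_cast hp.ne_zero) h1

lemma bess {l : ℕ} (hp : l.Prime) : ∑ Y, ‖∑ c ∈ T.Ty l, T.ch c Y‖ ^ 2 = l * (T.Ty l).card := by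
  have h : ((∑ Y, ‖∑ c ∈ T.Ty l, T.ch c Y‖ ^ 2 : ℝ) : ℂ) = l * (T.Ty l).card := by
    push_cast
    simp only [← Complex.mul_conj', map_sum, sum_mul_sum]
    rw [sum_comm, sum_congr rfl (g := fun _ => (l : ℂ)), sum_const, nsmul_eq_mul, mul_comm]
    intro c hc
    rw [sum_comm, sum_eq_single_of_mem c hc (fun c' _ hc' => T.orth c c' hc'.symm), T.nf, mem_Ty.1 hc]
  exact_mod_cast h

lemma three {X : κ} (hX : X ≠ T.o) {f : κ → ℝ} (hf : ∀ X, 0 ≤ f X) : f T.o + (f X + f (T.st X)) ≤ ∑ Y, f Y := by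
  have h1 : T.st X ≠ T.o := fun h => hX (by rw [← T.st_st X, h, T.st_o])
  have := sum_le_sum_of_subset_of_nonneg (Finset.subset_univ {T.o, X, T.st X}) (f := f) (fun _ _ _ => hf _)
  rwa [sum_insert (by simp [hX.symm, h1.symm]), sum_pair (T.sd hX)] at this

lemma agr_all {l : ℕ} (hl : l ∈ T.n.primeFactors) {X Y : κ} (hX : X ≠ T.o) (ha : T.Agr l X (T.st X)) (hd : T.d X = T.d Y) : T.Agr l X Y := by
  by_contra hn
  have hne : X ≠ Y := by rintro rfl; exact hn fun _ _ => rfl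
  obtain ⟨l1, -, -, -, h1⟩ := T.ex_t hd hne
  have e : l = l1 := by by_contra h; exact hn (h1 l hl h)
  subst e
  have hz : ∀ c, (T.ch c X - T.ch c Y) * (conj (T.ch c X) - conj (T.ch c (T.st X))) = 0 := fun c => by
    by_cases hc : c = T.j0
    · rw [hc, T.ch_j, T.ch_j, hd, sub_self, zero_mul]
    · by_cases h : T.L c = l
      · rw [ha c (mem_Ty.2 h), sub_self, mul_zero]
      · have := h1 (T.L c) (Nat.mem_primeFactors.2 ⟨(T.typ hc).1, Dvd.intro_left _ (T.wL c), by have := T.n1; omega⟩) h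
        rw [this c (mem_Ty.2 rfl), sub_self, zero_mul]
  have h2 : ∑ c, (T.w c : ℂ) * ((T.ch c X - T.ch c Y) * (conj (T.ch c X) - conj (T.ch c (T.st X)))) = 0 := by simp [hz]
  have h3 : ∑ c, (T.w c : ℂ) * ((T.ch c X - T.ch c Y) * (conj (T.ch c X) - conj (T.ch c (T.st X)))) =
      ∑ c, (T.w c : ℂ) * (T.ch c X * conj (T.ch c X)) - ∑ c, (T.w c : ℂ) * (T.ch c X * conj (T.ch c (T.st X)))
      - ∑ c, (T.w c : ℂ) * (T.ch c Y * conj (T.ch c X)) + ∑ c, (T.w c : ℂ) * (T.ch c Y * conj (T.ch c (T.st X))) := by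
    simp only [← sum_sub_distrib, ← sum_add_distrib]
    exact scr fun _ _ => by ring
  rw [h2, row, row, row, row, if_pos rfl, if_neg (T.sd hX), if_neg hne.symm] at h3
  have := T.nc
  split_ifs at h3
  · apply this; linear_combination (-1 / 2 : ℂ) * h3
  · apply this; linear_combination - h3

lemma caseA {l : ℕ} (hl : l ∈ T.n.primeFactors) {X : κ} (hX : X ≠ T.o) (hd : ¬ l ∣ T.d X) (ha : T.Agr l X (T.st X)) : 3 * (T.Ty l).card ≤ l := by
  have hp := Nat.prime_of_mem_primeFactors hl
  have hv : ∀ c, ∃ v : ℤ, c ∈ T.Ty l → T.ch c X = v := fun c => by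
    by_cases hc : c ∈ T.Ty l
    · obtain ⟨v, hv⟩ := int_of_fix (T.int c X) fun σ => by
        obtain ⟨X', h1, h2⟩ := T.gr σ X
        rw [h2, ← T.agr_all hl hX ha h1.symm c hc]
      exact ⟨v, fun _ => hv⟩
    · exact ⟨0, fun h => absurd h hc⟩
  choose v hv using hv
  have hv' : ∀ c ∈ T.Ty l, T.ch c (T.st X) = v c := fun c hc => by rw [← ha c hc, hv c hc]
  have hb : ∀ c ∈ T.Ty l, 1 + 2 * v c ^ 2 ≤ l := fun c hc => by
    have := T.three hX (f := fun Y => ‖T.ch c Y‖ ^ 2) fun _ => by positivity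
    rw [T.nfr, mem_Ty.1 hc, T.ch_o, hv c hc, hv' c hc, NormOneClass.norm_one, Complex.norm_intCast, sq_abs] at this
    have : (1 + 2 * v c ^ 2 : ℝ) ≤ l := by linarith
    exact_mod_cast this
  have heq : ∀ c ∈ T.Ty l, ∀ c' ∈ T.Ty l, (l : ℤ) ∣ v c - v c' → v c = v c' := fun c hc c' hc' h => by
    have h1 := hb c hc
    have h2 := hb c' hc'
    refine sub_eq_zero.1 (Int.eq_zero_of_abs_lt_dvd h (abs_lt_of_sq_lt_sq ?_ (by positivity)))
    nlinarith [sq_nonneg (v c + v c'), sq_nonneg ((l : ℤ) - 1)]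
  have hcg : ∀ c1 ∈ T.Ty l, (l : ℤ) ∣ v c1 - T.d X := fun c1 hc1 => by
    by_contra hnd
    set U := (insert (T.d X : ℤ) ((T.Ty l).image v)).erase (v c1) with hU
    set φ : J → ℂ := ∏ u ∈ U, fun c => T.ch c X - u with hφ
    have hφS : φ ∈ T.Sp := by
      refine Finset.prod_induction _ (· ∈ T.Sp) (fun _ _ => Sp_mul) Sp_one fun u _ => ?_
      have := Submodule.sub_mem _ (T.Sp_ch X) (Submodule.smul_mem _ u T.Sp_one)
      convert this using 1
      funext c; simp
    have hφc : ∀ c, φ c = ∏ u ∈ U, (T.ch c X - u) := fun c => by rw [hφ, Finset.prod_apply]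
    obtain ⟨z, k, h1, h2⟩ := T.cong hl hφS
    have hz : φ T.j0 = 0 := by
      rw [hφc]
      refine Finset.prod_eq_zero (i := (T.d X : ℤ)) ?_ (by simp [T.ch_j])
      rw [hU, mem_erase]
      refine ⟨fun e => hnd (by simp [e]), mem_insert_self _ _⟩
    rw [hz] at h1
    have hz0 : z = 0 := by exact_mod_cast h1.symm
    have h3 : ∀ c ∈ T.Ty l, φ c = if v c = v c1 then ((∏ u ∈ U, (v c1 - u) : ℤ) : ℂ) else 0 := fun c hc => by
      rw [hφc]
      split_ifs with h
      · rw [hv c hc, h]; push_cast; rfl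
      · refine Finset.prod_eq_zero (i := v c) ?_ (by rw [hv c hc, sub_self])
        exact Finset.mem_erase.2 ⟨h, mem_insert_of_mem (mem_image_of_mem v hc)⟩
    rw [sum_congr rfl h3, ← sum_filter, sum_const, nsmul_eq_mul, hz0] at h2
    have h4 : (((T.Ty l).filter fun c => v c = v c1).card : ℤ) * ∏ u ∈ U, (v c1 - u) = l * k := by
      apply Int.cast_injective (α := ℂ)
      push_cast at h2 ⊢
      rw [h2]; ring
    have hpi : Prime (l : ℤ) := Nat.prime_iff_prime_int.1 hp
    rcases hpi.dvd_or_dvd (Dvd.intro _ h4.symm) with h5 | h5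
    · have h6 := Nat.le_of_dvd (Finset.card_pos.2 ⟨c1, by simp [hc1]⟩) (Int.natCast_dvd_natCast.1 h5)
      have h7 := card_filter_le (T.Ty l) fun c => v c = v c1
      have := T.a_lt hl
      omega
    · obtain ⟨u, hu, h6⟩ := hpi.exists_mem_finset_dvd h5
      obtain ⟨hu1, hu2⟩ := Finset.mem_erase.1 hu
      rcases Finset.mem_insert.1 hu2 with rfl | hu3
      · exact hnd h6
      · obtain ⟨c, hc, rfl⟩ := Finset.mem_image.1 hu3
        exact hu1 (heq c1 hc1 c hc h6).symm
  rcases (T.Ty l).eq_empty_or_nonempty with h0 | ⟨c1, hc1⟩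
  · rw [h0]; simp
  have hall : ∀ c ∈ T.Ty l, v c = v c1 := fun c hc => heq c hc c1 hc1 (by
    obtain ⟨u, hu⟩ := (hcg c hc).sub (hcg c1 hc1)
    exact ⟨u, by linear_combination hu⟩)
  have hv0 : v c1 ≠ 0 := fun h0 => by
    have := hcg c1 hc1
    rw [h0, zero_sub, dvd_neg] at this
    exact hd (Int.natCast_dvd_natCast.1 this)
  have h1 := T.three hX (f := fun Y => ‖∑ c ∈ T.Ty l, T.ch c Y‖ ^ 2) fun _ => by positivity
  rw [T.bess hp] at h1
  have e1 : ∑ c ∈ T.Ty l, T.ch c X = (((T.Ty l).card * v c1 : ℤ) : ℂ) := by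
    rw [scr fun c hc => (hv c hc).trans (by rw [hall c hc])]; simp
  have e2 : ∑ c ∈ T.Ty l, T.ch c (T.st X) = (((T.Ty l).card * v c1 : ℤ) : ℂ) := by
    rw [scr fun c hc => (hv' c hc).trans (by rw [hall c hc])]; simp
  rw [e1, e2, T.sum_o, Complex.norm_intCast, Complex.norm_intCast, sq_abs, sq_abs] at h1
  have h2 : ((T.Ty l).card : ℤ) ^ 2 + 2 * ((T.Ty l).card * v c1) ^ 2 ≤ l * (T.Ty l).card := by
    have : ((T.Ty l).card : ℝ) ^ 2 + 2 * ((T.Ty l).card * v c1) ^ 2 ≤ l * (T.Ty l).card := by push_cast at h1; linarith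
    exact_mod_cast this
  have h3 : 1 ≤ v c1 ^ 2 := Int.add_one_le_iff.2 (sq_pos_of_ne_zero hv0)
  have h4 : (0 : ℤ) < (T.Ty l).card := by exact_mod_cast Finset.card_pos.2 ⟨c1, hc1⟩
  have h5 : (3 * (T.Ty l).card : ℤ) ≤ l := by
    refine le_of_mul_le_mul_right ?_ h4
    nlinarith [mul_le_mul_of_nonneg_left h3 (sq_nonneg ((T.Ty l).card : ℤ))]
  exact_mod_cast h5
end Tab
end

section
open ComplexConjugate
namespace Tab
variable {κ J : Type} [Fintype κ] [DecidableEq κ] [Fintype J] [DecidableEq J] {T : Tab κ J}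

lemma caseB {l : ℕ} (hl : l ∈ T.n.primeFactors) (hB : ∀ X, X ≠ T.o → ¬ l ∣ T.d X → ¬ T.Agr l X (T.st X)) : 3 * (T.Ty l).card ≤ l := by
  classical
  have hp := Nat.prime_of_mem_primeFactors hl
  set a := (T.Ty l).card with ha
  have hz : ∀ c ∈ T.Ty l, ∀ X, l ∣ T.d X → T.ch c X = 0 := fun c hc X hX => T.vanish (T.Ty_ne hp hc) (by rwa [mem_Ty.1 hc])
  have hno : T.o ∉ T.Own l := by simp [Own]
  set S := insert T.o (T.Own l) with hS
  have hmem : ∀ X, X ∉ S → l ∣ T.d X := fun X hX => by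
    simp only [hS, mem_insert, Own, mem_filter, mem_univ, true_and, not_or, not_and, not_not] at hX
    by_contra hd
    exact hB X hX.1 hd (hX.2 hX.1)
  have hcS : S.card = a + 1 := by rw [hS, card_insert_of_notMem hno, T.own_card hl]
  have hj : T.j0 ∉ T.Ty l := fun h => T.Ty_ne hp h rfl
  set C := insert T.j0 (T.Ty l) with hC
  have hcC : C.card = a + 1 := by rw [hC, card_insert_of_notMem hj]
  set D := ∑ X ∈ S, T.d X ^ 2 with hD
  have hD1 : 1 + 4 * a ≤ D := by
    rw [hD, hS, sum_insert hno, T.d_o, ha, ← T.own_card hl, mul_comm, ← smul_eq_mul]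
    refine add_le_add (by norm_num) (card_nsmul_le_sum _ _ _ fun X hX => ?_)
    simp only [Own, mem_filter] at hX
    have := T.d_two X hX.2.1
    nlinarith
  let nm : J → ℂ := fun c => if c = T.j0 then D else l
  have hnm : ∀ c, nm c ≠ 0 := fun c => by
    simp only [nm]; split_ifs
    · exact_mod_cast (by omega)
    · exact_mod_cast hp.ne_zero
  have hin : ∀ c ∈ C, ∀ c' ∈ C, ∑ X ∈ S, T.ch c X * conj (T.ch c' X) = if c = c' then nm c else 0 := fun c hc c' hc' => by
    by_cases hh : c ∈ T.Ty l ∨ c' ∈ T.Ty l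
    · rw [sum_subset (Finset.subset_univ S) fun X _ hX => by
        rcases hh with h | h
        · rw [hz c h X (hmem X hX), zero_mul]
        · rw [hz c' h X (hmem X hX), map_zero, mul_zero]]
      split_ifs with h
      · subst h
        rw [or_self] at hh
        rw [T.nf, mem_Ty.1 hh]
        simp [nm, T.Ty_ne hp hh]
      · exact T.orth c c' h
    · rw [not_or] at hh
      have e1 := (Finset.mem_insert.1 hc).resolve_right hh.1
      have e2 := (Finset.mem_insert.1 hc').resolve_right hh.2
      rw [e1, e2, if_pos rfl]
      simp [nm, T.ch_j, hD, sq]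
  let P : Matrix C S ℂ := Matrix.of fun c X => T.ch c X / nm c
  let Q : Matrix S C ℂ := Matrix.of fun X c => conj (T.ch c X)
  have hPQ : P * Q = 1 := by
    ext c c'
    rw [Matrix.mul_apply, Matrix.one_apply]
    have := sum_coe_sort S fun X => T.ch c X / nm c * conj (T.ch c' X)
    refine this.trans ?_
    have e : ∀ X, T.ch c X / nm c * conj (T.ch c' X) = (T.ch c X * conj (T.ch c' X)) / nm c := fun X => by ring
    simp only [e]
    rw [← sum_div, hin c c.2 c' c'.2]
    by_cases h : c = c'
    · rw [if_pos h, if_pos (by rw [h]), div_self (hnm _)]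
    · rw [if_neg h, if_neg fun e => h (Subtype.ext e), zero_div]
  have hQP := (Matrix.mul_eq_one_comm_of_card_eq _ _ _ (by simp only [Fintype.card_coe]; rw [hcS, hcC])).1 hPQ
  have hoS : T.o ∈ S := mem_insert_self _ _
  have h1 := congrFun (congrFun hQP ⟨T.o, hoS⟩) ⟨T.o, hoS⟩
  rw [Matrix.mul_apply, Matrix.one_apply_eq] at h1
  have h2 : ∑ c ∈ C, conj (T.ch c T.o) * (T.ch c T.o / nm c) = 1 := (sum_coe_sort C fun c => conj (T.ch c T.o) * (T.ch c T.o / nm c)).symm.trans h1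
  have h3 : ∀ c ∈ T.Ty l, conj (T.ch c T.o) * (T.ch c T.o / nm c) = 1 / l := fun c hc => by
    simp [T.ch_o, nm, T.Ty_ne hp hc]
  rw [hC, sum_insert hj, sum_congr rfl h3, sum_const, ← ha, T.ch_o] at h2
  have hl0 : (l : ℂ) ≠ 0 := by exact_mod_cast hp.ne_zero
  have hD0 : (D : ℂ) ≠ 0 := by exact_mod_cast (by omega)
  simp only [nm, if_true, map_one, one_mul, nsmul_eq_mul] at h2
  field_simp at h2
  have h4 : l + D * a = D * l := by exact_mod_cast h2
  have h5 := T.a_lt hl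
  rw [← ha] at h5
  rcases Nat.eq_zero_or_pos a with h0 | h0
  · omega
  · exfalso
    obtain ⟨e, he⟩ : ∃ e, l = a + 1 + e := ⟨l - a - 1, by omega⟩
    have h6 : a + 1 + e = D * (1 + e) := by rw [he] at h4; nlinarith
    have h7 := Nat.mul_le_mul_right (1 + e) hD1
    nlinarith

lemma tab_false (T : Tab κ J) : False := by
  have h3 : ∀ l ∈ T.n.primeFactors, 3 * (T.Ty l).card ≤ l := fun l hl => by
    by_cases h : ∃ X, X ≠ T.o ∧ ¬ l ∣ T.d X ∧ T.Agr l X (T.st X)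
    · obtain ⟨X, h1, h2, h3⟩ := h
      exact T.caseA hl h1 h2 h3
    · push Not at h
      exact T.caseB hl h
  have hs := T.a_sum
  have hc := T.card3
  have hn : ∀ l ∈ T.n.primeFactors, T.n / l * l = T.n := fun l hl => Nat.div_mul_cancel (Nat.dvd_of_mem_primeFactors hl)
  have hle : ∀ l ∈ T.n.primeFactors, 3 * (T.n / l * (T.Ty l).card) ≤ T.n := fun l hl => by
    nlinarith [hn l hl, Nat.mul_le_mul_left (T.n / l) (h3 l hl)]
  obtain ⟨l, hl, hl3⟩ : ∃ l ∈ T.n.primeFactors, l ≠ 3 := by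
    by_contra hx
    push Not at hx
    have := card_le_card (show T.n.primeFactors ⊆ {3} from fun l hl => by simpa using hx l hl)
    simp [hc] at this
  have hp := Nat.prime_of_mem_primeFactors hl
  have h4 : 3 * (T.Ty l).card + 1 ≤ l := by
    have := h3 l hl
    by_contra hlt
    have e : l = 3 * (T.Ty l).card := by omega
    exact hl3 ((Nat.prime_dvd_prime_iff_eq Nat.prime_three hp).1 (Dvd.intro _ e.symm)).symm
  have h5 : 3 * (T.n / l * (T.Ty l).card) + T.n / l ≤ T.n := by
    nlinarith [hn l hl, Nat.mul_le_mul_left (T.n / l) h4]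
  have h6 := sum_le_card_nsmul (T.n.primeFactors.erase l) _ _ fun l' hl' => hle l' (mem_of_mem_erase hl')
  rw [card_erase_of_mem hl, hc, ← mul_sum, smul_eq_mul] at h6
  rw [← Finset.add_sum_erase _ _ hl] at hs
  have h7 : T.n / l ≤ 3 := by omega
  have h8 : (T.n / l).primeFactors.card = 2 := by
    have e := (T.cop hl).primeFactors_mul
    rw [hn l hl] at e
    have e2 := congrArg Finset.card e
    rw [card_union_of_disjoint (T.cop hl).disjoint_primeFactors, hp.primeFactors, hc] at e2
    simp at e2; omega
  generalize T.n / l = x at h7 h8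
  interval_cases x
  · simp at h8
  · simp at h8
  · rw [Nat.prime_two.primeFactors] at h8; simp at h8
  · rw [Nat.prime_three.primeFactors] at h8; simp at h8
end Tab

lemma Mdl.Hyp.false {I : Type} [Fintype I] [DecidableEq I] {M : Mdl I} (h : M.Hyp) : False := by
  obtain ⟨κ, J, i1, i2, i3, i4, ⟨T⟩⟩ := M.exists_tab h
  exact T.tab_false
end

section
universe u

theorem thmM (n : ℕ) : ∀ (A : Type u) [Ring A] [HopfAlgebra ℂ A] [FiniteDimensional ℂ A] [IsSemisimpleRing A],
    finrank ℂ A = n → 1 < finrank ℂ A → Pn (finrank ℂ A) → ¬ NoChar A := by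
  induction n using Nat.strong_induction_on with
  | _ n ih =>
  intro A _ _ _ _ hn h1 hP hno
  obtain ⟨W⟩ := exists_wed A
  obtain ⟨F, hF⟩ := W.exists_fus
  have hF : W.Of F := by exact ⟨hF.1, hF.2.1, hF.2.2.1, hF.2.2.2⟩
  have hcl : ∀ L, F.Cl L → L = {F.o} ∨ L = univ := fun L hL =>
    W.cl_triv hF hP hno (fun B _ _ _ _ hB hB1 hBP => ih _ (hn ▸ hB) B rfl hB1 hBP) hL
  obtain ⟨WD⟩ := exists_wed (Db A)
  obtain ⟨M, hd, ho, hst, hN, hMn, hm⟩ := exists_mdl WD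
  have hD : WD.Of M.toFus := ⟨hd, ho, hst, hN⟩
  refine Mdl.Hyp.false (M := M) ⟨?_, ?_, ?_, ?_⟩
  · rw [hMn]; exact hP
  · rw [hMn]; exact h1
  · intro X hX; rw [hd]; exact inv_dim hF hD hno h1 hcl hX
  · intro K hK X hXK hX
    have := cl_big hF hD hno h1 hcl hK hXK hX
    rw [hMn, hd]
    refine ⟨this.1, fun h Y hY hYo => ?_⟩
    have e := hm Y
    rw [this.2 h Y hY hYo] at e
    exact_mod_cast e

lemma pn_pqr {p q r : ℕ} (hp : p.Prime) (hq : q.Prime) (hr : r.Prime) (hpq : p < q) (hqr : q < r) :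
    Pn (p * q * r) ∧ 1 < p * q * r := by
  have c1 : Nat.Coprime p q := (Nat.coprime_primes hp hq).2 hpq.ne
  have c2 : Nat.Coprime (p * q) r := Nat.Coprime.mul_left ((Nat.coprime_primes hp hr).2 (hpq.trans hqr).ne) ((Nat.coprime_primes hq hr).2 hqr.ne)
  refine ⟨⟨?_, ?_⟩, ?_⟩
  · rw [Nat.squarefree_mul c2, Nat.squarefree_mul c1]
    exact ⟨⟨hp.prime.squarefree, hq.prime.squarefree⟩, hr.prime.squarefree⟩
  · rw [c2.primeFactors_mul, c1.primeFactors_mul, hp.primeFactors, hq.primeFactors, hr.primeFactors]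
    exact (card_union_le _ _).trans (Nat.add_le_add (card_union_le _ _) le_rfl)
  · have := Nat.mul_pos (Nat.mul_pos hp.pos hq.pos) hr.pos
    nlinarith [hp.two_le, hq.two_le, hr.two_le, Nat.mul_le_mul hp.two_le hq.two_le]

theorem exists_gl (A : Type u) [Ring A] [HopfAlgebra ℂ A] [FiniteDimensional ℂ A] [IsSemisimpleRing A]
    (h1 : 1 < finrank ℂ A) (hP : Pn (finrank ℂ A)) :
    ∃ g : A, g ≠ 1 ∧ comul (R := ℂ) g = g ⊗ₜ[ℂ] g ∧ counit (R := ℂ) g = 1 := by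
  obtain ⟨W⟩ := exists_wed A
  haveI := du_ss W
  have hD := thmM _ (Du A) rfl (by rw [finrank_du]; exact h1) (by rw [finrank_du]; exact hP)
  unfold NoChar at hD
  push Not at hD
  obtain ⟨φ, f, hf⟩ := hD
  obtain ⟨g, hg⟩ := exists_ev φ.toLinearMap
  have hg : ∀ f, φ f = f g := hg
  refine ⟨g, ?_, ?_, ?_⟩
  · rintro rfl
    exact hf (hg f)
  · refine IsInt.pr_sep fun a b => ?_
    rw [pr_comul, pr_tmul, ← hg, ← hg, ← hg, map_mul]
  · have := hg 1
    rw [map_one, du_one] at this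
    exact this.symm
end

end Pqr
end

open TensorProduct in
/-- A semisimple Hopf algebra over ℂ of dimension `p * q * r` with `p < q < r` primes
contains a nontrivial group-like element and admits a nontrivial one-dimensional
representation. -/
theorem semisimple_hopf_dim_pqr_grouplike_and_char
    (p q r : ℕ) (hp : p.Prime) (hq : q.Prime) (hr : r.Prime)
    (hpq : p < q) (hqr : q < r)
    (H : Type*) [Ring H] [HopfAlgebra ℂ H]
    [FiniteDimensional ℂ H] [IsSemisimpleRing H]
    (hdim : Module.finrank ℂ H = p * q * r) :
    (∃ g : H, g ≠ 1 ∧ Coalgebra.comul (R := ℂ) g = g ⊗ₜ[ℂ] g ∧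
      Coalgebra.counit (R := ℂ) g = 1) ∧
    (∃ φ : H →ₐ[ℂ] ℂ, φ ≠ Bialgebra.counitAlgHom ℂ H) := by
  obtain ⟨hP, h1⟩ := Pqr.pn_pqr hp hq hr hpq hqr
  rw [← hdim] at hP h1
  refine ⟨Pqr.exists_gl H h1 hP, ?_⟩
  by_contra hc
  push Not at hc
  exact Pqr.thmM _ H rfl h1 hP fun φ x => by rw [hc φ]; rfl
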